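/- Let A be an A∞-algebra over ℤ and let M and N be A∞-bimodules over A which are torsion-free as abelian groups. Let f = (f_{r,s})_{r,s≥0} : M → N be a morphism of A∞-bimodules and set f₁ := f_{0,0}. If the induced map (f₁)_* : H^*(M, μ^M_{0,0}) → H^*(N, μ^N_{0,0}) is an isomorphism of graded abelian groups, then the map induced by f_* on homology, [f_*] : HH_*(A;M) → HH_*(A;N), is an isomorphism of graded abelian groups. -/

import Mathlib

namespace AInfPaper

open Finset
open scoped TensorProduct

attribute [local instance 2000] AddCommGroup.toAddCommMonoid

/-- The sign `(-1)^k` for `k : ℤ`. -/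
def sgn (k : ℤ) : ℤ := (-1) ^ k.natAbs

section

variable (R : Type) [CommRing R]

/-- `R`-multilinearity of an `n`-ary map between modules. -/
def IsMultilinear {A B : Type} [AddCommGroup A] [Module R A] [AddCommGroup B] [Module R B]
    {n : ℕ} (g : (Fin n → A) → B) : Prop :=
  (∀ (v : Fin n → A) (i : Fin n) (x y : A),
      g (Function.update v i (x + y)) = g (Function.update v i x) + g (Function.update v i y)) ∧
  (∀ (v : Fin n → A) (i : Fin n) (c : R) (x : A),
      g (Function.update v i (c • x)) = c • g (Function.update v i x))

/-- `R`-linearity in every slot of a map `A^{⊗r} ⊗ M ⊗ A^{⊗s} → N`. -/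
def IsTriMultilinear {A M N : Type} [AddCommGroup A] [Module R A] [AddCommGroup M] [Module R M]
    [AddCommGroup N] [Module R N] {r s : ℕ}
    (g : (Fin r → A) → M → (Fin s → A) → N) : Prop :=
  (∀ (x : Fin r → A) (m : M) (y : Fin s → A) (i : Fin r) (v w : A),
      g (Function.update x i (v + w)) m y
        = g (Function.update x i v) m y + g (Function.update x i w) m y) ∧
  (∀ (x : Fin r → A) (m : M) (y : Fin s → A) (i : Fin r) (c : R) (v : A),
      g (Function.update x i (c • v)) m y = c • g (Function.update x i v) m y) ∧
  (∀ (x : Fin r → A) (m₁ m₂ : M) (y : Fin s → A), g x (m₁ + m₂) y = g x m₁ y + g x m₂ y) ∧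
  (∀ (x : Fin r → A) (c : R) (m : M) (y : Fin s → A), g x (c • m) y = c • g x m y) ∧
  (∀ (x : Fin r → A) (m : M) (y : Fin s → A) (j : Fin s) (v w : A),
      g x m (Function.update y j (v + w))
        = g x m (Function.update y j v) + g x m (Function.update y j w)) ∧
  (∀ (x : Fin r → A) (m : M) (y : Fin s → A) (j : Fin s) (c : R) (v : A),
      g x m (Function.update y j (c • v)) = c • g x m (Function.update y j v))

/-- The conditions making `(gr, μ)` an `A∞`-algebra structure on `A`:
multilinearity of the operations, gradedness (`deg μₙ = 2 − n`) and the `A∞`-equations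
(on homogeneous elements, with the Koszul signs `(-1)^{✠₁^{i-1}}` computed from
the reduced degrees `‖a‖ = deg a − 1`). -/
def IsAInftyAlgebra {A : Type} [AddCommGroup A] [Module R A]
    (gr : ℤ → Submodule R A) (μ : (n : ℕ) → (Fin n → A) → A) : Prop :=
  (∀ n : ℕ, IsMultilinear R (μ n)) ∧
  (∀ (n : ℕ) (d : Fin n → ℤ) (a : Fin n → A),
      (∀ i, a i ∈ gr (d i)) → μ n a ∈ gr ((∑ i, d i) + 2 - n)) ∧
  (∀ (r : ℕ), 1 ≤ r → ∀ (d : ℕ → ℤ) (a : ℕ → A), (∀ q, q < r → a q ∈ gr (d q)) →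
    ∑ n₁ ∈ Finset.Icc 1 r, ∑ i ∈ Finset.range (r + 1 - n₁),
      sgn (∑ q ∈ Finset.range i, (d q - 1)) •
        μ (r + 1 - n₁) (fun j =>
          if (j : ℕ) < i then a (j : ℕ)
          else if (j : ℕ) = i then μ n₁ (fun k => a (i + (k : ℕ)))
          else a ((j : ℕ) + n₁ - 1)) = 0)

/-- The conditions making `(grM, μM)` an `A∞`-bimodule over the `A∞`-algebra `(gr, μ)`:
multilinearity, gradedness (`deg μM_{r,s} = 1 − r − s`) and the defining equations of
type `(r,s)` evaluated on homogeneous elements `a_1, …, a_{r+s}` (stored as `a 0, …,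
a (r+s-1)` of degrees `d 0, …`) and `m` of degree `dm`. -/
def IsAInftyBimodule {A M : Type} [AddCommGroup A] [Module R A] [AddCommGroup M] [Module R M]
    (gr : ℤ → Submodule R A) (μ : (n : ℕ) → (Fin n → A) → A)
    (grM : ℤ → Submodule R M)
    (μM : (r s : ℕ) → (Fin r → A) → M → (Fin s → A) → M) : Prop :=
  (∀ r s : ℕ, IsTriMultilinear R (μM r s)) ∧
  (∀ (r s : ℕ) (dx : Fin r → ℤ) (dm : ℤ) (dy : Fin s → ℤ)
      (x : Fin r → A) (m : M) (y : Fin s → A),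
      (∀ i, x i ∈ gr (dx i)) → m ∈ grM dm → (∀ j, y j ∈ gr (dy j)) →
      μM r s x m y ∈ grM ((∑ i, dx i) + dm + (∑ j, dy j) + 1 - r - s)) ∧
  (∀ (r s : ℕ) (d : ℕ → ℤ) (dm : ℤ) (a : ℕ → A) (m : M),
      (∀ q, q < r + s → a q ∈ gr (d q)) → m ∈ grM dm →
      (∑ r₂ ∈ Finset.Icc 1 r, ∑ i ∈ Finset.range (r + 1 - r₂),
          sgn (∑ q ∈ Finset.range i, (d q - 1)) •
            μM (r + 1 - r₂) s
              (fun j => if (j : ℕ) < i then a (j : ℕ)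
                else if (j : ℕ) = i then μ r₂ (fun k => a (i + (k : ℕ)))
                else a ((j : ℕ) + r₂ - 1))
              m (fun j => a (r + (j : ℕ))))
      + (∑ r₁ ∈ Finset.range (r + 1), ∑ s₁ ∈ Finset.range (s + 1),
          sgn (∑ q ∈ Finset.range r₁, (d q - 1)) •
            μM r₁ s₁ (fun j => a (j : ℕ))
              (μM (r - r₁) (s - s₁) (fun j => a (r₁ + (j : ℕ))) m (fun j => a (r + (j : ℕ))))
              (fun j => a (r + (s - s₁) + (j : ℕ))))
      + (∑ s₂ ∈ Finset.Icc 1 s, ∑ i ∈ Finset.range (s + 1 - s₂),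
          sgn ((∑ q ∈ Finset.range (r + i), (d q - 1)) + dm) •
            μM r (s + 1 - s₂) (fun k => a (k : ℕ)) m
              (fun k => if (k : ℕ) < i then a (r + (k : ℕ))
                else if (k : ℕ) = i then μ s₂ (fun t => a (r + i + (t : ℕ)))
                else a (r + (k : ℕ) + s₂ - 1))) = 0)

/-- The conditions making a family `f = (f_{r,s})` a morphism of `A∞`-bimodules
`M → N` over `(gr, μ)` of degree `dg`. -/
def IsBimoduleMorphism {A M N : Type} [AddCommGroup A] [Module R A] [AddCommGroup M] [Module R M]
    [AddCommGroup N] [Module R N]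
    (gr : ℤ → Submodule R A) (μ : (n : ℕ) → (Fin n → A) → A)
    (grM : ℤ → Submodule R M) (μM : (r s : ℕ) → (Fin r → A) → M → (Fin s → A) → M)
    (grN : ℤ → Submodule R N) (μN : (r s : ℕ) → (Fin r → A) → N → (Fin s → A) → N)
    (dg : ℤ)
    (f : (r s : ℕ) → (Fin r → A) → M → (Fin s → A) → N) : Prop :=
  (∀ r s : ℕ, IsTriMultilinear R (f r s)) ∧
  (∀ (r s : ℕ) (dx : Fin r → ℤ) (dm : ℤ) (dy : Fin s → ℤ)
      (x : Fin r → A) (m : M) (y : Fin s → A),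
      (∀ i, x i ∈ gr (dx i)) → m ∈ grM dm → (∀ j, y j ∈ gr (dy j)) →
      f r s x m y ∈ grN ((∑ i, dx i) + dm + (∑ j, dy j) + dg - r - s)) ∧
  (∀ (r s : ℕ) (d : ℕ → ℤ) (dm : ℤ) (a : ℕ → A) (m : M),
      (∀ q, q < r + s → a q ∈ gr (d q)) → m ∈ grM dm →
      (∑ r₁ ∈ Finset.range (r + 1), ∑ s₁ ∈ Finset.range (s + 1),
          sgn (dg * ∑ q ∈ Finset.range r₁, (d q - 1)) •
            μN r₁ s₁ (fun j => a (j : ℕ))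
              (f (r - r₁) (s - s₁) (fun j => a (r₁ + (j : ℕ))) m (fun j => a (r + (j : ℕ))))
              (fun j => a (r + (s - s₁) + (j : ℕ))))
      = (∑ r₂ ∈ Finset.Icc 1 r, ∑ i ∈ Finset.range (r + 1 - r₂),
          sgn ((∑ q ∈ Finset.range i, (d q - 1)) + dg) •
            f (r + 1 - r₂) s
              (fun j => if (j : ℕ) < i then a (j : ℕ)
                else if (j : ℕ) = i then μ r₂ (fun k => a (i + (k : ℕ)))
                else a ((j : ℕ) + r₂ - 1))
              m (fun j => a (r + (j : ℕ))))
      + (∑ r₁ ∈ Finset.range (r + 1), ∑ s₁ ∈ Finset.range (s + 1),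
          sgn ((∑ q ∈ Finset.range r₁, (d q - 1)) + dg) •
            f r₁ s₁ (fun j => a (j : ℕ))
              (μM (r - r₁) (s - s₁) (fun j => a (r₁ + (j : ℕ))) m (fun j => a (r + (j : ℕ))))
              (fun j => a (r + (s - s₁) + (j : ℕ))))
      + (∑ s₂ ∈ Finset.Icc 1 s, ∑ i ∈ Finset.range (s + 1 - s₂),
          sgn ((∑ q ∈ Finset.range (r + i), (d q - 1)) + dm + dg) •
            f r (s + 1 - s₂) (fun k => a (k : ℕ)) m
              (fun k => if (k : ℕ) < i then a (r + (k : ℕ))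
                else if (k : ℕ) = i then μ s₂ (fun t => a (r + i + (t : ℕ)))
                else a (r + (k : ℕ) + s₂ - 1))))

/-- Concatenation `(a_1,…,a_r, a₀, a_{r+1},…,a_{r+s})` of two blocks of elements
around a middle element. -/
def cat3 {A : Type} (r s : ℕ) (x : Fin r → A) (a₀ : A) (y : Fin s → A)
    (k : Fin (r + 1 + s)) : A :=
  if h : (k : ℕ) < r then x ⟨k, h⟩
  else if h2 : (k : ℕ) = r then a₀
  else y ⟨(k : ℕ) - (r + 1), by have := k.isLt; omega⟩


/-- The `n`-th summand `M ⊗ A^{⊗n}` of the Hochschild chain complex. -/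
abbrev HTens (A M : Type) [AddCommGroup A] [Module R A] [AddCommGroup M] [Module R M]
    (n : ℕ) : Type :=
  M ⊗[R] (PiTensorProduct R (fun _ : Fin n => A))

/-- The Hochschild chain module `CH_*(A;M) = ⊕ₙ M ⊗ A^{⊗n}`. -/
abbrev HChain (A M : Type) [AddCommGroup A] [Module R A] [AddCommGroup M] [Module R M] : Type :=
  DirectSum ℕ (fun n => HTens R A M n)

/-- The elementary Hochschild chain `m ⊗ a_1 ⊗ ⋯ ⊗ a_n` (the `a`'s are `a 0, …, a (n-1)`). -/
noncomputable def hchElt {A M : Type} [AddCommGroup A] [Module R A] [AddCommGroup M] [Module R M]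
    (n : ℕ) (m : M) (a : ℕ → A) : HChain R A M :=
  DirectSum.lof R ℕ (fun k => HTens R A M k) n
    (m ⊗ₜ[R] PiTensorProduct.tprod R (fun i : Fin n => a (i : ℕ)))

/-- The component `b_{i,l}` of the Hochschild differential, evaluated on the homogeneous
elementary chain `m ⊗ a_1 ⊗ ⋯ ⊗ a_n` where `m` has degree `dm` and `a_{q+1}` has degree
`d q`.  Here `i ∈ {0,…,n}` and `l ∈ {1,…,n+1}` as in the paper; the result is an
elementary chain in `M ⊗ A^{⊗(n-l+1)}` with the appropriate Koszul sign. -/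
noncomputable def bComp {A M : Type} [AddCommGroup A] [Module R A] [AddCommGroup M] [Module R M]
    (μ : (n : ℕ) → (Fin n → A) → A)
    (μM : (r s : ℕ) → (Fin r → A) → M → (Fin s → A) → M)
    (n i l : ℕ) (dm : ℤ) (d : ℕ → ℤ) (m : M) (a : ℕ → A) : HChain R A M :=
  if 1 ≤ l ∧ l ≤ n + 1 ∧ i ≤ n then
    (if i = 0 then
      DirectSum.lof R ℕ (fun k => HTens R A M k) (n + 1 - l)
        ((μM 0 (l - 1) (fun k => a (k : ℕ)) m (fun k => a (k : ℕ))) ⊗ₜ[R]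
          PiTensorProduct.tprod R (fun q : Fin (n + 1 - l) => a (l - 1 + (q : ℕ))))
    else if i + l ≤ n + 1 then
      sgn (dm + ∑ q ∈ Finset.range (i - 1), (d q - 1)) •
        DirectSum.lof R ℕ (fun k => HTens R A M k) (n + 1 - l)
          (m ⊗ₜ[R] PiTensorProduct.tprod R (fun j : Fin (n + 1 - l) =>
            if (j : ℕ) < i - 1 then a (j : ℕ)
            else if (j : ℕ) = i - 1 then μ l (fun k => a (i - 1 + (k : ℕ)))
            else a ((j : ℕ) + l - 1)))
    else
      sgn ((dm + ∑ q ∈ Finset.range (i - 1), (d q - 1)) *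
            (∑ q ∈ Finset.Ico (i - 1) n, (d q - 1))) •
        DirectSum.lof R ℕ (fun k => HTens R A M k) (n + 1 - l)
          ((μM (n - i + 1) (i + l - n - 2) (fun k => a (i - 1 + (k : ℕ))) m
              (fun k => a (k : ℕ))) ⊗ₜ[R]
            PiTensorProduct.tprod R (fun j : Fin (n + 1 - l) => a (l + i - n - 2 + (j : ℕ)))))
  else 0

/-- `b` is the Hochschild differential of `(gr,μ,grM,μM)`: on every homogeneous elementary
chain it is given by the sum of the components `b_{i,l}`. -/
def IsHochschildB {A M : Type} [AddCommGroup A] [Module R A] [AddCommGroup M] [Module R M]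
    (gr : ℤ → Submodule R A) (μ : (n : ℕ) → (Fin n → A) → A)
    (grM : ℤ → Submodule R M) (μM : (r s : ℕ) → (Fin r → A) → M → (Fin s → A) → M)
    (b : HChain R A M →ₗ[R] HChain R A M) : Prop :=
  ∀ (n : ℕ) (dm : ℤ) (d : ℕ → ℤ) (m : M) (a : ℕ → A),
    m ∈ grM dm → (∀ q, q < n → a q ∈ gr (d q)) →
    b (hchElt R n m a)
      = ∑ l ∈ Finset.Icc 1 (n + 1), ∑ i ∈ Finset.range (n + 1),
          bComp R μ μM n i l dm d m a

/-- The degree-`j` part `CH_j(A;M)` of the Hochschild chain module: the span of the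
homogeneous elementary chains `m ⊗ a_1 ⊗ ⋯ ⊗ a_n` of degree
`n − μ(m) − Σ μ(a_q) = −μ(m) − Σ ‖a_q‖ = j`. -/
noncomputable def hchDeg {A M : Type} [AddCommGroup A] [Module R A] [AddCommGroup M] [Module R M]
    (gr : ℤ → Submodule R A) (grM : ℤ → Submodule R M) (j : ℤ) :
    Submodule R (HChain R A M) :=
  Submodule.span R {x | ∃ (n : ℕ) (dm : ℤ) (d : ℕ → ℤ) (m : M) (a : ℕ → A),
    m ∈ grM dm ∧ (∀ q, q < n → a q ∈ gr (d q)) ∧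
    (-dm - ∑ q ∈ Finset.range n, (d q - 1)) = j ∧ x = hchElt R n m a}

/-- The length filtration `F_p CH_*(A;M) = ⊕_{n ≤ p} M ⊗ A^{⊗n}` (`= 0` for `p < 0`). -/
noncomputable def hchFilt {A M : Type} [AddCommGroup A] [Module R A] [AddCommGroup M] [Module R M]
    (p : ℤ) : Submodule R (HChain R A M) :=
  ⨆ (n : ℕ) (_ : (n : ℤ) ≤ p), LinearMap.range (DirectSum.lof R ℕ (fun k => HTens R A M k) n)

/-- The length filtration indexed by `ℕ∞ = ℕ ∪ {∞}`, with `F_∞ = CH_*(A;M)`. -/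
noncomputable def hchFiltE {A M : Type} [AddCommGroup A] [Module R A] [AddCommGroup M] [Module R M]
    (p : WithTop ℕ) : Submodule R (HChain R A M) :=
  ⨆ (n : ℕ) (_ : (n : WithTop ℕ) ≤ p), LinearMap.range (DirectSum.lof R ℕ (fun k => HTens R A M k) n)

/-- `b1` is the family of maps `b₁ : M ⊗ A^{⊗n} → M ⊗ A^{⊗n}` built from the
operations with exactly one input (`μ₁` and `μM_{0,0}`). -/
def IsB1 {A M : Type} [AddCommGroup A] [Module R A] [AddCommGroup M] [Module R M]
    (gr : ℤ → Submodule R A) (μ : (n : ℕ) → (Fin n → A) → A)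
    (grM : ℤ → Submodule R M) (μM : (r s : ℕ) → (Fin r → A) → M → (Fin s → A) → M)
    (b1 : (k : ℕ) → HTens R A M k →ₗ[R] HTens R A M k) : Prop :=
  ∀ (n : ℕ) (dm : ℤ) (d : ℕ → ℤ) (m : M) (a : ℕ → A),
    m ∈ grM dm → (∀ q, q < n → a q ∈ gr (d q)) →
    DirectSum.lof R ℕ (fun k => HTens R A M k) n
        (b1 n (m ⊗ₜ[R] PiTensorProduct.tprod R (fun i : Fin n => a (i : ℕ))))
      = ∑ i ∈ Finset.range (n + 1), bComp R μ μM n i 1 dm d m a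

/-- The formula for the Hochschild chain map `f_*` induced by a morphism of
`A∞`-bimodules `f = (f_{r,s}) : M → N` of degree `dg`, evaluated on a homogeneous
elementary chain. -/
noncomputable def fstarFormula {A M N : Type} [AddCommGroup A] [Module R A] [AddCommGroup M] [Module R M]
    [AddCommGroup N] [Module R N]
    (f : (r s : ℕ) → (Fin r → A) → M → (Fin s → A) → N) (dg : ℤ)
    (n : ℕ) (dm : ℤ) (d : ℕ → ℤ) (m : M) (a : ℕ → A) : HChain R A N :=
  ∑ r ∈ Finset.range (n + 1), ∑ s ∈ Finset.range (n + 1 - r),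
    sgn ((dm + ∑ q ∈ Finset.range (n - r), (d q - 1)) * (∑ q ∈ Finset.Ico (n - r) n, (d q - 1))
          + dg * (-dm - ∑ q ∈ Finset.range n, (d q - 1))) •
      DirectSum.lof R ℕ (fun k => HTens R A N k) (n - r - s)
        ((f r s (fun k => a (n - r + (k : ℕ))) m (fun k => a (k : ℕ))) ⊗ₜ[R]
          PiTensorProduct.tprod R (fun j : Fin (n - r - s) => a (s + (j : ℕ))))

/-- `F` is the Hochschild chain map induced by `f`. -/
def IsFStar {A M N : Type} [AddCommGroup A] [Module R A] [AddCommGroup M] [Module R M]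
    [AddCommGroup N] [Module R N]
    (gr : ℤ → Submodule R A) (grM : ℤ → Submodule R M)
    (f : (r s : ℕ) → (Fin r → A) → M → (Fin s → A) → N) (dg : ℤ)
    (F : HChain R A M →ₗ[R] HChain R A N) : Prop :=
  ∀ (n : ℕ) (dm : ℤ) (d : ℕ → ℤ) (m : M) (a : ℕ → A),
    m ∈ grM dm → (∀ q, q < n → a q ∈ gr (d q)) →
    F (hchElt R n m a) = fstarFormula R f dg n dm d m a


/-- The degree-`j` part of the graded dual of a graded module: those functionals which
vanish on `grV i` for every `i ≠ j`. -/
def dualGrade {V : Type} [AddCommMonoid V] [Module R V]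
    (grV : ℤ → Submodule R V) (j : ℤ) : Submodule R (Module.Dual R V) where
  carrier := {φ | ∀ i : ℤ, i ≠ j → ∀ v ∈ grV i, φ v = 0}
  add_mem' := by
    intro φ ψ hφ hψ i hi v hv
    simp [hφ i hi v hv, hψ i hi v hv]
  zero_mem' := by intro i hi v hv; simp
  smul_mem' := by
    intro c φ hφ i hi v hv
    simp [hφ i hi v hv]

/-- `μStar` is the family of structure maps of the dual `A∞`-bimodule `M^{-*}`:
tri-multilinear maps which, on homogeneous elements, are given by Tradler's formula with
the sign `(-1)^{‡_{r,s}}`.  Here a functional of degree `k` in `M^{-*}` is one that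
vanishes on `grM i` for `i ≠ -k`. -/
def IsDualOps {A M : Type} [AddCommGroup A] [Module R A] [AddCommGroup M] [Module R M]
    (gr : ℤ → Submodule R A) (grM : ℤ → Submodule R M)
    (μM : (r s : ℕ) → (Fin r → A) → M → (Fin s → A) → M)
    (μStar : (r s : ℕ) → (Fin r → A) → Module.Dual R M → (Fin s → A) → Module.Dual R M) :
    Prop :=
  (∀ r s : ℕ, IsTriMultilinear R (μStar r s)) ∧
  (∀ (r s : ℕ) (dx : Fin r → ℤ) (k : ℤ) (dy : Fin s → ℤ) (dm : ℤ)
      (x : Fin r → A) (φ : Module.Dual R M) (y : Fin s → A) (m : M),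
      (∀ i, x i ∈ gr (dx i)) → φ ∈ dualGrade R grM (-k) → (∀ j, y j ∈ gr (dy j)) →
      m ∈ grM dm →
      μStar r s x φ y m
        = sgn (((∑ i, dx i) - r) * (((∑ j, dy j) - s) + k + dm) + k + 1) •
            φ (μM s r y m x))

/-- The Hochschild cochain module `CH^*(A;P) = Πₙ Hom(A^{⊗n}, P)`, with `Hom(A^{⊗n},P)`
realized as `n`-multilinear maps. -/
abbrev HCochain (A P : Type) [AddCommGroup A] [Module R A] [AddCommGroup P] [Module R P] :
    Type :=
  (n : ℕ) → MultilinearMap R (fun _ : Fin n => A) P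

/-- The degree-`j` part `CH^j(A;P) = Πₙ Hom^{j-n}(A^{⊗n},P)` of the Hochschild cochain
module. -/
def ccDeg {A P : Type} [AddCommGroup A] [Module R A] [AddCommGroup P] [Module R P]
    (gr : ℤ → Submodule R A) (grP : ℤ → Submodule R P) (j : ℤ) :
    Submodule R (HCochain R A P) where
  carrier := {c | ∀ (n : ℕ) (dFin : Fin n → ℤ) (a : Fin n → A),
      (∀ i, a i ∈ gr (dFin i)) → c n a ∈ grP ((∑ i, dFin i) + (j - n))}
  add_mem' := by
    intro c c' hc hc' n dFin a ha
    have h : (c + c') n a = c n a + c' n a := rfl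
    rw [h]
    exact (grP _).add_mem (hc n dFin a ha) (hc' n dFin a ha)
  zero_mem' := by
    intro n dFin a ha
    have h : (0 : HCochain R A P) n a = 0 := rfl
    rw [h]
    exact (grP _).zero_mem
  smul_mem' := by
    intro t c hc n dFin a ha
    have h : (t • c) n a = t • c n a := rfl
    rw [h]
    exact (grP _).smul_mem t (hc n dFin a ha)

/-- `β` is the Hochschild codifferential on `CH^*(A;P)` for the coefficient
`A∞`-bimodule `(grP, μP)`: its value on a cochain which is homogeneous of degree `j` is
given componentwise on homogeneous elements by the defining formula. -/
def IsCodiff {A P : Type} [AddCommGroup A] [Module R A] [AddCommGroup P] [Module R P]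
    (gr : ℤ → Submodule R A) (μ : (n : ℕ) → (Fin n → A) → A)
    (grP : ℤ → Submodule R P)
    (μP : (r s : ℕ) → (Fin r → A) → P → (Fin s → A) → P)
    (β : HCochain R A P →ₗ[R] HCochain R A P) : Prop :=
  ∀ (c : HCochain R A P) (j : ℤ),
    (∀ (n : ℕ) (dFin : Fin n → ℤ) (a : Fin n → A), (∀ i, a i ∈ gr (dFin i)) →
        c n a ∈ grP ((∑ i, dFin i) + (j - n))) →
    ∀ (L : ℕ) (d : ℕ → ℤ) (a : ℕ → A), (∀ q, q < L → a q ∈ gr (d q)) →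
      β c L (fun i : Fin L => a (i : ℕ))
        = ∑ l ∈ Finset.range (L + 1),
            ((∑ i ∈ Finset.range (L - l),
                sgn (∑ q ∈ Finset.range i, (d q - 1)) •
                  c (L - l) (fun t : Fin (L - l) =>
                    if (t : ℕ) < i then a (t : ℕ)
                    else if (t : ℕ) = i then μ (l + 1) (fun k => a (i + (k : ℕ)))
                    else a ((t : ℕ) + l)))
              + ∑ i ∈ Finset.range (l + 1),
                  sgn (j * ((∑ q ∈ Finset.range i, (d q - 1)) + 1) + 1) •
                    μP i (l - i) (fun k => a (k : ℕ))
                      (c (L - l) (fun k : Fin (L - l) => a (i + (k : ℕ))))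
                      (fun k => a ((L - l) + i + (k : ℕ))))


/-- `Φ` is the duality map `φ : Hom(CH_*(A;M),R) → CH^*(A;M^{-*})`, characterized on
homogeneous elements by `(φ(g)(a_1,…,a_n))(m) = (-1)^{μ(m)·✠₁ⁿ} g(m ⊗ a_1 ⊗ ⋯ ⊗ a_n)`. -/
def IsPhi {A M : Type} [AddCommGroup A] [Module R A] [AddCommGroup M] [Module R M]
    (gr : ℤ → Submodule R A) (grM : ℤ → Submodule R M)
    (Φ : Module.Dual R (HChain R A M) →ₗ[R] HCochain R A (Module.Dual R M)) : Prop :=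
  ∀ (g : Module.Dual R (HChain R A M)) (n : ℕ) (dm : ℤ) (d : ℕ → ℤ) (m : M) (a : ℕ → A),
    m ∈ grM dm → (∀ q, q < n → a q ∈ gr (d q)) →
    Φ g n (fun i : Fin n => a (i : ℕ)) m
      = sgn (dm * ∑ q ∈ Finset.range n, (d q - 1)) • g (hchElt R n m a)

end

section Tagged

variable {A M : Type} [AddCommGroup A] [AddCommGroup M]

/-- A degree-tagged element obtained by applying `μ_l` to tagged elements. -/
def tagMu (μ : (n : ℕ) → (Fin n → A) → A) (l : ℕ) (v : Fin l → ℤ × A) : ℤ × A :=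
  ((∑ i, (v i).1) + 2 - l, μ l (fun i => (v i).2))

/-- Extension of a finite tagged tuple by zero. -/
def pad {k : ℕ} (w : Fin k → ℤ × A) : ℕ → ℤ × A :=
  fun q => if h : q < k then w ⟨q, h⟩ else (0, 0)

/-- The component `(β(f))_l` of the Hochschild codifferential with coefficients in the
`A∞`-bimodule `(M, μM)`, for a (degree-tagged) cochain `f` of arity `nf` and cochain
degree `j`, evaluated on the tagged elements `v 0, …, v (nf+l-1)`. -/
def betaT (μ : (n : ℕ) → (Fin n → A) → A)
    (μM : (r s : ℕ) → (Fin r → A) → M → (Fin s → A) → M)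
    (j : ℤ) (nf : ℕ) (f : (Fin nf → ℤ × A) → M) (l : ℕ) (v : ℕ → ℤ × A) : M :=
  (∑ i ∈ Finset.range nf,
      sgn (∑ q ∈ Finset.range i, ((v q).1 - 1)) •
        f (fun t => if (t : ℕ) < i then v (t : ℕ)
            else if (t : ℕ) = i then tagMu μ (l + 1) (fun k => v (i + (k : ℕ)))
            else v ((t : ℕ) + l)))
  + ∑ i ∈ Finset.range (l + 1),
      sgn (j * ((∑ q ∈ Finset.range i, ((v q).1 - 1)) + 1) + 1) •
        μM i (l - i) (fun k => (v (k : ℕ)).2)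
          (f (fun k => v (i + (k : ℕ))))
          (fun k => (v (nf + i + (k : ℕ))).2)

/-- The component `(β(f))_l` of the Hochschild codifferential of `CH^*(A)`, i.e. with
coefficients in `A[1]` (so `μ^{A[1]}_{i-1,l-i+1} = μ_{l+1}` and the second sign uses
`deg f − 1`), for a tagged cochain `f` of arity `nf` and `CH^*(A)`-degree `j`. -/
def betaShift (μ : (n : ℕ) → (Fin n → A) → A)
    (j : ℤ) (nf : ℕ) (f : (Fin nf → ℤ × A) → A) (l : ℕ) (v : ℕ → ℤ × A) : A :=
  (∑ i ∈ Finset.range nf,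
      sgn (∑ q ∈ Finset.range i, ((v q).1 - 1)) •
        f (fun t => if (t : ℕ) < i then v (t : ℕ)
            else if (t : ℕ) = i then tagMu μ (l + 1) (fun k => v (i + (k : ℕ)))
            else v ((t : ℕ) + l)))
  + ∑ i ∈ Finset.range (l + 1),
      sgn ((j - 1) * ((∑ q ∈ Finset.range i, ((v q).1 - 1)) + 1) + 1) •
        μ (l + 1) (fun t =>
          if (t : ℕ) < i then (v (t : ℕ)).2
          else if (t : ℕ) = i then f (fun k => v (i + (k : ℕ)))
          else (v (nf + (t : ℕ) - 1)).2)

/-- The summand `f ∪_{k,j₁,j₂} g` of the Hochschild cup product of (tagged) cochains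
`f ∈ Hom(A^{⊗m},A)` of degree `jf` and `g ∈ Hom(A^{⊗n},A)` of degree `jg`, evaluated on
the tagged elements `v 0, …, v (m+n+k-1)`, with the sign `(-1)^{℧_{j₁,j₂}}`. -/
def cupT (μ : (n : ℕ) → (Fin n → A) → A) (jf jg : ℤ) (m n : ℕ)
    (f : (Fin m → ℤ × A) → A) (g : (Fin n → ℤ × A) → A)
    (k j₁ j₂ : ℕ) (v : ℕ → ℤ × A) : A :=
  sgn ((jf - 1) * (∑ q ∈ Finset.range (j₁ - 1), ((v q).1 - 1))
       + (jg - 1) * ((∑ q ∈ Finset.range (j₂ - 1), ((v q).1 - 1)) + jf)) •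
    μ (k + 2) (fun t =>
      if (t : ℕ) < j₁ - 1 then (v (t : ℕ)).2
      else if (t : ℕ) = j₁ - 1 then f (fun k' => v (j₁ - 1 + (k' : ℕ)))
      else if (t : ℕ) < j₂ - m then (v ((t : ℕ) + m - 1)).2
      else if (t : ℕ) = j₂ - m then g (fun k' => v (j₂ - 1 + (k' : ℕ)))
      else (v ((t : ℕ) + m + n - 2)).2)

/-- The component of arity `m+n+k` of the full cup product `f ∪ g`. -/
def cupComp (μ : (n : ℕ) → (Fin n → A) → A) (jf jg : ℤ) (m n : ℕ)
    (f : (Fin m → ℤ × A) → A) (g : (Fin n → ℤ × A) → A)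
    (k : ℕ) (v : ℕ → ℤ × A) : A :=
  ∑ j₁ ∈ Finset.Icc 1 (n + k), ∑ j₂ ∈ Finset.Icc (j₁ + m) (m + k + 1),
    cupT μ jf jg m n f g k j₁ j₂ v

end Tagged

section Signs

/-- The Maltese sum `✠_i^j` of the tuple `m ⊗ a_1 ⊗ ⋯` (with `μ(m) = dm`, `μ(a_{q+1}) = d q`),
where the lower index `i ≤ 0` means that the `m`-slot is included (contributing `μ(m)`),
and the `a`-entries contribute their reduced degrees. -/
def malZ (dm : ℤ) (d : ℕ → ℤ) (i j : ℤ) : ℤ :=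
  (if i ≤ 0 then dm else 0) + ∑ q ∈ Finset.Ico (i - 1).toNat j.toNat, (d q - 1)

/-- The sign exponent `*_i = ✠_0^i · ✠_{i+1}^n` of a tuple `m ⊗ a_1 ⊗ ⋯ ⊗ a_n`. -/
def starZ (dm : ℤ) (d : ℕ → ℤ) (n : ℕ) (i : ℤ) : ℤ :=
  malZ dm d 0 i * malZ dm d (i + 1) (n : ℤ)

/-- The degree of the `M`-slot of `b_{i,l}(m ⊗ a_1 ⊗ ⋯ ⊗ a_n)`. -/
def bDm (n i l : ℕ) (dm : ℤ) (d : ℕ → ℤ) : ℤ :=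
  if i = 0 then dm + (∑ q ∈ Finset.range (l - 1), d q) + 2 - l
  else if i + l ≤ n + 1 then dm
  else dm + (∑ q ∈ Finset.Ico (i - 1) n, d q) + (∑ q ∈ Finset.range (i + l - n - 2), d q) + 2 - l

/-- The degrees of the `A`-entries of `b_{i,l}(m ⊗ a_1 ⊗ ⋯ ⊗ a_n)`. -/
def bD (n i l : ℕ) (d : ℕ → ℤ) : ℕ → ℤ := fun q =>
  if i = 0 then d (q + l - 1)
  else if i + l ≤ n + 1 then
    (if q < i - 1 then d q
     else if q = i - 1 then (∑ k ∈ Finset.range l, d (i - 1 + k)) + 2 - l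
     else d (q + l - 1))
  else d (l + i - n - 2 + q)

/-- The cup-product sign exponent `℧_{j₁,j₂}(f,g,a_1,…)` for cochains of degrees
`jf` and `jg`, computed from the degrees `e q` of the inputs `a_{q+1}`. -/
def mho (jf jg : ℤ) (j₁ j₂ : ℕ) (e : ℕ → ℤ) : ℤ :=
  (jf - 1) * (∑ q ∈ Finset.range (j₁ - 1), (e q - 1))
    + (jg - 1) * ((∑ q ∈ Finset.range (j₂ - 1), (e q - 1)) + jf)

/-- The degrees of the sequence obtained from `a_1, a_2, …` (of degrees `e 0, e 1, …`)
by replacing `a_i, …, a_{i+l}` with `μ_{l+1}(a_i,…,a_{i+l})`. -/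
def insD (e : ℕ → ℤ) (i l : ℕ) : ℕ → ℤ := fun q =>
  if q < i - 1 then e q
  else if q = i - 1 then (∑ k ∈ Finset.range (l + 1), e (i - 1 + k)) + 1 - l
  else e (q + l)

end Signs

section Deconcatenation

variable {α β Z Z' : Type*} [AddCommGroup Z] [AddCommGroup Z']

/-- The sum of `φ u v` over all factorizations `L = u ++ v`. -/
def splitSum : List α → (List α → List α → Z) → Z
  | [], φ => φ [] []
  | a :: L, φ => φ [] (a :: L) + splitSum L (fun u v => φ (a :: u) v)

/-- The sum of `φ u v w` over all factorizations `L = u ++ v ++ w`. -/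
def splitSum₃ (L : List α) (φ : List α → List α → List α → Z) : Z :=
  splitSum L fun u x => splitSum x fun v w => φ u v w

theorem splitSum_congr {L : List α} {φ ψ : List α → List α → Z}
    (h : ∀ u v, u ++ v = L → φ u v = ψ u v) : splitSum L φ = splitSum L ψ := by
  induction L generalizing φ ψ with
  | nil => exact h [] [] rfl
  | cons a L ih =>
    simp only [splitSum]
    rw [h [] (a :: L) rfl, ih fun u v huv => h (a :: u) v (by simp [huv])]

theorem splitSum₃_congr {L : List α} {φ ψ : List α → List α → List α → Z}
    (h : ∀ u v w, u ++ (v ++ w) = L → φ u v w = ψ u v w) : splitSum₃ L φ = splitSum₃ L ψ :=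
  splitSum_congr fun u x hux => splitSum_congr fun v w hvw => h u v w (by rw [hvw, hux])

theorem map_splitSum (F : Z →+ Z') (L : List α) (φ : List α → List α → Z) :
    F (splitSum L φ) = splitSum L fun u v => F (φ u v) := by
  induction L generalizing φ with
  | nil => rfl
  | cons a L ih => simp only [splitSum, map_add, ih]

theorem map_splitSum₃ (F : Z →+ Z') (L : List α) (φ : List α → List α → List α → Z) :
    F (splitSum₃ L φ) = splitSum₃ L fun u v w => F (φ u v w) := by
  simp only [splitSum₃, map_splitSum]

theorem splitSum_zero (L : List α) : splitSum L (fun _ _ => (0 : Z)) = 0 := by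
  induction L with
  | nil => rfl
  | cons a L ih => simp only [splitSum, ih, add_zero]

theorem splitSum_add (L : List α) (φ ψ : List α → List α → Z) :
    (splitSum L fun u v => φ u v + ψ u v) = splitSum L φ + splitSum L ψ := by
  induction L generalizing φ ψ with
  | nil => rfl
  | cons a L ih => simp only [splitSum, ih]; abel

theorem smul_splitSum (c : ℤ) (L : List α) (φ : List α → List α → Z) :
    c • splitSum L φ = splitSum L fun u v => c • φ u v :=
  map_splitSum (zsmulAddGroupHom c) L φ

theorem splitSum₃_zero (L : List α) : splitSum₃ L (fun _ _ _ => (0 : Z)) = 0 := by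
  simp only [splitSum₃, splitSum_zero]

theorem splitSum₃_add (L : List α) (φ ψ : List α → List α → List α → Z) :
    (splitSum₃ L fun u v w => φ u v w + ψ u v w) = splitSum₃ L φ + splitSum₃ L ψ := by
  simp only [splitSum₃, splitSum_add]

theorem smul_splitSum₃ (c : ℤ) (L : List α) (φ : List α → List α → List α → Z) :
    c • splitSum₃ L φ = splitSum₃ L fun u v w => c • φ u v w :=
  map_splitSum₃ (zsmulAddGroupHom c) L φ

theorem splitSum_comm (L : List α) (K : List β)
    (φ : List α → List α → List β → List β → Z) :
    (splitSum L fun u v => splitSum K fun x y => φ u v x y)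
      = splitSum K fun x y => splitSum L fun u v => φ u v x y := by
  induction L generalizing φ with
  | nil => rfl
  | cons a L ih => simp only [splitSum, ih, splitSum_add]

/-- Coassociativity of deconcatenation. -/
theorem splitSum_assoc (L : List α) (φ : List α → List α → List α → Z) :
    (splitSum L fun x w => splitSum x fun u v => φ u v w)
      = splitSum L fun u x => splitSum x fun v w => φ u v w := by
  induction L generalizing φ with
  | nil => rfl
  | cons a L ih =>
    simp only [splitSum, splitSum_add, add_assoc]
    rw [ih]

/-- Deconcatenation of a word with a marked letter. -/
theorem splitSum_insert (U : List α) (a : α) (W : List α) (φ : List α → List α → Z) :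
    splitSum (U ++ a :: W) φ
      = (splitSum U fun x y => φ x (y ++ a :: W)) + splitSum W fun y z => φ (U ++ a :: y) z := by
  induction U generalizing φ with
  | nil => rfl
  | cons b U ih => simp only [List.cons_append, splitSum, ih, add_assoc]

theorem splitSum₃_insert (U : List α) (a : α) (W : List α)
    (φ : List α → List α → List α → Z) :
    splitSum₃ (U ++ a :: W) φ
      = (splitSum₃ U fun x y z => φ x y (z ++ a :: W))
        + (splitSum U fun x y₁ => splitSum W fun y₂ z => φ x (y₁ ++ a :: y₂) z)
        + splitSum₃ W fun x y z => φ (U ++ a :: x) y z := by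
  simp only [splitSum₃, splitSum_insert, splitSum_add]

theorem splitSum_eq_sum (L : List α) (φ : List α → List α → Z) :
    splitSum L φ = ∑ i ∈ Finset.range (L.length + 1), φ (L.take i) (L.drop i) := by
  induction L generalizing φ with
  | nil => simp [splitSum]
  | cons a L ih =>
    rw [splitSum, ih, List.length_cons, Finset.sum_range_succ' _ (L.length + 1)]
    simp [add_comm]

/-- The sum over all factorizations of a word into five factors. -/
def splitSum₅ (L : List α)
    (φ : List α → List α → List α → List α → List α → Z) : Z :=
  splitSum₃ L fun u v r => splitSum₃ r fun x y z => φ u v x y z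

theorem splitSum₃_left (L : List α) (φ : List α → List α → List α → List α → List α → Z) :
    (splitSum₃ L fun u v w => splitSum₃ u fun x y z => φ x y z v w) = splitSum₅ L φ := by
  have h1 : ∀ u t : List α,
      (splitSum t fun v w => splitSum u fun x s => splitSum s fun y z => φ x y z v w)
        = splitSum u fun x s => splitSum s fun y z => splitSum t fun v w => φ x y z v w := by
    intro u t
    rw [splitSum_comm]
    exact splitSum_congr fun x s _ => splitSum_comm _ _ _
  simp only [splitSum₅, splitSum₃, h1]
  rw [splitSum_assoc L fun x s t =>
    splitSum s fun y z => splitSum t fun v w => φ x y z v w]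
  exact splitSum_congr fun x r _ =>
    splitSum_assoc r fun y z t => splitSum t fun v w => φ x y z v w

theorem splitSum₃_middle (L : List α) (φ : List α → List α → List α → List α → List α → Z) :
    (splitSum₃ L fun u x w => splitSum₃ x fun a v b => φ u a v b w) = splitSum₅ L φ := by
  simp only [splitSum₅, splitSum₃]
  refine splitSum_congr fun u t _ => ?_
  rw [splitSum_assoc t fun a q w => splitSum q fun v b => φ u a v b w]
  exact splitSum_congr fun a r _ => splitSum_assoc r fun v b w => φ u a v b w

theorem splitSum₃_ends (L : List α) (φ : List α → List α → List α → List α → List α → Z) :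
    (splitSum₃ L fun u v w => splitSum u fun a b => splitSum w fun c d => φ a b v c d)
      = splitSum₅ L φ := by
  simp only [splitSum₅, splitSum₃]
  rw [← splitSum_assoc L fun a b t =>
    splitSum t fun v w => splitSum w fun c d => φ a b v c d]
  exact splitSum_congr fun u t _ => splitSum_comm _ _ _

end Deconcatenation

section Signs

/-- The sign of a parity. -/
def parSign (k : ZMod 2) : ℤ := if k = 0 then 1 else -1

theorem parSign_add (a b : ZMod 2) : parSign (a + b) = parSign a * parSign b := by
  revert a b; decide

theorem parSign_smul_smul {Z : Type*} [AddCommGroup Z] (a b : ZMod 2) (z : Z) :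
    parSign a • parSign b • z = parSign (a + b) • z := by
  rw [smul_smul, parSign_add]

theorem parSign_smul_congr {Z : Type*} [AddCommGroup Z] {a b : ZMod 2} (h : a = b) (z : Z) :
    parSign a • z = parSign b • z := by
  rw [h]

theorem parSign_add_one_smul {Z : Type*} [AddCommGroup Z] (a : ZMod 2) (z : Z) :
    parSign (a + 1) • z = -(parSign a • z) := by
  rw [parSign_add, ← neg_smul]
  congr 1
  revert a; decide

end Signs

section BarOperators

variable {α 𝓜 𝓝 𝓟 Z : Type*} [AddCommGroup Z] (par : α → ZMod 2)

/-- The total parity of a word. -/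
def wordPar (L : List α) : ZMod 2 := (L.map par).sum

@[simp] theorem wordPar_nil : wordPar par [] = 0 := rfl

@[simp] theorem wordPar_cons (a : α) (L : List α) :
    wordPar par (a :: L) = par a + wordPar par L := by simp [wordPar]

@[simp] theorem wordPar_append (L K : List α) :
    wordPar par (L ++ K) = wordPar par L + wordPar par K := by simp [wordPar]

/-- The operator on functionals on Hochschild words which rotates a terminal block to the front
and applies `g` to the resulting initial part of the word. -/
def wrapOp (parM : 𝓜 → ZMod 2) (g : List α → 𝓜 → List α → 𝓝)
    (E : 𝓝 → List α → Z) (m : 𝓜) (L : List α) : Z :=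
  splitSum₃ L fun u v w =>
    parSign (wordPar par w * (parM m + wordPar par u + wordPar par v)) • E (g w m u) v

/-- The operator on functionals on Hochschild words which contracts a block of algebra elements. -/
def barOp (mu : List α → α) (parM : 𝓜 → ZMod 2)
    (E : 𝓜 → List α → Z) (m : 𝓜) (L : List α) : Z :=
  splitSum₃ L fun u v w => parSign (parM m + wordPar par u) • E m (u ++ mu v :: w)

variable {par} {mu : List α → α} {parM : 𝓜 → ZMod 2} {parN : 𝓝 → ZMod 2}

theorem wrapOp_wrapOp {h : List α → 𝓜 → List α → 𝓝} {e : ZMod 2}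
    (hh : ∀ w m u, parN (h w m u) = wordPar par w + parM m + wordPar par u + e)
    (g : List α → 𝓝 → List α → 𝓟) (E : 𝓟 → List α → Z) (m : 𝓜) (L : List α) :
    wrapOp par parM h (wrapOp par parN g E) m L
      = splitSum₃ L fun u v w =>
          parSign (wordPar par w * (parM m + wordPar par u + wordPar par v)) •
            splitSum w fun w₁ w₂ => splitSum u fun u₁ u₂ =>
              parSign (e * wordPar par w₁) • E (g w₁ (h w₂ m u₁) u₂) v := by
  simp only [wrapOp, smul_splitSum₃, smul_splitSum, parSign_smul_smul, hh]
  refine Eq.trans (b := splitSum₅ L fun u₁ u₂ v w₁ w₂ =>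
    parSign ((wordPar par w₁ + wordPar par w₂) *
      (parM m + wordPar par u₁ + wordPar par u₂ + wordPar par v) + e * wordPar par w₁) •
      E (g w₁ (h w₂ m u₁) u₂) v) ?_ ?_
  · rw [← splitSum₃_middle]
    refine splitSum₃_congr fun u x w _ => splitSum₃_congr fun a v b hx => ?_
    subst hx
    refine parSign_smul_congr ?_ _
    simp only [wordPar_append]
    grind
  · rw [← splitSum₃_ends]
    refine splitSum₃_congr fun u v w _ => ?_
    rw [splitSum_comm]
    refine splitSum_congr fun c d hw => splitSum_congr fun a b hu => ?_
    subst hu hw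
    refine parSign_smul_congr ?_ _
    simp only [wordPar_append]
    grind

set_option maxHeartbeats 1000000 in
theorem barOp_wrapOp {g : List α → 𝓜 → List α → 𝓝} {e : ZMod 2}
    (hmu : ∀ L, par (mu L) = wordPar par L + 1)
    (hg : ∀ w m u, parN (g w m u) = wordPar par w + parM m + wordPar par u + e)
    (E : 𝓝 → List α → Z) (m : 𝓜) (L : List α) :
    barOp par mu parM (wrapOp par parM g E) m L
      = parSign e • wrapOp par parM g (barOp par mu parN E) m L
      + splitSum₃ L fun u v w =>
          parSign (wordPar par w * (parM m + wordPar par u + wordPar par v)) •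
            ((splitSum₃ w fun x y z => parSign (wordPar par x) • E (g (x ++ mu y :: z) m u) v)
            + splitSum₃ u fun x y z => parSign (wordPar par w + wordPar par x + parM m) •
                E (g w m (x ++ mu y :: z)) v) := by
  simp only [wrapOp, barOp, smul_splitSum₃, smul_splitSum, smul_add, parSign_smul_smul, splitSum₃_insert,
    splitSum₃_add, hg]
  have h1 : (splitSum₃ L fun u v w => splitSum₃ u fun x y z =>
        parSign (parM m + wordPar par u +
          wordPar par (z ++ mu v :: w) * (parM m + wordPar par x + wordPar par y)) •
        E (g (z ++ mu v :: w) m x) y)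
      = splitSum₃ L fun u v w => splitSum₃ w fun x y z =>
          parSign (wordPar par w * (parM m + wordPar par u + wordPar par v) + wordPar par x) •
            E (g (x ++ mu y :: z) m u) v := by
    refine Eq.trans (b := splitSum₅ L fun u v x y z =>
      parSign ((wordPar par x + wordPar par y + wordPar par z) *
        (parM m + wordPar par u + wordPar par v) + wordPar par x) •
        E (g (x ++ mu y :: z) m u) v) ?_ ?_
    · rw [← splitSum₃_left]
      refine splitSum₃_congr fun u v w _ => splitSum₃_congr fun x y z hu => ?_
      subst hu
      refine parSign_smul_congr ?_ _
      simp only [wordPar_append, wordPar_cons, hmu]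
      grind
    · refine splitSum₃_congr fun u v w _ => splitSum₃_congr fun x y z hu => ?_
      subst hu
      refine parSign_smul_congr ?_ _
      simp only [wordPar_append]
      grind
  have h2 : (splitSum₃ L fun u v w => splitSum u fun x y₁ => splitSum w fun y₂ z =>
        parSign (parM m + wordPar par u +
          wordPar par z * (parM m + wordPar par x + wordPar par (y₁ ++ mu v :: y₂))) •
        E (g z m x) (y₁ ++ mu v :: y₂))
      = splitSum₃ L fun u v w => splitSum₃ v fun x y z =>
          parSign (e + (wordPar par w * (parM m + wordPar par u + wordPar par v) +
            (wordPar par w + parM m + wordPar par u + e + wordPar par x))) •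
          E (g w m u) (x ++ mu y :: z) := by
    refine Eq.trans (b := splitSum₅ L fun x y₁ v y₂ z =>
      parSign (parM m + wordPar par x + wordPar par y₁ +
          wordPar par z * (parM m + wordPar par x + wordPar par y₁ + wordPar par v
            + wordPar par y₂ + 1)) •
        E (g z m x) (y₁ ++ mu v :: y₂)) ?_ ?_
    · rw [← splitSum₃_ends]
      refine splitSum₃_congr fun u v w _ => splitSum_congr fun x y hu => splitSum_congr fun z t hw => ?_
      subst hu hw
      refine parSign_smul_congr ?_ _
      simp only [wordPar_append, wordPar_cons, hmu]
      grind
    · rw [← splitSum₃_middle]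
      refine splitSum₃_congr fun u v w _ => splitSum₃_congr fun x y z hu => ?_
      subst hu
      refine parSign_smul_congr ?_ _
      simp only [wordPar_append]
      grind
  have h3 : (splitSum₃ L fun u v w => splitSum₃ w fun x y z =>
        parSign (parM m + wordPar par u +
          wordPar par z * (parM m + wordPar par (u ++ mu v :: x) + wordPar par y)) •
        E (g z m (u ++ mu v :: x)) y)
      = splitSum₃ L fun u v w => splitSum₃ u fun x y z =>
          parSign (wordPar par w * (parM m + wordPar par u + wordPar par v) +
            (wordPar par w + wordPar par x + parM m)) •
            E (g w m (x ++ mu y :: z)) v := by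
    refine Eq.trans (b := splitSum₅ L fun u v x y z =>
      parSign (parM m + wordPar par u +
          wordPar par z * (parM m + wordPar par u + wordPar par v + 1 + wordPar par x +
            wordPar par y)) •
        E (g z m (u ++ mu v :: x)) y) ?_ ?_
    · refine splitSum₃_congr fun u v w _ => splitSum₃_congr fun x y z hu => ?_
      subst hu
      refine parSign_smul_congr ?_ _
      simp only [wordPar_append, wordPar_cons, hmu]
      grind
    · rw [← splitSum₃_left]
      refine splitSum₃_congr fun u v w _ => splitSum₃_congr fun x y z hu => ?_
      subst hu
      refine parSign_smul_congr ?_ _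
      simp only [wordPar_append]
      grind
  rw [h1, h2, h3]
  abel

theorem barOp_barOp (hmu : ∀ L, par (mu L) = wordPar par L + 1) (E : 𝓜 → List α → Z)
    (hE : ∀ m x Y z, (splitSum₃ Y fun y₁ v y₂ =>
      parSign (wordPar par y₁) • E m (x ++ mu (y₁ ++ mu v :: y₂) :: z)) = 0)
    (m : 𝓜) (L : List α) :
    barOp par mu parM (barOp par mu parM E) m L = 0 := by
  simp only [barOp, smul_splitSum₃, smul_splitSum, parSign_smul_smul, splitSum₃_insert,
    splitSum₃_add, smul_add]
  have h1 : (splitSum₃ L fun u v w => splitSum₃ u fun x y z =>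
        parSign (parM m + wordPar par u + (parM m + wordPar par x)) •
        E m (x ++ mu y :: (z ++ mu v :: w)))
      = splitSum₅ L fun x y z v w => parSign (wordPar par y + wordPar par z) •
        E m (x ++ mu y :: (z ++ mu v :: w)) := by
    rw [← splitSum₃_left]
    refine splitSum₃_congr fun u v w _ => splitSum₃_congr fun x y z hu => ?_
    subst hu
    refine parSign_smul_congr ?_ _
    simp only [wordPar_append]
    grind
  have h3 : (splitSum₃ L fun u v w => splitSum₃ w fun x y z =>
        parSign (parM m + wordPar par u + (parM m + wordPar par (u ++ mu v :: x))) •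
        E m (u ++ mu v :: x ++ mu y :: z))
      = splitSum₅ L fun x y z v w => parSign (wordPar par y + wordPar par z + 1) •
        E m (x ++ mu y :: (z ++ mu v :: w)) := by
    refine splitSum₃_congr fun u v w _ => splitSum₃_congr fun x y z hu => ?_
    subst hu
    rw [List.append_assoc, List.cons_append]
    refine parSign_smul_congr ?_ _
    simp only [wordPar_append, wordPar_cons, hmu]
    grind
  have h2 : (splitSum₃ L fun u v w => splitSum u fun x y₁ => splitSum w fun y₂ z =>
        parSign (parM m + wordPar par u + (parM m + wordPar par x)) •
        E m (x ++ mu (y₁ ++ mu v :: y₂) :: z)) = 0 := by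
    refine Eq.trans (b := splitSum₅ L fun x y₁ v y₂ z => parSign (wordPar par y₁) •
        E m (x ++ mu (y₁ ++ mu v :: y₂) :: z)) ?_ ?_
    · rw [← splitSum₃_ends]
      refine splitSum₃_congr fun u v w _ => splitSum_congr fun x y hu => splitSum_congr fun z t hw => ?_
      subst hu hw
      refine parSign_smul_congr ?_ _
      simp only [wordPar_append]
      grind
    · rw [← splitSum₃_middle]
      simp only [hE]
      exact splitSum₃_zero L
  rw [h1, h2, h3, add_zero, splitSum₅, splitSum₅, ← splitSum₃_add]
  simp only [← splitSum₃_add, parSign_add_one_smul, add_neg_cancel, splitSum₃_zero]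

/-- The morphism equations turn into commutation of the wrapping operator with the full Hochschild
operators. -/
theorem wrapOp_comm {muM : List α → 𝓜 → List α → 𝓜} {muN : List α → 𝓝 → List α → 𝓝}
    {f : List α → 𝓜 → List α → 𝓝} {e : ZMod 2}
    (hmu : ∀ L, par (mu L) = wordPar par L + 1)
    (hmuM : ∀ w m u, parM (muM w m u) = wordPar par w + parM m + wordPar par u + 1)
    (hf : ∀ w m u, parN (f w m u) = wordPar par w + parM m + wordPar par u + e)
    (E : 𝓝 → List α → Z)
    (hrel : ∀ X m Y V,
      (splitSum X fun x₁ x₂ => splitSum Y fun y₁ y₂ =>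
        parSign (e * wordPar par x₁) • E (muN x₁ (f x₂ m y₁) y₂) V)
      = (splitSum₃ X fun x₁ x₂ x₃ =>
          parSign (wordPar par x₁ + e) • E (f (x₁ ++ mu x₂ :: x₃) m Y) V)
        + (splitSum X fun x₁ x₂ => splitSum Y fun y₁ y₂ =>
          parSign (wordPar par x₁ + e) • E (f x₁ (muM x₂ m y₁) y₂) V)
        + splitSum₃ Y fun y₁ y₂ y₃ =>
          parSign (wordPar par X + wordPar par y₁ + parM m + e) •
            E (f X m (y₁ ++ mu y₂ :: y₃)) V)
    (m : 𝓜) (L : List α) :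
    wrapOp par parM f (fun n K => wrapOp par parN muN E n K + barOp par mu parN E n K) m L
      = parSign e • (wrapOp par parM muM (wrapOp par parM f E) m L
          + barOp par mu parM (wrapOp par parM f E) m L) := by
  have hadd : ∀ E₁ E₂ : 𝓝 → List α → Z,
      wrapOp par parM f (fun n K => E₁ n K + E₂ n K) m L
        = wrapOp par parM f E₁ m L + wrapOp par parM f E₂ m L := by
    intro E₁ E₂
    simp only [wrapOp, smul_add, splitSum₃_add]
  have hee : ∀ z : Z, parSign e • parSign e • z = z := by
    intro z
    rw [parSign_smul_smul, CharTwo.add_self_eq_zero]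
    simp [parSign]
  rw [hadd, wrapOp_wrapOp hf, wrapOp_wrapOp hmuM, barOp_wrapOp hmu hf, smul_add, smul_add, hee]
  simp only [hrel]
  rw [← add_assoc, add_right_comm, add_left_inj, smul_splitSum₃, smul_splitSum₃, ← splitSum₃_add]
  refine splitSum₃_congr fun u v w _ => ?_
  simp only [smul_add, smul_splitSum₃, smul_splitSum, parSign_smul_smul, one_mul]
  rw [add_assoc, add_left_comm]
  congr 1
  · refine splitSum_congr fun x y _ => splitSum_congr fun z t _ => ?_
    refine parSign_smul_congr ?_ _
    ring
  · congr 1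
    · refine splitSum₃_congr fun x y z _ => ?_
      refine parSign_smul_congr ?_ _
      ring
    · refine splitSum₃_congr fun x y z _ => ?_
      refine parSign_smul_congr ?_ _
      ring

/-- The bimodule equations turn into the vanishing of the square of the full Hochschild operator. -/
theorem hochschildOp_sq {muM : List α → 𝓜 → List α → 𝓜}
    (hmu : ∀ L, par (mu L) = wordPar par L + 1)
    (hmuM : ∀ w m u, parM (muM w m u) = wordPar par w + parM m + wordPar par u + 1)
    (E : 𝓜 → List α → Z)
    (hE : ∀ m x Y z, (splitSum₃ Y fun y₁ v y₂ =>
      parSign (wordPar par y₁) • E m (x ++ mu (y₁ ++ mu v :: y₂) :: z)) = 0)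
    (hrel : ∀ X m Y V,
      (splitSum₃ X fun x₁ x₂ x₃ =>
          parSign (wordPar par x₁) • E (muM (x₁ ++ mu x₂ :: x₃) m Y) V)
        + (splitSum X fun x₁ x₂ => splitSum Y fun y₁ y₂ =>
          parSign (wordPar par x₁) • E (muM x₁ (muM x₂ m y₁) y₂) V)
        + (splitSum₃ Y fun y₁ y₂ y₃ =>
          parSign (wordPar par X + wordPar par y₁ + parM m) •
            E (muM X m (y₁ ++ mu y₂ :: y₃)) V) = 0)
    (m : 𝓜) (L : List α) :
    wrapOp par parM muM (fun n K => wrapOp par parM muM E n K + barOp par mu parM E n K) m L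
      + barOp par mu parM (fun n K => wrapOp par parM muM E n K + barOp par mu parM E n K) m L
      = 0 := by
  have hadd : ∀ E₁ E₂ : 𝓜 → List α → Z,
      wrapOp par parM muM (fun n K => E₁ n K + E₂ n K) m L
        = wrapOp par parM muM E₁ m L + wrapOp par parM muM E₂ m L := by
    intro E₁ E₂
    simp only [wrapOp, smul_add, splitSum₃_add]
  have hadd' : ∀ E₁ E₂ : 𝓜 → List α → Z,
      barOp par mu parM (fun n K => E₁ n K + E₂ n K) m L
        = barOp par mu parM E₁ m L + barOp par mu parM E₂ m L := by
    intro E₁ E₂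
    simp only [barOp, smul_add, splitSum₃_add]
  have hs : ∀ z : Z, parSign 1 • z = -z := by
    intro z
    simp [parSign]
  rw [hadd, hadd', barOp_barOp hmu E hE, wrapOp_wrapOp hmuM, barOp_wrapOp hmu hmuM, hs, add_zero,
    add_assoc, add_neg_cancel_left, ← splitSum₃_add]
  rw [← splitSum₃_zero L]
  refine splitSum₃_congr fun u v w _ => ?_
  rw [← smul_add, ← smul_zero (parSign _), ← hrel w m u v]
  congr 1
  simp only [one_mul]
  abel

end BarOperators

section Congr

variable {A M N : Type*}

theorem op_congr {μ : (n : ℕ) → (Fin n → A) → A} {n n' : ℕ} (hn : n = n') {a a' : ℕ → A}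
    (ha : ∀ q, q < n → a q = a' q) :
    μ n (fun i => a i) = μ n' (fun i => a' i) := by
  subst hn
  congr 1
  exact funext fun i => ha i i.2

theorem biop_congr {f : (r s : ℕ) → (Fin r → A) → M → (Fin s → A) → N} {r r' s s' : ℕ}
    (hr : r = r') (hs : s = s') {a a' c c' : ℕ → A} {m m' : M} (hm : m = m')
    (ha : ∀ q, q < r → a q = a' q) (hc : ∀ q, q < s → c q = c' q) :
    f r s (fun i => a i) m (fun i => c i) = f r' s' (fun i => a' i) m' (fun i => c' i) := by
  subst hr hs hm
  congr 1
  · exact funext fun i => ha i i.2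
  · exact funext fun i => hc i i.2

end Congr

section Words

variable {R : Type} [CommRing R] {A M N : Type} [AddCommGroup A] [Module R A]
  [AddCommGroup M] [Module R M] [AddCommGroup N] [Module R N]
  {gr : ℤ → Submodule R A} {grM : ℤ → Submodule R M} {grN : ℤ → Submodule R N}

theorem sgn_eq_parSign (k : ℤ) : sgn k = parSign (k : ZMod 2) := by
  unfold sgn parSign
  rcases Int.even_or_odd k with h | h
  · rw [(Int.natAbs_even.mpr h).neg_one_pow, if_pos ((ZMod.intCast_eq_zero_iff_even).mpr h)]
  · rw [(Int.natAbs_odd.mpr h).neg_one_pow, if_neg]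
    rw [ZMod.intCast_eq_zero_iff_even]
    exact Int.not_even_iff_odd.mpr h

/-- An element of a graded module together with a degree in which it is homogeneous. -/
abbrev Letter (gr : ℤ → Submodule R A) : Type := {p : ℤ × A // p.2 ∈ gr p.1}

/-- The sequence of elements underlying a word, extended by zero. -/
def seqVal (L : List (Letter gr)) (q : ℕ) : A := (L.map fun p => p.1.2).getD q 0

/-- The sequence of degrees of a word, extended by zero. -/
def seqDeg (L : List (Letter gr)) (q : ℕ) : ℤ := (L.map fun p => p.1.1).getD q 0

theorem seqVal_mem (L : List (Letter gr)) {q : ℕ} (hq : q < L.length) :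
    seqVal L q ∈ gr (seqDeg L q) := by
  simp only [seqVal, seqDeg, List.getD_eq_getElem?_getD, List.getElem?_map,
    List.getElem?_eq_getElem hq, Option.map_some, Option.getD_some]
  exact L[q].2

theorem seqVal_append (L K : List (Letter gr)) (q : ℕ) :
    seqVal (L ++ K) q = if q < L.length then seqVal L q else seqVal K (q - L.length) := by
  simp only [seqVal, List.getD_eq_getElem?_getD, List.getElem?_map, List.getElem?_append]
  split_ifs <;> rfl

theorem seqDeg_append (L K : List (Letter gr)) (q : ℕ) :
    seqDeg (L ++ K) q = if q < L.length then seqDeg L q else seqDeg K (q - L.length) := by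
  simp only [seqDeg, List.getD_eq_getElem?_getD, List.getElem?_map, List.getElem?_append]
  split_ifs <;> rfl

theorem seqVal_cons (p : Letter gr) (K : List (Letter gr)) (q : ℕ) :
    seqVal (p :: K) q = if q = 0 then p.1.2 else seqVal K (q - 1) := by
  cases q <;> simp [seqVal]

/-- The parity of the reduced degree of a letter. -/
def letterPar (p : Letter gr) : ZMod 2 := ((p.1.1 - 1 : ℤ) : ZMod 2)

/-- The parity of the degree of a letter. -/
def degPar (p : Letter gr) : ZMod 2 := (p.1.1 : ZMod 2)

theorem wordPar_letterPar (L : List (Letter gr)) :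
    wordPar letterPar L = ((∑ q ∈ range L.length, (seqDeg L q - 1) : ℤ) : ZMod 2) := by
  induction L with
  | nil => simp
  | cons p L ih =>
    rw [wordPar_cons, ih, List.length_cons, sum_range_succ']
    simp [seqDeg, letterPar, add_comm]

theorem sum_seqDeg_append_left (L K : List (Letter gr)) :
    ((∑ q ∈ range L.length, (seqDeg (L ++ K) q - 1) : ℤ) : ZMod 2) = wordPar letterPar L := by
  rw [wordPar_letterPar]
  congr 1
  refine sum_congr rfl fun q hq => ?_
  rw [seqDeg_append, if_pos (mem_range.mp hq)]

theorem intCast_sum_seqDeg (L : List (Letter gr)) :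
    ((∑ i : Fin L.length, seqDeg L i : ℤ) : ZMod 2) = wordPar letterPar L + L.length := by
  rw [wordPar_letterPar, Fin.sum_univ_eq_sum_range, sum_sub_distrib]
  simp

/-- The action of the operations `μ` on words. -/
def letterMu (μ : (n : ℕ) → (Fin n → A) → A)
    (hμ : ∀ (n : ℕ) (d : Fin n → ℤ) (a : Fin n → A),
      (∀ i, a i ∈ gr (d i)) → μ n a ∈ gr ((∑ i, d i) + 2 - n))
    (L : List (Letter gr)) : Letter gr :=
  ⟨((∑ i : Fin L.length, seqDeg L i) + 2 - L.length,
    if L = [] then 0 else μ L.length fun i => seqVal L i), by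
    dsimp only
    split_ifs
    · exact zero_mem _
    · exact hμ _ _ _ fun i => seqVal_mem L i.2⟩

theorem letterPar_letterMu {μ : (n : ℕ) → (Fin n → A) → A}
    (hμ : ∀ (n : ℕ) (d : Fin n → ℤ) (a : Fin n → A),
      (∀ i, a i ∈ gr (d i)) → μ n a ∈ gr ((∑ i, d i) + 2 - n)) (L : List (Letter gr)) :
    letterPar (letterMu μ hμ L) = wordPar letterPar L + 1 := by
  have h := intCast_sum_seqDeg L
  simp only [letterPar, letterMu, Int.cast_sub, Int.cast_add, h]
  push_cast
  ring_nf

/-- The action of the components of a bimodule map on words. -/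
def letterMap (f : (r s : ℕ) → (Fin r → A) → M → (Fin s → A) → N) (dg : ℤ)
    (hf : ∀ (r s : ℕ) (dx : Fin r → ℤ) (dm : ℤ) (dy : Fin s → ℤ)
      (x : Fin r → A) (m : M) (y : Fin s → A),
      (∀ i, x i ∈ gr (dx i)) → m ∈ grM dm → (∀ j, y j ∈ gr (dy j)) →
      f r s x m y ∈ grN ((∑ i, dx i) + dm + (∑ j, dy j) + dg - r - s))
    (X : List (Letter gr)) (m : Letter grM) (Y : List (Letter gr)) : Letter grN :=
  ⟨((∑ i : Fin X.length, seqDeg X i) + m.1.1 + (∑ i : Fin Y.length, seqDeg Y i) + dg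
      - X.length - Y.length,
    f X.length Y.length (fun i => seqVal X i) m.1.2 (fun i => seqVal Y i)),
    hf _ _ _ _ _ _ _ _ (fun i => seqVal_mem X i.2) m.2 fun i => seqVal_mem Y i.2⟩

theorem degPar_letterMap {f : (r s : ℕ) → (Fin r → A) → M → (Fin s → A) → N} {dg : ℤ}
    (hf : ∀ (r s : ℕ) (dx : Fin r → ℤ) (dm : ℤ) (dy : Fin s → ℤ)
      (x : Fin r → A) (m : M) (y : Fin s → A),
      (∀ i, x i ∈ gr (dx i)) → m ∈ grM dm → (∀ j, y j ∈ gr (dy j)) →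
      f r s x m y ∈ grN ((∑ i, dx i) + dm + (∑ j, dy j) + dg - r - s))
    (X : List (Letter gr)) (m : Letter grM) (Y : List (Letter gr)) :
    degPar (letterMap f dg hf X m Y)
      = wordPar letterPar X + degPar m + wordPar letterPar Y + (dg : ZMod 2) := by
  have h := intCast_sum_seqDeg X
  have h' := intCast_sum_seqDeg Y
  simp only [degPar, letterMap, Int.cast_sub, Int.cast_add, h, h']
  push_cast
  ring

/-- The elementary Hochschild chain of a word with coefficient `m`. -/
noncomputable def wordElt (m : Letter grM) (L : List (Letter gr)) : HChain R A M :=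
  hchElt R L.length m.1.2 (seqVal L)

theorem hchElt_congr {n n' : ℕ} (hn : n = n') {m m' : M} (hm : m = m') {a a' : ℕ → A}
    (ha : ∀ q, q < n → a q = a' q) : hchElt R n m a = hchElt R n' m' a' := by
  subst hn hm
  unfold hchElt
  congr 3
  exact funext fun i => ha i i.2

end Words

section Sums

variable {α Z : Type*} [AddCommGroup Z]

theorem splitSum_eq_sum_left {L : List α} {φ : List α → List α → Z} {G : ℕ → Z}
    (h : ∀ u v, u ++ v = L → φ u v = G u.length) :
    splitSum L φ = ∑ i ∈ range (L.length + 1), G i := by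
  rw [splitSum_eq_sum]
  refine sum_congr rfl fun i hi => ?_
  rw [h _ _ (List.take_append_drop i L), List.length_take,
    min_eq_left (Nat.lt_succ_iff.mp (mem_range.mp hi))]

theorem splitSum_eq_sum_right {L : List α} {φ : List α → List α → Z} {G : ℕ → Z}
    (h : ∀ u v, u ++ v = L → φ u v = G v.length) :
    splitSum L φ = ∑ i ∈ range (L.length + 1), G i := by
  rw [splitSum_eq_sum_left (G := fun i => G (L.length - i)),
    ← sum_range_reflect]
  · refine sum_congr rfl fun i hi => ?_
    have := mem_range.mp hi
    congr 1
    omega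
  · intro u v huv
    rw [h u v huv, ← huv, List.length_append, Nat.add_sub_cancel_left]

theorem splitSum₃_eq_sum {L : List α} {φ : List α → List α → List α → Z} {G : ℕ → ℕ → Z}
    (h0 : ∀ u w, u ++ w = L → φ u [] w = 0)
    (h : ∀ u v w, u ++ (v ++ w) = L → v ≠ [] → φ u v w = G v.length u.length) :
    splitSum₃ L φ = ∑ n ∈ Icc 1 L.length, ∑ i ∈ range (L.length + 1 - n), G n i := by
  have h1 : splitSum₃ L φ = ∑ i ∈ range (L.length + 1), ∑ n ∈ Icc 1 (L.length - i), G n i := by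
    refine splitSum_eq_sum_left fun u x hux => ?_
    rw [splitSum_eq_sum_left (G := fun n => if n = 0 then 0 else G n u.length)]
    · have hx : L.length - u.length = x.length := by
        rw [← hux, List.length_append, Nat.add_sub_cancel_left]
      rw [hx, range_eq_Ico, sum_eq_sum_Ico_succ_bot (Nat.succ_pos _), if_pos rfl, zero_add]
      refine sum_congr (by ext; simp) fun n hn => ?_
      rw [if_neg]
      have := (mem_Icc.mp hn).1
      omega
    · intro v w hvw
      subst hvw
      split_ifs with hv
      · rw [List.length_eq_zero_iff] at hv
        subst hv
        exact h0 u w hux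
      · exact h u v w hux fun hv' => hv (by rw [hv']; rfl)
  rw [h1]
  refine sum_comm' fun i n => ?_
  simp only [mem_range, mem_Icc]
  omega

end Sums

section Relations

variable {R : Type} [CommRing R] {A M N P : Type} [AddCommGroup A] [Module R A]
  [AddCommGroup M] [Module R M] [AddCommGroup N] [Module R N] [AddCommGroup P] [Module R P]
  {gr : ℤ → Submodule R A} {grM : ℤ → Submodule R M} {grN : ℤ → Submodule R N}
  {grP : ℤ → Submodule R P}

theorem IsMultilinear.map_eq_zero {n : ℕ} {g : (Fin n → A) → M} (hg : IsMultilinear R g)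
    (v : Fin n → A) (i : Fin n) (hv : v i = 0) : g v = 0 := by
  have h := hg.2 v i 0 0
  rwa [zero_smul, zero_smul, ← hv, Function.update_eq_self] at h

theorem IsTriMultilinear.map_eq_zero_left {r s : ℕ} {g : (Fin r → A) → M → (Fin s → A) → N}
    (hg : IsTriMultilinear R g) (x : Fin r → A) (m : M) (y : Fin s → A) (i : Fin r)
    (hx : x i = 0) : g x m y = 0 := by
  have h := hg.2.1 x m y i 0 0
  rwa [zero_smul, zero_smul, ← hx, Function.update_eq_self] at h

theorem IsTriMultilinear.map_eq_zero_right {r s : ℕ} {g : (Fin r → A) → M → (Fin s → A) → N}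
    (hg : IsTriMultilinear R g) (x : Fin r → A) (m : M) (y : Fin s → A) (i : Fin s)
    (hy : y i = 0) : g x m y = 0 := by
  have h := hg.2.2.2.2.2 x m y i 0 0
  rwa [zero_smul, zero_smul, ← hy, Function.update_eq_self] at h

/-- The sequence obtained from `a` by replacing the block of length `l` at position `i` by `p`. -/
def replaceBlock (a : ℕ → A) (i l : ℕ) (p : A) (q : ℕ) : A :=
  if q < i then a q else if q = i then p else a (q + l - 1)

theorem seqVal_insert (u : List (Letter gr)) (p : Letter gr) (w : List (Letter gr)) (q : ℕ) :
    seqVal (u ++ p :: w) q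
      = if q < u.length then seqVal u q
        else if q = u.length then p.1.2 else seqVal w (q - u.length - 1) := by
  rw [seqVal_append, seqVal_cons]
  split_ifs <;> first | rfl | omega

theorem seqVal_insert_eq_replaceBlock {L u v w : List (Letter gr)} (h : u ++ (v ++ w) = L)
    (hv : v ≠ []) (p : Letter gr) {b : A} (hb : p.1.2 = b) (K : List (Letter gr)) (q : ℕ)
    (hq : q < (u ++ p :: w).length) :
    seqVal (u ++ p :: w) q = replaceBlock (seqVal (L ++ K)) u.length v.length b q := by
  have := List.length_pos_of_ne_nil hv
  subst h hb
  simp only [List.length_append, List.length_cons] at hq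
  rw [seqVal_insert]
  simp only [replaceBlock, seqVal_append, List.length_append]
  split_ifs <;> first | rfl | omega | (congr 1; omega)

theorem seqVal_append_middle {u v w : List (Letter gr)} {q : ℕ} (hq : q < v.length) :
    seqVal v q = seqVal (u ++ (v ++ w)) (u.length + q) := by
  rw [seqVal_append, if_neg (by omega), seqVal_append, if_pos (by omega)]
  congr 1
  omega

section

variable {μ : (n : ℕ) → (Fin n → A) → A}
  {hμ : ∀ (n : ℕ) (d : Fin n → ℤ) (a : Fin n → A),
    (∀ i, a i ∈ gr (d i)) → μ n a ∈ gr ((∑ i, d i) + 2 - n)}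

theorem letterMu_nil_val : (letterMu μ hμ []).1.2 = 0 := by
  simp [letterMu]

theorem letterMu_val {u v w : List (Letter gr)} (hv : v ≠ []) :
    (letterMu μ hμ v).1.2
      = μ v.length (fun k => seqVal (u ++ (v ++ w)) (u.length + k)) := by
  refine (if_neg hv).trans ?_
  exact op_congr (μ := μ) rfl (a' := fun k => seqVal (u ++ (v ++ w)) (u.length + k))
    fun q hq => seqVal_append_middle hq

theorem letterMu_relation (hA : IsAInftyAlgebra R gr μ) (L : List (Letter gr)) :
    (splitSum₃ L fun u v w => parSign (wordPar letterPar u) •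
      (letterMu μ hμ (u ++ letterMu μ hμ v :: w)).1.2) = 0 := by
  rw [splitSum₃_eq_sum (G := fun n i => sgn (∑ q ∈ range i, (seqDeg L q - 1)) •
    μ (L.length + 1 - n) (fun j => replaceBlock (seqVal L) i n
      (μ n fun k => seqVal L (i + k)) j))]
  · rcases L with _ | ⟨p, L⟩
    · rfl
    · exact hA.2.2 _ (Nat.succ_pos _) _ _ fun q hq => seqVal_mem _ hq
  · intro u w _
    refine smul_eq_zero_of_right _ ((if_neg (by simp)).trans ?_)
    refine (hA.1 _).map_eq_zero _ ⟨u.length, by simp⟩ ?_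
    simp [seqVal_insert, letterMu_nil_val]
  · intro u v w h hv
    have hval := seqVal_insert_eq_replaceBlock h hv (letterMu μ hμ v)
      (letterMu_val (u := u) (w := w) hv) []
    rw [List.append_nil] at hval
    rw [h] at hval
    congr 1
    · rw [sgn_eq_parSign, ← h, sum_seqDeg_append_left]
    · refine (if_neg (by simp)).trans ?_
      refine op_congr (μ := μ) (a' := replaceBlock _ _ _ _) ?_ fun q hq => hval q hq
      have := List.length_pos_of_ne_nil hv
      simp only [← h, List.length_append, List.length_cons]
      omega

variable {f : (r s : ℕ) → (Fin r → A) → M → (Fin s → A) → N} {dg : ℤ}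
  {hf : ∀ (r s : ℕ) (dx : Fin r → ℤ) (dm : ℤ) (dy : Fin s → ℤ)
    (x : Fin r → A) (m : M) (y : Fin s → A),
    (∀ i, x i ∈ gr (dx i)) → m ∈ grM dm → (∀ j, y j ∈ gr (dy j)) →
    f r s x m y ∈ grN ((∑ i, dx i) + dm + (∑ j, dy j) + dg - r - s)}

theorem splitSum₃_letterMap_left (hlin : ∀ r s : ℕ, IsTriMultilinear R (f r s))
    (X Y : List (Letter gr)) (m : Letter grM) {τ : List (Letter gr) → ZMod 2} {σ : ℕ → ℤ}
    (hσ : ∀ u v, u ++ v = X → parSign (τ u) = σ u.length) :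
    (splitSum₃ X fun u v w => parSign (τ u) •
        (letterMap f dg hf (u ++ letterMu μ hμ v :: w) m Y).1.2)
      = ∑ n ∈ Icc 1 X.length, ∑ i ∈ range (X.length + 1 - n),
          σ i • f (X.length + 1 - n) Y.length
            (fun j => replaceBlock (seqVal (X ++ Y)) i n
              (μ n fun k => seqVal (X ++ Y) (i + k)) j)
            m.1.2 (fun j => seqVal (X ++ Y) (X.length + j)) := by
  refine splitSum₃_eq_sum ?_ ?_
  · intro u w _
    refine smul_eq_zero_of_right _ ((hlin _ _).map_eq_zero_left _ _ _ ⟨u.length, by simp⟩ ?_)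
    simp [seqVal_insert, letterMu_nil_val]
  · intro u v w h hv
    have hval := seqVal_insert_eq_replaceBlock h hv (letterMu μ hμ v)
      (letterMu_val (u := u) (w := w ++ Y) hv) Y
    rw [← List.append_assoc v, ← List.append_assoc u, h] at hval
    congr 1
    · exact hσ _ _ h
    · refine biop_congr (f := f) (a' := replaceBlock _ _ _ _)
        (c' := fun q => seqVal (X ++ Y) (X.length + q)) ?_ rfl rfl (fun q hq => hval q hq) ?_
      · have := List.length_pos_of_ne_nil hv
        simp only [← h, List.length_append, List.length_cons]
        omega
      · intro q hq
        simpa using seqVal_append_middle (u := X) (w := []) hq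

theorem splitSum₃_letterMap_right (hlin : ∀ r s : ℕ, IsTriMultilinear R (f r s))
    (X Y : List (Letter gr)) (m : Letter grM) {τ : List (Letter gr) → ZMod 2} {σ : ℕ → ℤ}
    (hσ : ∀ u v, u ++ v = Y → parSign (τ u) = σ u.length) :
    (splitSum₃ Y fun u v w => parSign (τ u) •
        (letterMap f dg hf X m (u ++ letterMu μ hμ v :: w)).1.2)
      = ∑ n ∈ Icc 1 Y.length, ∑ i ∈ range (Y.length + 1 - n),
          σ i • f X.length (Y.length + 1 - n) (fun k => seqVal (X ++ Y) k) m.1.2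
            (fun k => if (k : ℕ) < i then seqVal (X ++ Y) (X.length + k)
              else if (k : ℕ) = i then μ n (fun t => seqVal (X ++ Y) (X.length + i + t))
              else seqVal (X ++ Y) (X.length + k + n - 1)) := by
  refine splitSum₃_eq_sum ?_ ?_
  · intro u w _
    refine smul_eq_zero_of_right _ ((hlin _ _).map_eq_zero_right _ _ _ ⟨u.length, by simp⟩ ?_)
    simp [seqVal_insert, letterMu_nil_val]
  · intro u v w h hv
    have hmu := letterMu_val (μ := μ) (hμ := hμ) (u := X ++ u) (w := w) hv
    have hpos := List.length_pos_of_ne_nil hv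
    congr 1
    · exact hσ _ _ h
    · refine biop_congr (f := f) (a' := seqVal (X ++ Y))
        (c' := fun k => if k < u.length then seqVal (X ++ Y) (X.length + k)
              else if k = u.length then
                μ v.length (fun t => seqVal (X ++ Y) (X.length + u.length + t))
              else seqVal (X ++ Y) (X.length + k + v.length - 1)) rfl ?_ rfl ?_ ?_
      · simp only [← h, List.length_append, List.length_cons]
        omega
      · intro q hq
        rw [seqVal_append, if_pos hq]
      · intro q hq
        simp only [List.append_assoc, h, List.length_append] at hmu
        rw [seqVal_insert, hmu]
        simp only [List.length_append, List.length_cons] at hq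
        simp only [← h, seqVal_append]
        split_ifs <;> first | rfl | omega | (congr 1; omega)

theorem splitSum_letterMap_letterMap
    {g : (r s : ℕ) → (Fin r → A) → N → (Fin s → A) → P} {dg' : ℤ}
    {hg : ∀ (r s : ℕ) (dx : Fin r → ℤ) (dm : ℤ) (dy : Fin s → ℤ)
      (x : Fin r → A) (m : N) (y : Fin s → A),
      (∀ i, x i ∈ gr (dx i)) → m ∈ grN dm → (∀ j, y j ∈ gr (dy j)) →
      g r s x m y ∈ grP ((∑ i, dx i) + dm + (∑ j, dy j) + dg' - r - s)}
    (X Y : List (Letter gr)) (m : Letter grM) {τ : List (Letter gr) → ZMod 2} {σ : ℕ → ℤ}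
    (hσ : ∀ u v, u ++ v = X → parSign (τ u) = σ u.length) :
    (splitSum X fun x₁ x₂ => splitSum Y fun y₁ y₂ => parSign (τ x₁) •
        (letterMap g dg' hg x₁ (letterMap f dg hf x₂ m y₁) y₂).1.2)
      = ∑ r₁ ∈ range (X.length + 1), ∑ s₁ ∈ range (Y.length + 1),
          σ r₁ • g r₁ s₁ (fun j => seqVal (X ++ Y) j)
            (f (X.length - r₁) (Y.length - s₁) (fun j => seqVal (X ++ Y) (r₁ + j)) m.1.2
              (fun j => seqVal (X ++ Y) (X.length + j)))
            (fun j => seqVal (X ++ Y) (X.length + (Y.length - s₁) + j)) := by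
  refine splitSum_eq_sum_left fun x₁ x₂ hX => splitSum_eq_sum_right fun y₁ y₂ hY => ?_
  congr 1
  · exact hσ _ _ hX
  · refine biop_congr (f := g) (a' := seqVal (X ++ Y))
      (c' := fun j => seqVal (X ++ Y) (X.length + (Y.length - y₂.length) + j)) rfl rfl ?_ ?_ ?_
    · refine biop_congr (f := f) (a' := fun j => seqVal (X ++ Y) (x₁.length + j))
        (c' := fun j => seqVal (X ++ Y) (X.length + j)) ?_ ?_ rfl ?_ ?_
      · simp only [← hX, List.length_append]
        omega
      · simp only [← hY, List.length_append]
        omega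
      · intro q hq
        rw [← hX, List.append_assoc]
        exact seqVal_append_middle hq
      · intro q hq
        rw [← hY]
        exact seqVal_append_middle hq
    · intro q hq
      rw [← hX, List.append_assoc, seqVal_append, if_pos hq]
    · intro q hq
      have := seqVal_append_middle (u := X ++ y₁) (w := []) hq
      rw [this, List.append_nil, List.append_assoc, hY]
      congr 1
      simp only [← hY, List.length_append]
      omega

end

end Relations

section Sums

variable {α Z : Type*} [AddCommGroup Z]

theorem splitSum₃_eq_sum_ends {L : List α} {φ : List α → List α → List α → Z} {G : ℕ → ℕ → Z}
    (h : ∀ u v w, u ++ (v ++ w) = L → φ u v w = G w.length u.length) :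
    splitSum₃ L φ = ∑ r ∈ range (L.length + 1), ∑ s ∈ range (L.length + 1 - r), G r s := by
  rw [splitSum₃, ← splitSum_assoc]
  refine splitSum_eq_sum_right fun x w hx => ?_
  have hlen : L.length + 1 - w.length = x.length + 1 := by
    rw [← hx, List.length_append]
    omega
  rw [hlen]
  refine splitSum_eq_sum_left fun u v huv => h u v w ?_
  rw [← List.append_assoc, huv, hx]

theorem sum_Icc_sum_range_eq_add (n : ℕ) (B : ℕ → ℕ → Z) :
    ∑ l ∈ Icc 1 (n + 1), ∑ i ∈ range (n + 1), B i l
      = (∑ r ∈ range (n + 1), ∑ s ∈ range (n + 1 - r),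
          B (if r = 0 then 0 else n + 1 - r) (r + s + 1))
        + ∑ l ∈ Icc 1 n, ∑ i ∈ range (n + 1 - l), B (i + 1) l := by
  rw [sum_congr rfl fun l _ => (sum_filter_add_sum_filter_not (range (n + 1))
    (fun i => i = 0 ∨ n + 1 < i + l) _).symm, sum_add_distrib]
  congr 1
  · rw [sum_sigma', sum_sigma']
    refine sum_nbij' (fun p => ⟨if p.2 = 0 then 0 else n + 1 - p.2,
        p.1 - 1 - (if p.2 = 0 then 0 else n + 1 - p.2)⟩)
      (fun p => ⟨p.1 + p.2 + 1, if p.1 = 0 then 0 else n + 1 - p.1⟩) ?_ ?_ ?_ ?_ ?_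
    · rintro ⟨l, i⟩ h
      simp only [mem_sigma, mem_Icc, mem_filter, mem_range] at h ⊢
      split_ifs <;> omega
    · rintro ⟨r, s⟩ h
      simp only [mem_sigma, mem_Icc, mem_filter, mem_range] at h ⊢
      split_ifs <;> omega
    · rintro ⟨l, i⟩ h
      simp only [mem_sigma, mem_Icc, mem_filter, mem_range] at h ⊢
      simp only [Sigma.mk.injEq, heq_eq_eq]
      split_ifs <;> omega
    · rintro ⟨r, s⟩ h
      simp only [mem_sigma, mem_range] at h ⊢
      simp only [Sigma.mk.injEq, heq_eq_eq]
      split_ifs <;> omega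
    · rintro ⟨l, i⟩ h
      simp only [mem_sigma, mem_Icc, mem_filter, mem_range] at h ⊢
      congr 1 <;> split_ifs <;> omega
  · rw [sum_Icc_succ_top (by omega), sum_eq_zero (s := filter _ _), add_zero]
    · refine sum_congr rfl fun l hl => ?_
      rw [mem_Icc] at hl
      refine sum_nbij' (fun i => i - 1) (fun i => i + 1) ?_ ?_ ?_ ?_ ?_
      all_goals
        intro i hi
        simp only [mem_filter, mem_range] at hi ⊢
      · omega
      · omega
      · omega
      · omega
      · congr 1
        omega
    · intro i hi
      simp only [mem_filter, mem_range] at hi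
      omega

end Sums

section Operators

variable {R : Type} [CommRing R] {A M N : Type} [AddCommGroup A] [Module R A]
  [AddCommGroup M] [Module R M] [AddCommGroup N] [Module R N]
  {gr : ℤ → Submodule R A} {grM : ℤ → Submodule R M} {grN : ℤ → Submodule R N}
  {μ : (n : ℕ) → (Fin n → A) → A}
  {hμ : ∀ (n : ℕ) (d : Fin n → ℤ) (a : Fin n → A),
    (∀ i, a i ∈ gr (d i)) → μ n a ∈ gr ((∑ i, d i) + 2 - n)}
  {μM : (r s : ℕ) → (Fin r → A) → M → (Fin s → A) → M}
  {hμM : ∀ (r s : ℕ) (dx : Fin r → ℤ) (dm : ℤ) (dy : Fin s → ℤ)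
    (x : Fin r → A) (m : M) (y : Fin s → A),
    (∀ i, x i ∈ gr (dx i)) → m ∈ grM dm → (∀ j, y j ∈ gr (dy j)) →
    μM r s x m y ∈ grM ((∑ i, dx i) + dm + (∑ j, dy j) + 1 - r - s)}
  {μN : (r s : ℕ) → (Fin r → A) → N → (Fin s → A) → N}
  {hμN : ∀ (r s : ℕ) (dx : Fin r → ℤ) (dm : ℤ) (dy : Fin s → ℤ)
    (x : Fin r → A) (m : N) (y : Fin s → A),
    (∀ i, x i ∈ gr (dx i)) → m ∈ grN dm → (∀ j, y j ∈ gr (dy j)) →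
    μN r s x m y ∈ grN ((∑ i, dx i) + dm + (∑ j, dy j) + 1 - r - s)}
  {f : (r s : ℕ) → (Fin r → A) → M → (Fin s → A) → N} {dg : ℤ}
  {hf : ∀ (r s : ℕ) (dx : Fin r → ℤ) (dm : ℤ) (dy : Fin s → ℤ)
    (x : Fin r → A) (m : M) (y : Fin s → A),
    (∀ i, x i ∈ gr (dx i)) → m ∈ grM dm → (∀ j, y j ∈ gr (dy j)) →
    f r s x m y ∈ grN ((∑ i, dx i) + dm + (∑ j, dy j) + dg - r - s)}

theorem exists_addMonoidHom_wordElt (V : List (Letter gr)) :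
    ∃ ψ : M →+ HChain R A M, ∀ m : Letter grM, wordElt m V = ψ m.1.2 :=
  ⟨((DirectSum.lof R ℕ (fun k => HTens R A M k) V.length).comp
    ((TensorProduct.mk R M _).flip (PiTensorProduct.tprod R fun i => seqVal V i))).toAddMonoidHom,
    fun _ => rfl⟩

theorem exists_addMonoidHom_wordElt_insert (m : Letter grM) (u w : List (Letter gr)) :
    ∃ ψ : A →+ HChain R A M, ∀ p : Letter gr, wordElt m (u ++ p :: w) = ψ p.1.2 := by
  let a : ℕ → A := fun q => if q < u.length then seqVal u q else seqVal w (q - u.length - 1)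
  refine ⟨((DirectSum.lof R ℕ (fun k => HTens R A M k) (u.length + 1 + w.length)).comp
    ((TensorProduct.mk R M _ m.1.2).comp
      ((PiTensorProduct.tprod R).toLinearMap (fun i : Fin (u.length + 1 + w.length) => a i)
        (⟨u.length, by omega⟩ : Fin (u.length + 1 + w.length))))).toAddMonoidHom, fun p => ?_⟩
  refine (hchElt_congr (R := R) (n' := u.length + 1 + w.length) ?_ rfl
    (a' := fun q => if q = u.length then p.1.2 else a q) ?_).trans ?_
  · simp only [List.length_append, List.length_cons]
    omega
  · intro q _
    simp only [seqVal_insert, a]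
    split_ifs <;> first | rfl | omega
  · unfold hchElt
    simp only [LinearMap.toAddMonoidHom_coe, LinearMap.comp_apply, TensorProduct.mk_apply,
      MultilinearMap.toLinearMap_apply]
    congr 3
    funext i
    rw [Function.update_apply]
    simp only [Fin.ext_iff]

theorem intCast_sum_Ico_seqDeg (u w : List (Letter gr)) :
    ((∑ q ∈ Ico u.length (u ++ w).length, (seqDeg (u ++ w) q - 1) : ℤ) : ZMod 2)
      = wordPar letterPar w := by
  rw [sum_Ico_eq_sum_range, wordPar_letterPar, List.length_append, Nat.add_sub_cancel_left]
  congr 1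
  refine sum_congr rfl fun q _ => ?_
  rw [seqDeg_append, if_neg (by omega), Nat.add_sub_cancel_left]

theorem wordElt_letterMap {L u v w : List (Letter gr)} (h : u ++ (v ++ w) = L) (m : Letter grM)
    {r s k t : ℕ} (hr : r = w.length) (hs : s = u.length) (hk : k = v.length)
    (ht : t = L.length - w.length) :
    wordElt (letterMap f dg hf w m u) v
      = hchElt R k (f r s (fun j => seqVal L (t + j)) m.1.2 (fun j => seqVal L j))
          (fun j => seqVal L (s + j)) := by
  subst h hr hs hk ht
  refine hchElt_congr rfl ?_ fun q hq => seqVal_append_middle hq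
  refine biop_congr (f := f) rfl rfl rfl (a' := fun j => seqVal _ (_ + j)) ?_ ?_
  · intro q hq
    have := seqVal_append_middle (u := u ++ v) (w := []) hq
    rw [this, List.append_nil, List.append_assoc]
    congr 1
    simp only [List.length_append]
    omega
  · intro q hq
    rw [seqVal_append, if_pos hq]

theorem wrapOp_letterMap_wordElt (m : Letter grM) (L : List (Letter gr)) :
    wrapOp letterPar degPar (letterMap f dg hf) wordElt m L
      = parSign ((dg : ZMod 2) * (degPar m + wordPar letterPar L)) •
        fstarFormula R f dg L.length m.1.1 (seqDeg L) m.1.2 (seqVal L) := by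
  simp only [fstarFormula, smul_sum]
  refine splitSum₃_eq_sum_ends fun u v w h => ?_
  have hlen : L.length = u.length + (v.length + w.length) := by simp [← h]
  rw [wordElt_letterMap h m rfl rfl (k := L.length - w.length - u.length) (by omega) rfl,
    sgn_eq_parSign, parSign_smul_smul]
  refine parSign_smul_congr ?_ _
  have h1 := sum_seqDeg_append_left (u ++ v) w
  have h2 := intCast_sum_Ico_seqDeg (u ++ v) w
  have h3 := wordPar_letterPar L
  rw [List.append_assoc, h] at h1 h2
  have h4 : (u ++ v).length = L.length - w.length := by
    simp only [List.length_append]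
    omega
  rw [h4] at h1 h2
  have h5 : wordPar letterPar L
      = wordPar letterPar u + (wordPar letterPar v + wordPar letterPar w) := by simp [← h]
  rw [h5] at h3 ⊢
  simp only [Int.cast_add, Int.cast_mul, Int.cast_sub, Int.cast_neg, h1, h2, ← h3, degPar,
    wordPar_append]
  grind

theorem bComp_zero {n l : ℕ} (h1 : 1 ≤ l) (hl : l ≤ n + 1) (dm : ℤ) (d : ℕ → ℤ) (m : M)
    (a : ℕ → A) :
    bComp R μ μM n 0 l dm d m a
      = hchElt R (n + 1 - l) (μM 0 (l - 1) (fun k => a k) m fun k => a k)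
          fun q => a (l - 1 + q) :=
  (if_pos ⟨h1, hl, Nat.zero_le n⟩).trans (if_pos rfl)

theorem bComp_of_le {n l i : ℕ} (h1 : 1 ≤ l) (hl : i + 1 + l ≤ n + 1) (dm : ℤ) (d : ℕ → ℤ)
    (m : M) (a : ℕ → A) :
    bComp R μ μM n (i + 1) l dm d m a
      = sgn (dm + ∑ q ∈ range i, (d q - 1)) •
        hchElt R (n + 1 - l) m (replaceBlock a i l (μ l fun k => a (i + k))) :=
  (if_pos ⟨h1, by omega, by omega⟩).trans ((if_neg (Nat.succ_ne_zero i)).trans (if_pos hl))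

theorem bComp_of_lt {n l i : ℕ} (hl' : l ≤ n + 1) (hi : i + 1 ≤ n) (hl : n + 1 < i + 1 + l)
    (dm : ℤ) (d : ℕ → ℤ) (m : M) (a : ℕ → A) :
    bComp R μ μM n (i + 1) l dm d m a
      = sgn ((dm + ∑ q ∈ range i, (d q - 1)) * ∑ q ∈ Ico i n, (d q - 1)) •
        hchElt R (n + 1 - l)
          (μM (n - (i + 1) + 1) (i + 1 + l - n - 2) (fun k => a (i + k)) m fun k => a k)
          fun j => a (l + (i + 1) - n - 2 + j) :=
  (if_pos ⟨by omega, hl', hi⟩).trans ((if_neg (Nat.succ_ne_zero i)).trans (if_neg (by omega)))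

theorem sum_bComp_eq (m : Letter grM) (L : List (Letter gr)) :
    ∑ l ∈ Icc 1 (L.length + 1), ∑ i ∈ range (L.length + 1),
        bComp R μ μM L.length i l m.1.1 (seqDeg L) m.1.2 (seqVal L)
      = wrapOp letterPar degPar (letterMap μM 1 hμM) wordElt m L
        + barOp letterPar (letterMu μ hμ) degPar wordElt m L := by
  rw [sum_Icc_sum_range_eq_add]
  congr 1
  · refine (splitSum₃_eq_sum_ends fun u v w h => ?_).symm
    have hlen : L.length = u.length + (v.length + w.length) := by simp [← h]
    have h1 := sum_seqDeg_append_left (u ++ v) w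
    have h2 := intCast_sum_Ico_seqDeg (u ++ v) w
    rw [List.append_assoc, h] at h1 h2
    have h4 : (u ++ v).length = L.length - w.length := by
      simp only [List.length_append]
      omega
    rw [h4] at h1 h2
    by_cases hw : w.length = 0
    · rw [if_pos hw, bComp_zero (by omega) (by omega), wordElt_letterMap h m hw.symm
        (s := w.length + u.length + 1 - 1) (k := L.length + 1 - (w.length + u.length + 1))
        (by omega) (by omega) rfl]
      rw [List.length_eq_zero_iff] at hw
      rw [hw, wordPar_nil, zero_mul, parSign, if_pos rfl, one_smul]
      refine hchElt_congr rfl ?_ fun _ _ => rfl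
      exact biop_congr (f := μM) rfl rfl rfl (a := fun j => seqVal L (_ + j))
        (fun q hq => absurd hq (Nat.not_lt_zero q)) fun _ _ => rfl
    · obtain ⟨i, hi⟩ : ∃ i, L.length - w.length = i := ⟨_, rfl⟩
      have hi' : L.length + 1 - w.length = i + 1 := by omega
      rw [hi] at h1 h2
      rw [if_neg hw, hi', bComp_of_lt (by omega) (by omega) (by omega),
        wordElt_letterMap h m (r := L.length - (i + 1) + 1)
        (s := i + 1 + (w.length + u.length + 1) - L.length - 2)
        (k := L.length + 1 - (w.length + u.length + 1)) (t := i)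
        (by omega) (by omega) (by omega) (by omega)]
      congr 1
      · rw [sgn_eq_parSign, Int.cast_mul, Int.cast_add, h1, h2, degPar, wordPar_append]
        congr 1
        ring
      · refine hchElt_congr rfl rfl fun q _ => ?_
        congr 1
        omega
  · refine (splitSum₃_eq_sum ?_ ?_).symm
    · intro u w _
      obtain ⟨ψ, hψ⟩ := exists_addMonoidHom_wordElt_insert m u w
      rw [hψ, letterMu_nil_val, map_zero, smul_zero]
    · intro u v w h hv
      have hlen : L.length = u.length + (v.length + w.length) := by simp [← h]
      have hpos := List.length_pos_of_ne_nil hv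
      rw [bComp_of_le hpos (by omega)]
      congr 1
      · rw [sgn_eq_parSign]
        congr 1
        have h1 := sum_seqDeg_append_left u (v ++ w)
        rw [h] at h1
        rw [Int.cast_add, h1, degPar]
      · have hval := seqVal_insert_eq_replaceBlock h hv (letterMu μ hμ v)
          (letterMu_val (u := u) (w := w) hv) []
        rw [List.append_nil, h] at hval
        refine hchElt_congr (a' := replaceBlock _ _ _ _) ?_ rfl fun q hq => hval q hq
        simp only [List.length_append, List.length_cons]
        omega

theorem IsHochschildB.apply_wordElt {b : HChain R A M →ₗ[R] HChain R A M}
    (hb : IsHochschildB R gr μ grM μM b) (m : Letter grM) (L : List (Letter gr)) :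
    b (wordElt m L) = wrapOp letterPar degPar (letterMap μM 1 hμM) wordElt m L
        + barOp letterPar (letterMu μ hμ) degPar wordElt m L :=
  (hb _ _ _ _ _ m.2 fun _ hq => seqVal_mem L hq).trans (sum_bComp_eq m L)

theorem map_wrapOp {𝓜 𝓝 α Z Z' : Type*} [AddCommGroup Z] [AddCommGroup Z'] (G : Z →+ Z')
    {par : α → ZMod 2} {parM : 𝓜 → ZMod 2} {g : List α → 𝓜 → List α → 𝓝}
    {E : 𝓝 → List α → Z} (m : 𝓜) (L : List α) :
    G (wrapOp par parM g E m L) = wrapOp par parM g (fun n K => G (E n K)) m L := by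
  simp only [wrapOp, map_splitSum₃, map_zsmul]

theorem map_barOp {𝓜 α Z Z' : Type*} [AddCommGroup Z] [AddCommGroup Z'] (G : Z →+ Z')
    {par : α → ZMod 2} {parM : 𝓜 → ZMod 2} {mu : List α → α}
    {E : 𝓜 → List α → Z} (m : 𝓜) (L : List α) :
    G (barOp par mu parM E m L) = barOp par mu parM (fun n K => G (E n K)) m L := by
  simp only [barOp, map_splitSum₃, map_zsmul]

theorem wordElt_letterMu_relation (hA : IsAInftyAlgebra R gr μ) (m : Letter grM)
    (x Y z : List (Letter gr)) :
    (splitSum₃ Y fun u v w => parSign (wordPar letterPar u) •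
      wordElt m (x ++ letterMu μ hμ (u ++ letterMu μ hμ v :: w) :: z)) = 0 := by
  obtain ⟨ψ, hψ⟩ := exists_addMonoidHom_wordElt_insert m x z
  simp only [hψ, ← map_zsmul, ← map_splitSum₃]
  rw [letterMu_relation hA, map_zero]

theorem IsHochschildB.sq_wordElt (hA : IsAInftyAlgebra R gr μ)
    (hM : IsAInftyBimodule R gr μ grM μM) {b : HChain R A M →ₗ[R] HChain R A M}
    (hb : IsHochschildB R gr μ grM μM b) (m : Letter grM) (L : List (Letter gr)) :
    b (b (wordElt m L)) = 0 := by
  have hb' := fun m L => hb.apply_wordElt (hμ := hA.2.1) (hμM := hM.2.1) m L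
  rw [hb', map_add]
  refine (congrArg₂ _ (map_wrapOp b.toAddMonoidHom m L) (map_barOp b.toAddMonoidHom m L)).trans ?_
  simp only [LinearMap.toAddMonoidHom_coe, hb']
  refine hochschildOp_sq (letterPar_letterMu _) (fun w m u => ?_) wordElt
    (wordElt_letterMu_relation hA) (fun X m Y V => ?_) m L
  · rw [degPar_letterMap]
    simp
  · obtain ⟨ψ, hψ⟩ := exists_addMonoidHom_wordElt (grM := grM) V
    simp only [hψ, ← map_zsmul, ← map_splitSum₃, ← map_splitSum, ← map_add]
    rw [splitSum₃_letterMap_left hM.1 X Y m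
        (σ := fun i => sgn (∑ q ∈ range i, (seqDeg (X ++ Y) q - 1))),
      splitSum₃_letterMap_right hM.1 X Y m
        (τ := fun u => wordPar letterPar X + wordPar letterPar u + degPar m)
        (σ := fun i => sgn ((∑ q ∈ range (X.length + i), (seqDeg (X ++ Y) q - 1)) + m.1.1)),
      splitSum_letterMap_letterMap X Y m
        (σ := fun i => sgn (∑ q ∈ range i, (seqDeg (X ++ Y) q - 1)))]
    · refine Eq.trans (congrArg ψ ?_) (map_zero ψ)
      refine hM.2.2 X.length Y.length (seqDeg (X ++ Y)) m.1.1 (seqVal (X ++ Y)) m.1.2 ?_ m.2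
      exact fun q hq => seqVal_mem _ (by rwa [List.length_append])
    · intro u v h
      rw [sgn_eq_parSign, ← h, List.append_assoc, sum_seqDeg_append_left]
    · intro u v h
      have := sum_seqDeg_append_left (X ++ u) v
      rw [List.append_assoc, h, List.length_append, wordPar_append] at this
      rw [sgn_eq_parSign, Int.cast_add, this, degPar]
    · intro u v h
      rw [sgn_eq_parSign, ← h, List.append_assoc, sum_seqDeg_append_left]

theorem IsBimoduleMorphism.comm_wordElt (hA : IsAInftyAlgebra R gr μ)
    (hM : IsAInftyBimodule R gr μ grM μM) (hN : IsAInftyBimodule R gr μ grN μN)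
    (hmor : IsBimoduleMorphism R gr μ grM μM grN μN dg f)
    {bM : HChain R A M →ₗ[R] HChain R A M} (hbM : IsHochschildB R gr μ grM μM bM)
    {bN : HChain R A N →ₗ[R] HChain R A N} (hbN : IsHochschildB R gr μ grN μN bN)
    {F : HChain R A M →ₗ[R] HChain R A N}
    (hF : ∀ (m : Letter grM) (L : List (Letter gr)),
      F (wordElt m L) = wrapOp letterPar degPar (letterMap f dg hmor.2.1) wordElt m L)
    (m : Letter grM) (L : List (Letter gr)) :
    bN (F (wordElt m L)) = sgn dg • F (bM (wordElt m L)) := by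
  have hbM' := fun m L => hbM.apply_wordElt (hμ := hA.2.1) (hμM := hM.2.1) m L
  have hbN' := fun m L => hbN.apply_wordElt (hμ := hA.2.1) (hμM := hN.2.1) m L
  rw [hbM', hF, map_add]
  refine (map_wrapOp bN.toAddMonoidHom m L).trans (Eq.trans ?_ (congrArg (sgn dg • ·)
    (congrArg₂ _ (map_wrapOp F.toAddMonoidHom m L) (map_barOp F.toAddMonoidHom m L)).symm))
  simp only [LinearMap.toAddMonoidHom_coe, hbN', hF, sgn_eq_parSign]
  refine wrapOp_comm (letterPar_letterMu _) (fun w m u => ?_) (fun w m u => ?_) wordElt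
    (fun X m Y V => ?_) m L
  · rw [degPar_letterMap]
    simp
  · rw [degPar_letterMap]
  · obtain ⟨ψ, hψ⟩ := exists_addMonoidHom_wordElt (grM := grN) V
    simp only [hψ, ← map_zsmul, ← map_splitSum₃, ← map_splitSum, ← map_add]
    rw [splitSum₃_letterMap_left hmor.1 X Y m
        (τ := fun u => wordPar letterPar u + (dg : ZMod 2))
        (σ := fun i => sgn ((∑ q ∈ range i, (seqDeg (X ++ Y) q - 1)) + dg)),
      splitSum₃_letterMap_right hmor.1 X Y m
        (τ := fun u => wordPar letterPar X + wordPar letterPar u + degPar m + (dg : ZMod 2))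
        (σ := fun i => sgn ((∑ q ∈ range (X.length + i), (seqDeg (X ++ Y) q - 1)) + m.1.1 + dg)),
      splitSum_letterMap_letterMap X Y m
        (τ := fun u => (dg : ZMod 2) * wordPar letterPar u)
        (σ := fun i => sgn (dg * ∑ q ∈ range i, (seqDeg (X ++ Y) q - 1))),
      splitSum_letterMap_letterMap X Y m
        (τ := fun u => wordPar letterPar u + (dg : ZMod 2))
        (σ := fun i => sgn ((∑ q ∈ range i, (seqDeg (X ++ Y) q - 1)) + dg))]
    · refine congrArg ψ ?_
      refine hmor.2.2 X.length Y.length (seqDeg (X ++ Y)) m.1.1 (seqVal (X ++ Y)) m.1.2 ?_ m.2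
      exact fun q hq => seqVal_mem _ (by rwa [List.length_append])
    · intro u v h
      rw [sgn_eq_parSign, ← h, List.append_assoc, Int.cast_add, sum_seqDeg_append_left]
    · intro u v h
      rw [sgn_eq_parSign, ← h, List.append_assoc, Int.cast_mul, sum_seqDeg_append_left]
    · intro u v h
      have := sum_seqDeg_append_left (X ++ u) v
      rw [List.append_assoc, h, List.length_append, wordPar_append] at this
      rw [sgn_eq_parSign, Int.cast_add, Int.cast_add, this, degPar]
    · intro u v h
      rw [sgn_eq_parSign, ← h, List.append_assoc, Int.cast_add, sum_seqDeg_append_left]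

end Operators

section Grading

variable {R : Type} [CommRing R] {A M N : Type} [AddCommGroup A] [Module R A]
  [AddCommGroup M] [Module R M] [AddCommGroup N] [Module R N]
  {gr : ℤ → Submodule R A} {grM : ℤ → Submodule R M} {grN : ℤ → Submodule R N}

/-- The endomorphism of a graded module which is multiplication by `c d` in degree `d`. -/
noncomputable def gradedScale (hgr : DirectSum.IsInternal gr) (c : ℤ → R) : A →ₗ[R] A :=
  (DirectSum.toModule R ℤ A fun i => c i • (gr i).subtype) ∘ₗ
    (LinearEquiv.ofBijective (DirectSum.coeLinearMap gr) hgr).symm.toLinearMap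

theorem gradedScale_apply (hgr : DirectSum.IsInternal gr) (c : ℤ → R) {d : ℤ} {a : A}
    (ha : a ∈ gr d) : gradedScale hgr c a = c d • a := by
  have h : (LinearEquiv.ofBijective (DirectSum.coeLinearMap gr) hgr).symm a
      = DirectSum.lof R ℤ (fun i => gr i) d ⟨a, ha⟩ := by
    rw [LinearEquiv.symm_apply_eq]
    exact (DirectSum.coeLinearMap_lof gr d ⟨a, ha⟩).symm
  rw [gradedScale, LinearMap.comp_apply, LinearEquiv.coe_coe, h, DirectSum.toModule_lof]
  rfl

theorem span_homogeneous (hgr : DirectSum.IsInternal gr) :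
    Submodule.span R {a : A | ∃ d, a ∈ gr d} = ⊤ := by
  rw [eq_top_iff, ← hgr.submodule_iSup_eq_top, iSup_le_iff]
  exact fun d a ha => Submodule.subset_span ⟨d, ha⟩

theorem linearMap_ext_homogeneous (hgr : DirectSum.IsInternal gr) {φ ψ : A →ₗ[R] M}
    (h : ∀ d, ∀ a ∈ gr d, φ a = ψ a) : φ = ψ :=
  LinearMap.ext_on (span_homogeneous hgr) fun a ⟨d, ha⟩ => h d a ha

theorem multilinearMap_ext_of_span {ι : Type*} [Fintype ι] [DecidableEq ι] {S : Set A}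
    (hS : Submodule.span R S = ⊤)
    {φ ψ : MultilinearMap R (fun _ : ι => A) M}
    (h : ∀ v, (∀ i, v i ∈ S) → φ v = ψ v) : φ = ψ := by
  have key : ∀ (s : Finset ι) (v : ι → A), (∀ i ∉ s, v i ∈ S) → φ v = ψ v := by
    intro s
    induction s using Finset.induction with
    | empty => exact fun v hv => h v fun i => hv i (notMem_empty i)
    | insert i s _ ih =>
      intro v hv
      have hlin : φ.toLinearMap v i = ψ.toLinearMap v i := by
        refine LinearMap.ext_on hS fun a ha => ih _ fun k hk => ?_
        rcases eq_or_ne k i with rfl | hki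
        · rwa [Function.update_self]
        · rw [Function.update_of_ne hki]
          exact hv k (by simp [hki, hk])
      simpa using LinearMap.congr_fun hlin (v i)
  exact MultilinearMap.ext fun v => key univ v (by simp)

theorem exists_wordElt_eq {n : ℕ} {dm : ℤ} {d : ℕ → ℤ} {m : M} {a : ℕ → A}
    (hm : m ∈ grM dm) (ha : ∀ q, q < n → a q ∈ gr (d q)) :
    ∃ (x : Letter grM) (L : List (Letter gr)), x.1 = (dm, m) ∧ L.length = n ∧
      (∀ q, q < n → seqDeg L q = d q) ∧ hchElt R n m a = wordElt x L := by
  have hlen : ∀ g : Fin n → Letter gr, (List.ofFn g).length = n := fun g => List.length_ofFn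
  refine ⟨⟨(dm, m), hm⟩, List.ofFn fun i : Fin n => ⟨(d i, a i), ha i i.2⟩, rfl, hlen _, ?_, ?_⟩
  · intro q hq
    simp [seqDeg, hq]
  · refine hchElt_congr (hlen _).symm rfl fun q hq => ?_
    simp [seqVal, hq]

/-- Linear maps on `M ⊗ A^{⊗n}` agree if they agree on homogeneous elementary tensors. -/
theorem htens_ext (hgr : DirectSum.IsInternal gr) (hgrM : DirectSum.IsInternal grM) {n : ℕ}
    {φ ψ : HTens R A M n →ₗ[R] N}
    (h : ∀ (dm : ℤ) (d : ℕ → ℤ) (m : M) (a : ℕ → A), m ∈ grM dm →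
      (∀ q, q < n → a q ∈ gr (d q)) →
      φ (m ⊗ₜ[R] PiTensorProduct.tprod R fun i : Fin n => a i)
        = ψ (m ⊗ₜ[R] PiTensorProduct.tprod R fun i : Fin n => a i)) : φ = ψ := by
  refine TensorProduct.ext ?_
  refine linearMap_ext_homogeneous hgrM fun dm m hm => PiTensorProduct.ext ?_
  refine multilinearMap_ext_of_span (span_homogeneous hgr) fun v hv => ?_
  choose d hd using hv
  have := h dm (fun q => if hq : q < n then d ⟨q, hq⟩ else 0) m
    (fun q => if hq : q < n then v ⟨q, hq⟩ else 0) hm (fun q hq => by simp [hq, hd])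
  simpa using this

/-- Linear maps on Hochschild chains agree if they agree on homogeneous elementary chains. -/
theorem hchain_ext (hgr : DirectSum.IsInternal gr) (hgrM : DirectSum.IsInternal grM)
    {G G' : HChain R A M →ₗ[R] N}
    (h : ∀ (m : Letter grM) (L : List (Letter gr)), G (wordElt m L) = G' (wordElt m L)) :
    G = G' := by
  refine DirectSum.linearMap_ext R fun n => htens_ext hgr hgrM fun dm d m a hm ha => ?_
  obtain ⟨x, L, -, -, -, hx⟩ := exists_wordElt_eq (R := R) hm ha
  have := h x L
  rwa [← hx] at this

theorem span_wordElt (hgr : DirectSum.IsInternal gr) (hgrM : DirectSum.IsInternal grM) :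
    Submodule.span R {x : HChain R A M | ∃ (m : Letter grM) (L : List (Letter gr)),
      x = wordElt m L} = ⊤ := by
  rw [← Submodule.ker_mkQ (Submodule.span R _), LinearMap.ker_eq_top]
  refine hchain_ext hgr hgrM fun m L => ?_
  rw [LinearMap.zero_apply, ← LinearMap.mem_ker, Submodule.ker_mkQ]
  exact Submodule.subset_span ⟨m, L, rfl⟩

/-- The cohomological degree of a word with coefficient `m`. -/
def wordDeg (m : Letter grM) (L : List (Letter gr)) : ℤ :=
  m.1.1 + (L.map fun p => p.1.1 - 1).sum

theorem sum_seqDeg (L : List (Letter gr)) :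
    ∑ q ∈ range L.length, (seqDeg L q - 1) = (L.map fun p => p.1.1 - 1).sum := by
  induction L with
  | nil => rfl
  | cons p L ih =>
    rw [List.length_cons, sum_range_succ', List.map_cons, List.sum_cons, ← ih, add_comm]
    rfl

theorem wordElt_mem_hchDeg (m : Letter grM) (L : List (Letter gr)) :
    wordElt m L ∈ hchDeg R gr grM (-wordDeg m L) := by
  refine Submodule.subset_span ⟨L.length, m.1.1, seqDeg L, m.1.2, seqVal L, m.2,
    fun q hq => seqVal_mem L hq, ?_, rfl⟩
  rw [sum_seqDeg, wordDeg]
  ring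

theorem hchDeg_le {j : ℤ} {S : Submodule R (HChain R A M)}
    (h : ∀ (m : Letter grM) (L : List (Letter gr)), -wordDeg m L = j → wordElt m L ∈ S) :
    hchDeg R gr grM j ≤ S := by
  refine Submodule.span_le.mpr ?_
  rintro _ ⟨n, dm, d, m, a, hm, ha, hj, rfl⟩
  obtain ⟨x, L, hx, hL, hd, h'⟩ := exists_wordElt_eq (R := R) hm ha
  rw [h']
  refine h x L ?_
  rw [wordDeg, ← sum_seqDeg, hx, hL, ← hj, sum_congr rfl fun q hq => by
    rw [hd q (mem_range.mp hq)]]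
  ring

/-- The projection of Hochschild chains to a single multidegree. -/
noncomputable def multidegProj (hgr : DirectSum.IsInternal gr) (hgrM : DirectSum.IsInternal grM)
    (k : Σ n : ℕ, ℤ × (Fin n → ℤ)) : HChain R A M →ₗ[R] HChain R A M :=
  DirectSum.lof R ℕ (fun n => HTens R A M n) k.1 ∘ₗ
    TensorProduct.map (gradedScale hgrM (Pi.single k.2.1 1))
      (PiTensorProduct.map fun i => gradedScale hgr (Pi.single (k.2.2 i) 1)) ∘ₗ
    DirectSum.component R ℕ (fun n => HTens R A M n) k.1

/-- The multidegree of a word. -/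
def multideg (m : Letter grM) (L : List (Letter gr)) : Σ n : ℕ, ℤ × (Fin n → ℤ) :=
  ⟨L.length, m.1.1, fun i => seqDeg L i⟩

theorem multidegProj_wordElt (hgr : DirectSum.IsInternal gr) (hgrM : DirectSum.IsInternal grM)
    (k : Σ n : ℕ, ℤ × (Fin n → ℤ)) (m : Letter grM) (L : List (Letter gr)) :
    multidegProj hgr hgrM k (wordElt m L) = if k = multideg m L then wordElt m L else 0 := by
  obtain ⟨n, dm, d⟩ := k
  rw [multidegProj, LinearMap.comp_apply, LinearMap.comp_apply, wordElt, hchElt]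
  by_cases hn : L.length = n
  · subst hn
    rw [DirectSum.component.lof_self, TensorProduct.map_tmul, PiTensorProduct.map_tprod,
      gradedScale_apply hgrM _ m.2]
    simp only [gradedScale_apply hgr _ (seqVal_mem L (Fin.is_lt _))]
    split_ifs with h
    · simp only [multideg, Sigma.mk.injEq, heq_eq_eq, Prod.mk.injEq, true_and] at h
      obtain ⟨rfl, rfl⟩ := h
      simp
    · by_cases hdm : dm = m.1.1
      · obtain ⟨i, hi⟩ : ∃ i, d i ≠ seqDeg L i := by
          by_contra! hd
          exact h (by rw [multideg, hdm, funext hd])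
        rw [(PiTensorProduct.tprod R).map_coord_zero i (by rw [Pi.single_eq_of_ne hi.symm, zero_smul]),
          TensorProduct.tmul_zero, map_zero]
      · rw [Pi.single_eq_of_ne (Ne.symm hdm), zero_smul, TensorProduct.zero_tmul, map_zero]
  · rw [DirectSum.component.of, dif_neg hn, map_zero, map_zero, if_neg]
    exact fun h => hn (congrArg Sigma.fst h).symm

/-- The degree of a multidegree. -/
def totalDeg (k : Σ n : ℕ, ℤ × (Fin n → ℤ)) : ℤ := -k.2.1 - ∑ i, (k.2.2 i - 1)

theorem totalDeg_multideg (m : Letter grM) (L : List (Letter gr)) :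
    totalDeg (multideg m L) = -wordDeg m L := by
  rw [totalDeg, multideg, wordDeg, ← sum_seqDeg]
  simp only [Fin.sum_univ_eq_sum_range (fun q => seqDeg L q - 1)]
  ring

theorem finite_support_multidegProj (hgr : DirectSum.IsInternal gr)
    (hgrM : DirectSum.IsInternal grM) (x : HChain R A M) :
    (Function.support fun k => multidegProj hgr hgrM k x).Finite := by
  have hx : x ∈ Submodule.span R {x : HChain R A M | ∃ (m : Letter grM) (L : List (Letter gr)),
      x = wordElt m L} := by
    rw [span_wordElt hgr hgrM]
    trivial
  induction hx using Submodule.span_induction with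
  | mem x h =>
    obtain ⟨m, L, rfl⟩ := h
    refine (Set.finite_singleton (multideg m L)).subset fun k hk => ?_
    by_contra hne
    exact hk (by simp only [multidegProj_wordElt]; exact if_neg hne)
  | zero => simp
  | add x y _ _ hx hy =>
    simp only [map_add]
    exact (hx.union hy).subset (Function.support_add _ _)
  | smul c x _ hx =>
    simp only [map_smul]
    exact hx.subset (Function.support_const_smul_subset c _)

open scoped Classical in
/-- The projection of Hochschild chains to the part of degree `j`. -/
noncomputable def degProj (hgr : DirectSum.IsInternal gr) (hgrM : DirectSum.IsInternal grM)
    (j : ℤ) : HChain R A M →ₗ[R] HChain R A M where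
  toFun x := ∑ᶠ k, if totalDeg k = j then multidegProj hgr hgrM k x else 0
  map_add' x y := by
    rw [← finsum_add_distrib]
    · refine finsum_congr fun k => ?_
      split_ifs <;> simp
    · refine (finite_support_multidegProj hgr hgrM x).subset fun k hk => ?_
      simp only [Function.mem_support, ne_eq, ite_eq_right_iff, Classical.not_imp] at hk
      exact hk.2
    · refine (finite_support_multidegProj hgr hgrM y).subset fun k hk => ?_
      simp only [Function.mem_support, ne_eq, ite_eq_right_iff, Classical.not_imp] at hk
      exact hk.2
  map_smul' c x := by
    rw [RingHom.id_apply, smul_finsum']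
    · refine finsum_congr fun k => ?_
      split_ifs <;> simp
    · refine (finite_support_multidegProj hgr hgrM x).subset fun k hk => ?_
      simp only [Function.mem_support, ne_eq, ite_eq_right_iff, Classical.not_imp] at hk
      exact hk.2

theorem degProj_wordElt (hgr : DirectSum.IsInternal gr) (hgrM : DirectSum.IsInternal grM)
    (j : ℤ) (m : Letter grM) (L : List (Letter gr)) :
    degProj hgr hgrM j (wordElt m L) = if -wordDeg m L = j then wordElt m L else 0 := by
  refine (finsum_eq_single _ (multideg m L) fun k hk => ?_).trans ?_
  · rw [multidegProj_wordElt, if_neg hk, ite_self]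
  · rw [totalDeg_multideg, multidegProj_wordElt, if_pos rfl]

theorem degProj_mem (hgr : DirectSum.IsInternal gr) (hgrM : DirectSum.IsInternal grM)
    (j : ℤ) (x : HChain R A M) : degProj hgr hgrM j x ∈ hchDeg R gr grM j := by
  have h : Submodule.comap (degProj hgr hgrM j) (hchDeg R gr grM j) = ⊤ := by
    rw [eq_top_iff, ← span_wordElt hgr hgrM, Submodule.span_le]
    rintro _ ⟨m, L, rfl⟩
    rw [SetLike.mem_coe, Submodule.mem_comap, degProj_wordElt]
    split_ifs with h
    · exact h ▸ wordElt_mem_hchDeg m L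
    · exact zero_mem _
  exact (h ▸ Submodule.mem_top : x ∈ Submodule.comap _ _)

theorem degProj_eq_self (hgr : DirectSum.IsInternal gr) (hgrM : DirectSum.IsInternal grM)
    {j : ℤ} {x : HChain R A M} (hx : x ∈ hchDeg R gr grM j) : degProj hgr hgrM j x = x := by
  have h : hchDeg R gr grM j ≤ LinearMap.eqLocus (degProj hgr hgrM j) LinearMap.id :=
    hchDeg_le fun m L hj => by
      rw [LinearMap.mem_eqLocus, degProj_wordElt, if_pos hj, LinearMap.id_apply]
  exact h hx

/-- A homogeneous map commutes with the projections to the homogeneous parts. -/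
theorem degProj_map (hgr : DirectSum.IsInternal gr) (hgrM : DirectSum.IsInternal grM)
    (hgrN : DirectSum.IsInternal grN) {G : HChain R A M →ₗ[R] HChain R A N} {e : ℤ}
    (hG : ∀ (m : Letter grM) (L : List (Letter gr)),
      G (wordElt m L) ∈ hchDeg R gr grN (-wordDeg m L + e)) (j : ℤ) (x : HChain R A M) :
    degProj hgr hgrN (j + e) (G x) = G (degProj hgr hgrM j x) := by
  have h : degProj hgr hgrN (j + e) ∘ₗ G = G ∘ₗ degProj hgr hgrM j := by
    refine hchain_ext hgr hgrM fun m L => ?_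
    rw [LinearMap.comp_apply, LinearMap.comp_apply, degProj_wordElt]
    split_ifs with hj
    · rw [← hj, degProj_eq_self hgr hgrN (hG m L)]
    · have h0 : hchDeg R gr grN (-wordDeg m L + e)
          ≤ LinearMap.ker (degProj hgr hgrN (j + e)) :=
        hchDeg_le fun m' L' hj' => by
          rw [LinearMap.mem_ker, degProj_wordElt, if_neg (by omega)]
      rw [map_zero]
      exact h0 (hG m L)
  exact LinearMap.congr_fun h x

end Grading

section Degrees

theorem splitSum_mem {α Z : Type*} [AddCommGroup Z] (S : AddSubgroup Z) {L : List α}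
    {φ : List α → List α → Z} (h : ∀ u v, u ++ v = L → φ u v ∈ S) : splitSum L φ ∈ S := by
  induction L generalizing φ with
  | nil => exact h [] [] rfl
  | cons a L ih =>
    exact add_mem (h [] (a :: L) rfl) (ih fun u v huv => h (a :: u) v (by simp [huv]))

theorem splitSum₃_mem {α Z : Type*} [AddCommGroup Z] (S : AddSubgroup Z) {L : List α}
    {φ : List α → List α → List α → Z} (h : ∀ u v w, u ++ (v ++ w) = L → φ u v w ∈ S) :
    splitSum₃ L φ ∈ S :=
  splitSum_mem S fun u x hux => splitSum_mem S fun v w hvw => h u v w (by rw [hvw, hux])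

variable {R : Type} [CommRing R] {A M N : Type} [AddCommGroup A] [Module R A]
  [AddCommGroup M] [Module R M] [AddCommGroup N] [Module R N]
  {gr : ℤ → Submodule R A} {grM : ℤ → Submodule R M} {grN : ℤ → Submodule R N}

theorem sum_fin_seqDeg (L : List (Letter gr)) :
    ∑ i : Fin L.length, seqDeg L i = (L.map fun p => p.1.1 - 1).sum + L.length := by
  rw [← sum_seqDeg, Fin.sum_univ_eq_sum_range (fun q => seqDeg L q), sum_sub_distrib]
  simp

theorem wrapOp_wordElt_mem {f : (r s : ℕ) → (Fin r → A) → M → (Fin s → A) → N} {dg : ℤ}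
    (hf : ∀ (r s : ℕ) (dx : Fin r → ℤ) (dm : ℤ) (dy : Fin s → ℤ)
      (x : Fin r → A) (m : M) (y : Fin s → A),
      (∀ i, x i ∈ gr (dx i)) → m ∈ grM dm → (∀ j, y j ∈ gr (dy j)) →
      f r s x m y ∈ grN ((∑ i, dx i) + dm + (∑ j, dy j) + dg - r - s))
    (m : Letter grM) (L : List (Letter gr)) :
    wrapOp letterPar degPar (letterMap f dg hf) (wordElt (R := R)) m L
      ∈ hchDeg R gr grN (-wordDeg m L + -dg) := by
  refine splitSum₃_mem (hchDeg R gr grN _).toAddSubgroup fun u v w hL => ?_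
  refine AddSubgroup.zsmul_mem _ ((Submodule.mem_toAddSubgroup _).mpr ?_) _
  convert wordElt_mem_hchDeg (R := R) (letterMap f dg hf w m u) v using 2
  subst hL
  simp only [wordDeg, letterMap, sum_fin_seqDeg, List.map_append, List.sum_append]
  ring

theorem barOp_wordElt_mem {μ : (n : ℕ) → (Fin n → A) → A}
    (hμ : ∀ (n : ℕ) (d : Fin n → ℤ) (a : Fin n → A),
      (∀ i, a i ∈ gr (d i)) → μ n a ∈ gr ((∑ i, d i) + 2 - n))
    (m : Letter grM) (L : List (Letter gr)) :
    barOp letterPar (letterMu μ hμ) degPar (wordElt (R := R)) m L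
      ∈ hchDeg R gr grM (-wordDeg m L + -1) := by
  refine splitSum₃_mem (hchDeg R gr grM _).toAddSubgroup fun u v w hL => ?_
  refine AddSubgroup.zsmul_mem _ ((Submodule.mem_toAddSubgroup _).mpr ?_) _
  convert wordElt_mem_hchDeg (R := R) m (u ++ letterMu μ hμ v :: w) using 2
  subst hL
  simp only [wordDeg, letterMu, sum_fin_seqDeg, List.map_append, List.sum_append, List.map_cons,
    List.sum_cons]
  ring

theorem IsHochschildB.wordElt_mem {μ : (n : ℕ) → (Fin n → A) → A}
    {μM : (r s : ℕ) → (Fin r → A) → M → (Fin s → A) → M} (hA : IsAInftyAlgebra R gr μ)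
    (hM : IsAInftyBimodule R gr μ grM μM) {b : HChain R A M →ₗ[R] HChain R A M}
    (hb : IsHochschildB R gr μ grM μM b) (m : Letter grM) (L : List (Letter gr)) :
    b (wordElt m L) ∈ hchDeg R gr grM (-wordDeg m L + -1) := by
  rw [hb.apply_wordElt (hμ := hA.2.1) (hμM := hM.2.1)]
  exact add_mem (wrapOp_wordElt_mem _ m L) (barOp_wordElt_mem _ m L)

theorem sgn_add (a b : ℤ) : sgn (a + b) = sgn a * sgn b := by
  simp only [sgn_eq_parSign, Int.cast_add, parSign_add]

theorem sgn_mul_self (a : ℤ) : sgn a * sgn a = 1 := by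
  rw [← pow_two, sgn, ← pow_mul, mul_comm, pow_mul, neg_one_sq, one_pow]

theorem sgn_neg (a : ℤ) : sgn (-a) = sgn a := by
  rw [sgn, sgn, Int.natAbs_neg]

theorem sgn_sum {ι : Type*} (s : Finset ι) (g : ι → ℤ) : sgn (∑ i ∈ s, g i) = ∏ i ∈ s, sgn (g i) := by
  classical
  induction s using Finset.induction with
  | empty => rfl
  | insert i s hi ih => rw [sum_insert hi, prod_insert hi, sgn_add, ih]

/-- The endomorphism of the Hochschild chains which is multiplication by `(-1)^{e j}` in
degree `j`. -/
noncomputable def degSign (hgr : DirectSum.IsInternal gr) (hgrM : DirectSum.IsInternal grM)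
    (e : ℤ) : HChain R A M →ₗ[R] HChain R A M :=
  DirectSum.toModule R ℕ _ fun n => DirectSum.lof R ℕ (fun n => HTens R A M n) n ∘ₗ
    TensorProduct.map (gradedScale hgrM fun d => (sgn (e * d) : R))
      (PiTensorProduct.map fun _ => gradedScale hgr fun d => (sgn (e * (d - 1)) : R))

theorem degSign_wordElt (hgr : DirectSum.IsInternal gr) (hgrM : DirectSum.IsInternal grM)
    (e : ℤ) (m : Letter grM) (L : List (Letter gr)) :
    degSign hgr hgrM e (wordElt m L) = sgn (e * wordDeg m L) • wordElt m L := by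
  rw [degSign, wordElt, hchElt, DirectSum.toModule_lof, LinearMap.comp_apply,
    TensorProduct.map_tmul, PiTensorProduct.map_tprod, gradedScale_apply hgrM _ m.2]
  simp only [gradedScale_apply hgr _ (seqVal_mem L (Fin.is_lt _))]
  rw [MultilinearMap.map_smul_univ, TensorProduct.smul_tmul_smul, map_smul, ← Int.cast_prod,
    ← Int.cast_mul, ← sgn_sum, ← sgn_add, ← Int.cast_smul_eq_zsmul R, wordDeg, ← sum_seqDeg,
    Fin.sum_univ_eq_sum_range (fun q => e * (seqDeg L q - 1)), ← mul_sum, mul_add]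

theorem degSign_apply (hgr : DirectSum.IsInternal gr) (hgrM : DirectSum.IsInternal grM)
    (e : ℤ) {j : ℤ} {x : HChain R A M} (hx : x ∈ hchDeg R gr grM j) :
    degSign hgr hgrM e x = sgn (e * j) • x := by
  have h : hchDeg R gr grM j
      ≤ LinearMap.eqLocus (degSign hgr hgrM e) ((sgn (e * j) : R) • LinearMap.id) :=
    hchDeg_le fun m L hj => by
      rw [LinearMap.mem_eqLocus, degSign_wordElt, ← hj, mul_neg, sgn_neg, LinearMap.smul_apply,
        LinearMap.id_apply, Int.cast_smul_eq_zsmul]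
  rw [← Int.cast_smul_eq_zsmul R]
  exact h hx

end Degrees

section TensorDerivation

variable {R : Type*} [CommRing R] {A : Type*} [AddCommGroup A] [Module R A]

/-- The map applying `ψ` to the `i`-th tensor factor and `ε` to the preceding ones. -/
noncomputable def tensorDerivTerm (ε ψ : A →ₗ[R] A) (n : ℕ) (i : Fin n) :
    PiTensorProduct R (fun _ : Fin n => A) →ₗ[R] PiTensorProduct R (fun _ : Fin n => A) :=
  PiTensorProduct.map fun j => if j < i then ε else if j = i then ψ else LinearMap.id

/-- The `ε`-twisted derivation of the `n`-th tensor power which extends `ψ`. -/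
noncomputable def tensorDeriv (ε ψ : A →ₗ[R] A) (n : ℕ) :
    PiTensorProduct R (fun _ : Fin n => A) →ₗ[R] PiTensorProduct R (fun _ : Fin n => A) :=
  ∑ i, tensorDerivTerm ε ψ n i

variable {ε ψ : A →ₗ[R] A}

theorem tensorDerivTerm_comp_self (hψ : ψ ∘ₗ ψ = 0) (n : ℕ) (i : Fin n) :
    tensorDerivTerm ε ψ n i ∘ₗ tensorDerivTerm ε ψ n i = 0 := by
  refine PiTensorProduct.ext (MultilinearMap.ext fun v => ?_)
  simp only [tensorDerivTerm, LinearMap.compMultilinearMap_apply, LinearMap.comp_apply,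
    PiTensorProduct.map_tprod, LinearMap.zero_apply]
  refine (PiTensorProduct.tprod R).map_coord_zero i ?_
  simpa using LinearMap.congr_fun hψ (v i)

theorem tensorDerivTerm_anticomm (h : ε ∘ₗ ψ = -(ψ ∘ₗ ε)) (n : ℕ) {i k : Fin n} (hik : i < k) :
    tensorDerivTerm ε ψ n i ∘ₗ tensorDerivTerm ε ψ n k
      = -(tensorDerivTerm ε ψ n k ∘ₗ tensorDerivTerm ε ψ n i) := by
  refine PiTensorProduct.ext (MultilinearMap.ext fun v => ?_)
  simp only [tensorDerivTerm, LinearMap.compMultilinearMap_apply, LinearMap.comp_apply,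
    PiTensorProduct.map_tprod, LinearMap.neg_apply]
  rw [← Function.update_eq_self i fun j => (if j < k then ε else if j = k then ψ else LinearMap.id)
      ((if j < i then ε else if j = i then ψ else LinearMap.id) (v j)),
    ← MultilinearMap.map_update_neg]
  congr 1
  funext j
  rcases lt_trichotomy j i with hj | rfl | hj
  · rw [Function.update_of_ne hj.ne, if_pos hj, if_pos (hj.trans hik)]
  · have hv : ψ (ε (v j)) = -ε (ψ (v j)) := by
      rw [← LinearMap.comp_apply ε, h, LinearMap.neg_apply, neg_neg, LinearMap.comp_apply]
    simpa [hik] using hv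
  · rw [Function.update_of_ne hj.ne', if_neg hj.not_gt, if_neg hj.ne']
    rfl

theorem tensorDeriv_sq (hψ : ψ ∘ₗ ψ = 0) (h : ε ∘ₗ ψ = -(ψ ∘ₗ ε)) (n : ℕ) :
    tensorDeriv ε ψ n ∘ₗ tensorDeriv ε ψ n = 0 := by
  change tensorDeriv ε ψ n * tensorDeriv ε ψ n = 0
  rw [tensorDeriv, sum_mul_sum, ← sum_product']
  refine sum_involution (fun (p : Fin n × Fin n) _ => p.swap) (fun p _ => ?_) (fun p _ hp heq => hp ?_)
    (fun _ _ => mem_univ _) (fun _ _ => Prod.swap_swap _)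
  · rcases lt_trichotomy p.1 p.2 with hlt | heq | hlt
    · exact (congrArg (· + _) (tensorDerivTerm_anticomm h n hlt)).trans (neg_add_cancel _)
    · rw [Prod.fst_swap, Prod.snd_swap, heq]
      exact (congrArg₂ _ (tensorDerivTerm_comp_self hψ n _) (tensorDerivTerm_comp_self hψ n _)).trans
        (add_zero 0)
    · exact (congrArg (_ + ·) (tensorDerivTerm_anticomm h n hlt)).trans (add_neg_cancel _)
  · obtain ⟨i, k⟩ := p
    obtain rfl : k = i := congrArg Prod.fst heq
    exact tensorDerivTerm_comp_self hψ n _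

end TensorDerivation

section LinearParts

variable {R : Type} [CommRing R] {A M N : Type} [AddCommGroup A] [Module R A]
  [AddCommGroup M] [Module R M] [AddCommGroup N] [Module R N]
  {gr : ℤ → Submodule R A} {grM : ℤ → Submodule R M} {grN : ℤ → Submodule R N}

/-- The linear map underlying a multilinear operation with one input. -/
def unaryMap {g : (Fin 1 → A) → A} (hg : IsMultilinear R g) : A →ₗ[R] A where
  toFun a := g fun _ => a
  map_add' x y := by
    have h := hg.1 0 0 x y
    simp only [Function.update_eq_const_of_subsingleton] at h
    exact h
  map_smul' c x := by
    have h := hg.2 0 0 c x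
    simp only [Function.update_eq_const_of_subsingleton] at h
    exact h

/-- The linear map underlying a component without algebra inputs. -/
def middleMap {g : (Fin 0 → A) → M → (Fin 0 → A) → N} (hg : IsTriMultilinear R g) :
    M →ₗ[R] N where
  toFun m := g (fun i => i.elim0) m fun i => i.elim0
  map_add' x y := hg.2.2.1 _ x y _
  map_smul' c x := hg.2.2.2.1 _ c x _

theorem unaryMap_apply {g : (Fin 1 → A) → A} (hg : IsMultilinear R g) (v : Fin 1 → A) {a : A}
    (h : v 0 = a) : g v = unaryMap hg a :=
  congrArg g (funext fun i => by rw [Subsingleton.elim i 0, h])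

theorem middleMap_apply {g : (Fin 0 → A) → M → (Fin 0 → A) → N} (hg : IsTriMultilinear R g)
    (x y : Fin 0 → A) (m : M) : g x m y = middleMap hg m := by
  rw [Subsingleton.elim x fun i => i.elim0, Subsingleton.elim y fun i => i.elim0]
  rfl

variable {μ : (n : ℕ) → (Fin n → A) → A} {μM : (r s : ℕ) → (Fin r → A) → M → (Fin s → A) → M}
  {μN : (r s : ℕ) → (Fin r → A) → N → (Fin s → A) → N}
  {f : (r s : ℕ) → (Fin r → A) → M → (Fin s → A) → N} {dg : ℤ}

theorem IsAInftyAlgebra.unaryMap_mem (hA : IsAInftyAlgebra R gr μ) {d : ℤ} {a : A}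
    (ha : a ∈ gr d) : unaryMap (hA.1 1) a ∈ gr (d + 1) := by
  have h := hA.2.1 1 (fun _ => d) (fun _ => a) fun _ => ha
  rw [show d + 1 = (∑ _i : Fin 1, d) + 2 - (1 : ℕ) by simp; ring]
  exact h

theorem IsAInftyAlgebra.unaryMap_comp_self (hA : IsAInftyAlgebra R gr μ)
    (hgr : DirectSum.IsInternal gr) : unaryMap (hA.1 1) ∘ₗ unaryMap (hA.1 1) = 0 := by
  refine linearMap_ext_homogeneous hgr fun d a ha => ?_
  have h := hA.2.2 1 le_rfl (fun _ => d) (fun _ => a) fun _ _ => ha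
  rw [Icc_self, sum_singleton, Nat.add_sub_cancel, sum_range_one, range_zero, sum_empty] at h
  rw [unaryMap_apply (hA.1 1) _ (a := unaryMap (hA.1 1) a) rfl] at h
  simpa [sgn] using h

theorem IsAInftyBimodule.middleMap_comp_self (hM : IsAInftyBimodule R gr μ grM μM)
    (hgrM : DirectSum.IsInternal grM) : middleMap (hM.1 0 0) ∘ₗ middleMap (hM.1 0 0) = 0 := by
  refine linearMap_ext_homogeneous hgrM fun d m hm => ?_
  have h := hM.2.2 0 0 0 d 0 m (by simp) hm
  simp only [sgn, Icc_eq_empty_of_lt one_pos, sum_empty, zero_add, range_one, sum_singleton,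
    range_zero, Int.natAbs_zero, pow_zero, one_smul, add_zero] at h
  rwa [middleMap_apply (hM.1 0 0), middleMap_apply (hM.1 0 0)] at h

theorem IsBimoduleMorphism.middleMap_comm (hf : IsBimoduleMorphism R gr μ grM μM grN μN dg f)
    (hM : ∀ r s, IsTriMultilinear R (μM r s)) (hN : ∀ r s, IsTriMultilinear R (μN r s))
    (hgrM : DirectSum.IsInternal grM) :
    middleMap (hN 0 0) ∘ₗ middleMap (hf.1 0 0)
      = sgn dg • (middleMap (hf.1 0 0) ∘ₗ middleMap (hM 0 0)) := by
  refine linearMap_ext_homogeneous hgrM fun d m hm => ?_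
  have h := hf.2.2 0 0 0 d 0 m (by simp) hm
  simpa [sgn, middleMap_apply (hM 0 0), middleMap_apply (hN 0 0), middleMap_apply (hf.1 0 0)]
    using h

theorem middleMap_mem
    (hf : ∀ (r s : ℕ) (dx : Fin r → ℤ) (dm : ℤ) (dy : Fin s → ℤ)
      (x : Fin r → A) (m : M) (y : Fin s → A),
      (∀ i, x i ∈ gr (dx i)) → m ∈ grM dm → (∀ j, y j ∈ gr (dy j)) →
      f r s x m y ∈ grN ((∑ i, dx i) + dm + (∑ j, dy j) + dg - r - s))
    (hlin : IsTriMultilinear R (f 0 0)) {d : ℤ} {m : M} (hm : m ∈ grM d) :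
    middleMap hlin m ∈ grN (d + dg) := by
  have h := hf 0 0 0 d 0 (fun i => i.elim0) m (fun i => i.elim0) (fun i => i.elim0) hm
    fun i => i.elim0
  simp only [univ_eq_empty, sum_empty, zero_add, add_zero, Nat.cast_zero, sub_zero] at h
  exact h

/-- A homogeneous map commutes with sign maps up to sign. -/
theorem gradedScale_comp {φ : M →ₗ[R] N} {e : ℤ} (hφ : ∀ d, ∀ m ∈ grM d, φ m ∈ grN (d + e))
    (hgrM : DirectSum.IsInternal grM) (hgrN : DirectSum.IsInternal grN) (k : ℤ) :
    gradedScale hgrN (fun d => (sgn (d + k) : R)) ∘ₗ φ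
      = sgn e • (φ ∘ₗ gradedScale hgrM fun d => (sgn (d + k) : R)) := by
  refine linearMap_ext_homogeneous hgrM fun d m hm => ?_
  rw [LinearMap.comp_apply, gradedScale_apply hgrN _ (hφ d m hm), LinearMap.smul_apply,
    LinearMap.comp_apply, gradedScale_apply hgrM _ hm, map_smul, Int.cast_smul_eq_zsmul,
    Int.cast_smul_eq_zsmul, smul_smul, ← sgn_add]
  ring_nf

theorem component_bComp (n i : ℕ) {l k : ℕ} (dm : ℤ) (d : ℕ → ℤ) (m : M) (a : ℕ → A)
    (h : l ∈ Icc 1 (n + 1) → n + 1 - l ≠ k) :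
    DirectSum.component R ℕ (fun k => HTens R A M k) k (bComp R μ μM n i l dm d m a) = 0 := by
  unfold bComp
  split_ifs with h1 h2 h3
  · exact (DirectSum.component.of ..).trans (dif_neg (h (mem_Icc.mpr ⟨h1.1, h1.2.1⟩)))
  · rw [map_zsmul]
    exact (congrArg _ ((DirectSum.component.of ..).trans
      (dif_neg (h (mem_Icc.mpr ⟨h1.1, h1.2.1⟩))))).trans (smul_zero _)
  · rw [map_zsmul]
    exact (congrArg _ ((DirectSum.component.of ..).trans
      (dif_neg (h (mem_Icc.mpr ⟨h1.1, h1.2.1⟩))))).trans (smul_zero _)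
  · exact map_zero _

/-- The Hochschild differential does not increase the length of a chain. -/
theorem IsHochschildB.component_lof_of_lt (hgr : DirectSum.IsInternal gr)
    (hgrM : DirectSum.IsInternal grM) {b : HChain R A M →ₗ[R] HChain R A M}
    (hb : IsHochschildB R gr μ grM μM b) {n k : ℕ} (hnk : n < k) (c : HTens R A M n) :
    DirectSum.component R ℕ (fun k => HTens R A M k) k
        (b (DirectSum.lof R ℕ (fun k => HTens R A M k) n c)) = 0 := by
  have h : DirectSum.component R ℕ (fun k => HTens R A M k) k ∘ₗ b ∘ₗ
        DirectSum.lof R ℕ (fun k => HTens R A M k) n = 0 := by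
    refine htens_ext hgr hgrM fun dm d m a hm ha => ?_
    have hb' := hb n dm d m a hm ha
    rw [hchElt] at hb'
    rw [LinearMap.comp_apply, LinearMap.comp_apply, hb', map_sum, LinearMap.zero_apply]
    refine sum_eq_zero fun l hl => ?_
    rw [map_sum]
    have := mem_Icc.mp hl
    exact sum_eq_zero fun i _ => component_bComp _ _ _ _ _ _ (by omega)
  exact LinearMap.congr_fun h c

/-- The leading term of the map of Hochschild chains induced by a bimodule map. -/
theorem component_fstarFormula (n : ℕ) (hf : IsTriMultilinear R (f 0 0)) (dm : ℤ) (d : ℕ → ℤ)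
    (m : M) (a : ℕ → A) :
    DirectSum.component R ℕ (fun k => HTens R A N k) n (fstarFormula R f dg n dm d m a)
      = sgn (dg * (dm + ∑ q ∈ range n, (d q - 1))) •
        (middleMap hf m ⊗ₜ[R] PiTensorProduct.tprod R fun i : Fin n => a i) := by
  rw [fstarFormula, map_sum, sum_eq_single 0, map_sum, sum_eq_single 0, map_zsmul]
  · refine (congrArg _ (DirectSum.component.lof_self ..)).trans ?_
    simp only [Nat.sub_zero, Ico_self, sum_empty, mul_zero, zero_add, middleMap_apply hf]
    rw [← sgn_neg]
    congr 2
    ring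
  · intro s hs hs0
    rw [map_zsmul]
    have := mem_range.mp hs
    exact (congrArg _ ((DirectSum.component.of ..).trans (dif_neg (by omega)))).trans (smul_zero _)
  · simp
  · intro r hr hr0
    rw [map_sum]
    refine sum_eq_zero fun s hs => ?_
    rw [map_zsmul]
    have := mem_range.mp hr
    have := mem_range.mp hs
    exact (congrArg _ ((DirectSum.component.of ..).trans (dif_neg (by omega)))).trans (smul_zero _)
  · simp

theorem component_fstarFormula_of_lt {n k : ℕ} (hnk : n < k) (dm : ℤ) (d : ℕ → ℤ)
    (m : M) (a : ℕ → A) :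
    DirectSum.component R ℕ (fun k => HTens R A N k) k (fstarFormula R f dg n dm d m a) = 0 := by
  simp only [fstarFormula, map_sum, map_zsmul]
  refine sum_eq_zero fun r _ => sum_eq_zero fun s _ => ?_
  exact (congrArg _ ((DirectSum.component.of ..).trans (dif_neg (by omega)))).trans (smul_zero _)

/-- The leading term of the Hochschild differential. -/
theorem IsHochschildB.component_lof (hA : IsAInftyAlgebra R gr μ)
    (hM : ∀ r s, IsTriMultilinear R (μM r s)) (hgr : DirectSum.IsInternal gr)
    (hgrM : DirectSum.IsInternal grM) {b : HChain R A M →ₗ[R] HChain R A M}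
    (hb : IsHochschildB R gr μ grM μM b) (n : ℕ) (c : HTens R A M n) :
    DirectSum.component R ℕ (fun k => HTens R A M k) n
        (b (DirectSum.lof R ℕ (fun k => HTens R A M k) n c))
      = TensorProduct.map (middleMap (hM 0 0)) LinearMap.id c
        + TensorProduct.map (gradedScale hgrM fun d => (sgn (d + 0) : R))
          (tensorDeriv (gradedScale hgr fun d => (sgn (d + -1) : R)) (unaryMap (hA.1 1)) n) c := by
  have h : DirectSum.component R ℕ (fun k => HTens R A M k) n ∘ₗ b ∘ₗ
        DirectSum.lof R ℕ (fun k => HTens R A M k) n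
      = TensorProduct.map (middleMap (hM 0 0)) LinearMap.id
        + TensorProduct.map (gradedScale hgrM fun d => (sgn (d + 0) : R))
          (tensorDeriv (gradedScale hgr fun d => (sgn (d + -1) : R)) (unaryMap (hA.1 1)) n) := by
    refine htens_ext hgr hgrM fun dm d m a hm ha => ?_
    have hb' := hb n dm d m a hm ha
    rw [hchElt] at hb'
    rw [LinearMap.comp_apply, LinearMap.comp_apply, hb', LinearMap.add_apply,
      TensorProduct.map_tmul, TensorProduct.map_tmul, LinearMap.id_apply,
      gradedScale_apply hgrM _ hm, map_sum, sum_eq_single 1, map_sum, sum_range_succ', add_comm]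
    · congr 1
      · rw [bComp_zero le_rfl (by omega), hchElt, middleMap_apply (hM 0 0)]
        refine (DirectSum.component.lof_self ..).trans ?_
        simp
      · rw [tensorDeriv, LinearMap.sum_apply, TensorProduct.tmul_sum, ← Fin.sum_univ_eq_sum_range
          (fun i => DirectSum.component R ℕ (fun k => HTens R A M k) n
            (bComp R μ μM n (i + 1) 1 dm d m a))]
        refine sum_congr rfl fun i _ => ?_
        rw [bComp_of_le le_rfl (by omega), map_zsmul, hchElt]
        refine (congrArg _ (DirectSum.component.lof_self ..)).trans ?_
        rw [tensorDerivTerm, PiTensorProduct.map_tprod]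
        have hv : (fun j : Fin n => (if j < i then gradedScale hgr fun d => (sgn (d + -1) : R)
              else if j = i then unaryMap (hA.1 1) else LinearMap.id) (a j))
            = fun j : Fin n => (if (j : ℕ) < i then (sgn (d j - 1) : R) else 1) •
              replaceBlock a i 1 (μ 1 fun k => a (i + k)) j := by
          funext j
          rcases lt_trichotomy j i with hj | rfl | hj
          · have hj' : (j : ℕ) < i := hj
            rw [if_pos hj, if_pos hj', replaceBlock, if_pos hj',
              gradedScale_apply hgr _ (ha j j.2)]
            rfl
          · rw [if_neg (lt_irrefl j), if_pos rfl, if_neg (lt_irrefl (j : ℕ)), replaceBlock,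
              if_neg (lt_irrefl (j : ℕ)), if_pos rfl, one_smul]
            exact (unaryMap_apply (hA.1 1) (fun k => a (j + k)) rfl).symm
          · have hj' : (i : ℕ) < j := hj
            rw [if_neg hj.not_gt, if_neg hj.ne', if_neg hj'.not_gt, replaceBlock,
              if_neg hj'.not_gt, if_neg hj'.ne', one_smul]
            rfl
        have hprod : (∏ j : Fin n, if (j : ℕ) < i then (sgn (d j - 1) : R) else 1)
            = (sgn (∑ q ∈ range i, (d q - 1)) : R) := by
          rw [Fin.prod_univ_eq_prod_range (fun j => if j < (i : ℕ) then (sgn (d j - 1) : R) else 1),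
            sgn_sum, Int.cast_prod, ← prod_filter]
          refine prod_congr (ext fun j => ?_) fun _ _ => rfl
          have := i.2
          simp only [mem_filter, mem_range]
          omega
        rw [hv, MultilinearMap.map_smul_univ, hprod, TensorProduct.smul_tmul_smul, ← Int.cast_mul,
          add_zero, ← sgn_add, Int.cast_smul_eq_zsmul]
        rfl
    · intro l hl hl1
      rw [map_sum]
      refine sum_eq_zero fun i hi => ?_
      have := mem_Icc.mp hl
      exact component_bComp _ _ _ _ _ _ (by omega)
    · simp
  exact LinearMap.congr_fun h c

end LinearParts

section TensorAcyclic

open LinearMap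

universe u v

variable {R : Type u} [CommRing R]

/-- Tensoring a short exact sequence whose third term is flat preserves injectivity. -/
theorem rTensor_injective_of_exact_of_flat {Z K Q : Type*} [AddCommGroup Z] [Module R Z]
    [AddCommGroup K] [Module R K] [AddCommGroup Q] [Module R Q] [Module.Flat R Q]
    {i : Z →ₗ[R] K} {q : K →ₗ[R] Q} (hi : Function.Injective i) (hq : Function.Surjective q)
    (hiq : Function.Exact i q) (X : Type v) [AddCommGroup X] [Module R X] :
    Function.Injective (i.rTensor X) := by
  obtain ⟨L, _, _, _, π, hπ⟩ : ∃ (L : Type (max u v)) (_ : AddCommGroup L) (_ : Module R L)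
      (_ : Module.Flat R L) (π : L →ₗ[R] X), Function.Surjective π :=
    ⟨X →₀ R, inferInstance, Finsupp.module X R, inferInstance, Finsupp.linearCombination R id,
      fun x => ⟨Finsupp.single x 1, (Finsupp.linearCombination_single R 1 x).trans (one_smul R x)⟩⟩
  let j := (ker π).subtype
  have hj : Function.Exact j π := LinearMap.exact_subtype_ker_map π
  rw [injective_iff_map_eq_zero]
  intro z hz
  obtain ⟨z', rfl⟩ := LinearMap.lTensor_surjective Z hπ z
  have h1 : (π.lTensor K) ((i.rTensor L) z') = 0 := by
    rw [← hz, ← LinearMap.comp_apply, ← LinearMap.comp_apply, lTensor_comp_rTensor,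
      rTensor_comp_lTensor]
  obtain ⟨r, hr⟩ := (_root_.lTensor_exact K hj hπ _).1 h1
  have h2 : (j.lTensor Q) ((q.rTensor _) r) = 0 := by
    have : (j.lTensor Q) ((q.rTensor _) r) = (q.rTensor L) ((j.lTensor K) r) := by
      rw [← LinearMap.comp_apply, ← LinearMap.comp_apply, lTensor_comp_rTensor,
        rTensor_comp_lTensor]
    rw [this, hr, ← LinearMap.comp_apply, ← LinearMap.rTensor_comp, hiq.linearMap_comp_eq_zero]
    simp
  have hjQ : Function.Injective (j.lTensor Q) :=
    Module.Flat.lTensor_preserves_injective_linearMap j (Submodule.subtype_injective _)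
  have h3 : (q.rTensor _) r = 0 := hjQ (by rw [h2, map_zero])
  obtain ⟨r', rfl⟩ := (_root_.rTensor_exact _ hiq hq _).1 h3
  have h4 : (i.rTensor L) ((j.lTensor Z) r') = (i.rTensor L) z' := by
    rw [← hr, ← LinearMap.comp_apply, ← LinearMap.comp_apply, lTensor_comp_rTensor,
        rTensor_comp_lTensor]
  have hiL : Function.Injective (i.rTensor L) :=
    Module.Flat.rTensor_preserves_injective_linearMap i hi
  rw [← hiL h4, ← LinearMap.comp_apply, ← LinearMap.lTensor_comp, hj.linearMap_comp_eq_zero]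
  simp

/-- An acyclic complex with flat cycles stays acyclic after tensoring with any module. -/
theorem exact_rTensor_of_flat_ker {K : Type*} [AddCommGroup K] [Module R K]
    {d : K →ₗ[R] K} (hd : Function.Exact d d) [Module.Flat R (ker d)]
    (X : Type*) [AddCommGroup X] [Module R X] :
    Function.Exact (d.rTensor X) (d.rTensor X) := by
  let q : K →ₗ[R] ker d := d.codRestrict (ker d) (fun x => hd.apply_apply_eq_zero x)
  let i := (ker d).subtype
  have hdq : d = i ∘ₗ q := rfl
  have hq : Function.Surjective q := by
    rintro ⟨x, hx⟩
    obtain ⟨y, rfl⟩ := (hd x).1 hx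
    exact ⟨y, rfl⟩
  have hiq : Function.Exact i q := by
    intro x
    rw [← (ker d).injective_subtype.eq_iff]
    constructor
    · intro hx
      exact ⟨⟨x, hx⟩, rfl⟩
    · rintro ⟨⟨y, hy⟩, rfl⟩
      exact hy
  have hi : Function.Injective (i.rTensor X) :=
    rTensor_injective_of_exact_of_flat (ker d).injective_subtype hq hiq X
  intro t
  constructor
  · intro ht
    rw [hdq, LinearMap.rTensor_comp, LinearMap.comp_apply] at ht
    have h1 : (q.rTensor X) t = 0 := hi (by rw [ht, map_zero])
    obtain ⟨z, rfl⟩ := (_root_.rTensor_exact X hiq hq t).1 h1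
    obtain ⟨s, rfl⟩ := LinearMap.rTensor_surjective X hq z
    exact ⟨s, LinearMap.congr_fun (LinearMap.rTensor_comp X i q) s⟩
  · rintro ⟨s, rfl⟩
    rw [← LinearMap.comp_apply, ← LinearMap.rTensor_comp, hd.linearMap_comp_eq_zero]
    simp

/-- The tensor product of an acyclic flat complex with flat cycles and an arbitrary complex is
acyclic; the sign in the total differential is encoded in the involution `ε`. -/
theorem exists_tensor_total_primitive {K C : Type*} [AddCommGroup K] [Module R K]
    [AddCommGroup C] [Module R C] {d ε : K →ₗ[R] K} {δ : C →ₗ[R] C}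
    (hd : Function.Exact d d) [Module.Flat R K] [Module.Flat R (ker d)]
    (hεd : ε ∘ₗ d = -(d ∘ₗ ε)) (hδ : δ ∘ₗ δ = 0)
    (t : K ⊗[R] C) (ht : TensorProduct.map d LinearMap.id t + TensorProduct.map ε δ t = 0) :
    ∃ w : K ⊗[R] C, TensorProduct.map d LinearMap.id w + TensorProduct.map ε δ w = t := by
  let p : C →ₗ[R] range δ := δ.rangeRestrict
  have hp : Function.Surjective p := δ.surjective_rangeRestrict
  let k := (ker δ).subtype
  have hkp : Function.Exact k p := by
    intro x
    rw [← (range δ).injective_subtype.eq_iff]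
    constructor
    · intro hx
      exact ⟨⟨x, hx⟩, rfl⟩
    · rintro ⟨⟨y, hy⟩, rfl⟩
      exact hy
  have hpδ : p ∘ₗ δ = 0 := by
    ext x
    exact LinearMap.congr_fun hδ x
  have hδk : δ ∘ₗ k = 0 := by
    ext x
    exact x.2
  have hd0 : d ∘ₗ d = 0 := hd.linearMap_comp_eq_zero
  have h1 : (d.rTensor _) ((p.lTensor K) t) = 0 := by
    have h := congrArg (p.lTensor K) ht
    rw [map_add, map_zero] at h
    simp only [LinearMap.lTensor, LinearMap.rTensor, ← LinearMap.comp_apply,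
      ← TensorProduct.map_comp, hpδ, LinearMap.id_comp, LinearMap.comp_id,
      TensorProduct.map_zero_right, LinearMap.zero_apply, add_zero] at h ⊢
    exact h
  obtain ⟨s', hs'⟩ := (exact_rTensor_of_flat_ker hd _ _).1 h1
  obtain ⟨t', rfl⟩ := LinearMap.lTensor_surjective K hp s'
  let t2 := t - (TensorProduct.map d LinearMap.id t' + TensorProduct.map ε δ t')
  have h2 : (p.lTensor K) t2 = 0 := by
    rw [map_sub, ← hs', map_add]
    simp only [LinearMap.lTensor, LinearMap.rTensor, ← LinearMap.comp_apply,
      ← TensorProduct.map_comp, hpδ, LinearMap.id_comp, LinearMap.comp_id,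
      TensorProduct.map_zero_right, LinearMap.zero_apply, add_zero, sub_self]
  obtain ⟨u, hu⟩ := (_root_.lTensor_exact K hkp hp _).1 h2
  have h3 : TensorProduct.map d LinearMap.id t2 + TensorProduct.map ε δ t2 = 0 := by
    have e1 : TensorProduct.map d (LinearMap.id : C →ₗ[R] C) ∘ₗ TensorProduct.map ε δ
        = - (TensorProduct.map ε δ ∘ₗ TensorProduct.map d LinearMap.id) := by
      rw [← TensorProduct.map_comp, ← TensorProduct.map_comp, hεd, LinearMap.id_comp,
        LinearMap.comp_id]
      ext x y
      simp [TensorProduct.neg_tmul]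
    have e2 : TensorProduct.map d (LinearMap.id : C →ₗ[R] C) ∘ₗ TensorProduct.map d LinearMap.id
        = 0 := by
      rw [← TensorProduct.map_comp, hd0, TensorProduct.map_zero_left]
    have e3 : TensorProduct.map ε δ ∘ₗ TensorProduct.map ε δ = 0 := by
      rw [← TensorProduct.map_comp, hδ, TensorProduct.map_zero_right]
    have e1' := LinearMap.congr_fun e1 t'
    have e2' := LinearMap.congr_fun e2 t'
    have e3' := LinearMap.congr_fun e3 t'
    simp only [LinearMap.comp_apply, LinearMap.neg_apply, LinearMap.zero_apply] at e1' e2' e3'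
    simp only [t2, map_sub, map_add, e1', e2', e3']
    rw [sub_add_sub_comm, ht]
    abel
  have h4 : (d.rTensor _) u = 0 := by
    have hinj : Function.Injective (k.lTensor K) :=
      Module.Flat.lTensor_preserves_injective_linearMap k (ker δ).injective_subtype
    apply hinj
    rw [map_zero, ← h3, ← hu]
    simp only [LinearMap.lTensor, LinearMap.rTensor, ← LinearMap.comp_apply,
      ← TensorProduct.map_comp, hδk, LinearMap.id_comp, LinearMap.comp_id,
      TensorProduct.map_zero_right, LinearMap.zero_apply, add_zero]
  obtain ⟨u', rfl⟩ := (exact_rTensor_of_flat_ker hd _ _).1 h4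
  refine ⟨t' + (k.lTensor K) u', ?_⟩
  have h5 : TensorProduct.map d LinearMap.id ((k.lTensor K) u')
      + TensorProduct.map ε δ ((k.lTensor K) u') = t2 := by
    rw [← hu]
    simp only [LinearMap.lTensor, LinearMap.rTensor, ← LinearMap.comp_apply,
      ← TensorProduct.map_comp, hδk, LinearMap.id_comp, LinearMap.comp_id,
      TensorProduct.map_zero_right, LinearMap.zero_apply, add_zero]
  rw [map_add, map_add, add_add_add_comm, h5]
  simp [t2]

end TensorAcyclic

section FilteredExactness

variable {R : Type*} [CommRing R] {X : ℕ → Type*} [∀ n, AddCommGroup (X n)] [∀ n, Module R (X n)]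
  {D : DirectSum ℕ X →ₗ[R] DirectSum ℕ X} {D₀ : ∀ n, X n →ₗ[R] X n}

/-- If an endomorphism of `⨁ n, X n` does not raise the index, it preserves the filtration by
the index. -/
theorem apply_eq_zero_of_forall_ge
    (hlt : ∀ n k : ℕ, n < k → ∀ c, D (DirectSum.lof R ℕ X n c) k = 0)
    {p : ℕ} {x : DirectSum ℕ X} (hx : ∀ k, p ≤ k → x k = 0) {k : ℕ} (hk : p ≤ k) :
    D x k = 0 := by
  classical
  rw [← DirectSum.sum_support_of x, map_sum, DFinsupp.finsetSum_apply]
  refine Finset.sum_eq_zero fun n hn => ?_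
  rw [← DirectSum.lof_eq_of R]
  refine hlt n k (lt_of_lt_of_le ?_ hk) _
  by_contra! h
  exact (DFinsupp.mem_support_toFun x n).1 hn (hx n h)

/-- A square-zero endomorphism of `⨁ n, X n` which does not raise the index is exact as soon as
its diagonal parts are. -/
theorem exists_apply_eq_of_triangular (hD : ∀ x, D (D x) = 0)
    (hlt : ∀ n k : ℕ, n < k → ∀ c, D (DirectSum.lof R ℕ X n c) k = 0)
    (hdiag : ∀ n c, D (DirectSum.lof R ℕ X n c) n = D₀ n c)
    (hD₀ : ∀ n c, D₀ n c = 0 → ∃ w, D₀ n w = c)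
    (x : DirectSum ℕ X) (hx : D x = 0) : ∃ w, D w = x := by
  classical
  suffices h : ∀ p : ℕ, ∀ x : DirectSum ℕ X, (∀ k, p ≤ k → x k = 0) → D x = 0 → ∃ w, D w = x by
    refine h ((DFinsupp.support x).sup id + 1) x (fun k hk => ?_) hx
    by_contra hne
    have := Finset.le_sup (f := id) ((DFinsupp.mem_support_toFun x k).2 hne)
    simp only [id] at this
    omega
  intro p
  induction p with
  | zero =>
    intro x hx0 _
    exact ⟨0, by rw [map_zero]; ext k; exact (hx0 k k.zero_le).symm⟩
  | succ p ih =>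
    intro x hx0 hx
    have hself : ∀ (c : X p), DirectSum.lof R ℕ X p c p = c := fun c => DirectSum.lof_apply R p c
    have hne : ∀ (c : X p) k, p < k → DirectSum.lof R ℕ X p c k = 0 := fun c k hk =>
      DirectSum.of_eq_of_ne p k c hk.ne'
    have hrest : ∀ k, p ≤ k → (x - DirectSum.lof R ℕ X p (x p)) k = 0 := by
      intro k hk
      rw [DirectSum.sub_apply]
      rcases hk.eq_or_lt with rfl | hk
      · rw [hself, sub_self]
      · rw [hx0 k hk, hne _ _ hk, sub_zero]
    have htop : D₀ p (x p) = 0 := by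
      have h := apply_eq_zero_of_forall_ge hlt hrest le_rfl
      rwa [map_sub, hx, DirectSum.sub_apply, hdiag, DirectSum.zero_apply, zero_sub,
        neg_eq_zero] at h
    obtain ⟨w, hw⟩ := hD₀ p _ htop
    obtain ⟨w', hw'⟩ := ih (x - D (DirectSum.lof R ℕ X p w)) (fun k hk => by
      rw [DirectSum.sub_apply]
      rcases hk.eq_or_lt with rfl | hk
      · rw [hdiag, hw, sub_self]
      · rw [hx0 k hk, hlt p k hk, sub_zero]) (by rw [map_sub, hx, hD, sub_zero])
    exact ⟨w' + DirectSum.lof R ℕ X p w, by rw [map_add, hw', sub_add_cancel]⟩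

end FilteredExactness

section Cone

variable {R : Type*} [CommRing R] {M N L : Type*} [AddCommGroup M] [Module R M]
  [AddCommGroup N] [Module R N] [AddCommGroup L] [Module R L]

/-- The endomorphism `(x, y) ↦ (p x, q x + r y)` of `M × N`. -/
def coneMap (p : M →ₗ[R] M) (q : M →ₗ[R] N) (r : N →ₗ[R] N) : M × N →ₗ[R] M × N :=
  LinearMap.inl R M N ∘ₗ p ∘ₗ LinearMap.fst R M N
    + (LinearMap.inr R M N ∘ₗ q ∘ₗ LinearMap.fst R M N
      + LinearMap.inr R M N ∘ₗ r ∘ₗ LinearMap.snd R M N)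

theorem coneMap_apply (p : M →ₗ[R] M) (q : M →ₗ[R] N) (r : N →ₗ[R] N) (x : M × N) :
    coneMap p q r x = (p x.1, q x.1 + r x.2) := by
  simp [coneMap]

variable {T : ℕ → Type*} [∀ n, AddCommGroup (T n)] [∀ n, Module R (T n)]

/-- The map `⨁ n, M ⊗ T n → ⨁ n, N ⊗ T n` induced by a linear map `M → N`. -/
noncomputable def mapCoeff (T : ℕ → Type*) [∀ n, AddCommGroup (T n)] [∀ n, Module R (T n)]
    (φ : M →ₗ[R] N) : (DirectSum ℕ fun n => M ⊗[R] T n) →ₗ[R] DirectSum ℕ fun n => N ⊗[R] T n :=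
  DirectSum.lmap fun _ => TensorProduct.map φ LinearMap.id

theorem mapCoeff_lof (φ : M →ₗ[R] N) (n : ℕ) (c : M ⊗[R] T n) :
    mapCoeff T φ (DirectSum.lof R ℕ (fun n => M ⊗[R] T n) n c)
      = DirectSum.lof R ℕ (fun n => N ⊗[R] T n) n (TensorProduct.map φ LinearMap.id c) :=
  DirectSum.lmap_lof ..

theorem mapCoeff_apply (φ : M →ₗ[R] N) (x : DirectSum ℕ fun n => M ⊗[R] T n) (n : ℕ) :
    mapCoeff T φ x n = TensorProduct.map φ LinearMap.id (x n) := rfl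

theorem mapCoeff_mapCoeff {ψ : N →ₗ[R] L} {φ : M →ₗ[R] N} {χ : M →ₗ[R] L} (h : ψ ∘ₗ φ = χ)
    (x : DirectSum ℕ fun n => M ⊗[R] T n) : mapCoeff T ψ (mapCoeff T φ x) = mapCoeff T χ x := by
  ext n
  rw [mapCoeff_apply, mapCoeff_apply, mapCoeff_apply, ← h, TensorProduct.map_map,
    LinearMap.comp_id]

theorem mapCoeff_id (x : DirectSum ℕ fun n => M ⊗[R] T n) : mapCoeff T LinearMap.id x = x := by
  ext n
  rw [mapCoeff_apply, TensorProduct.map_id, LinearMap.id_apply]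

theorem mapCoeff_zero (x : DirectSum ℕ fun n => M ⊗[R] T n) :
    mapCoeff T (0 : M →ₗ[R] N) x = 0 := by
  ext n
  rw [mapCoeff_apply, TensorProduct.map_zero_left, LinearMap.zero_apply, DirectSum.zero_apply]

/-- The mapping cone of a map of filtered complexes `⨁ n, M ⊗ T n → ⨁ n, N ⊗ T n` is exact if
the mapping cone of its coefficient part is exact, with flat terms and cycles. -/
theorem cone_exact
    {P : (DirectSum ℕ fun n => M ⊗[R] T n) →ₗ[R] DirectSum ℕ fun n => M ⊗[R] T n}
    {Q : (DirectSum ℕ fun n => M ⊗[R] T n) →ₗ[R] DirectSum ℕ fun n => N ⊗[R] T n}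
    {S : (DirectSum ℕ fun n => N ⊗[R] T n) →ₗ[R] DirectSum ℕ fun n => N ⊗[R] T n}
    (hPP : ∀ x, P (P x) = 0) (hSS : ∀ y, S (S y) = 0) (hQ : ∀ x, Q (P x) + S (Q x) = 0)
    (hP_lt : ∀ n k : ℕ, n < k → ∀ c, P (DirectSum.lof R ℕ (fun n => M ⊗[R] T n) n c) k = 0)
    (hQ_lt : ∀ n k : ℕ, n < k → ∀ c, Q (DirectSum.lof R ℕ (fun n => M ⊗[R] T n) n c) k = 0)
    (hS_lt : ∀ n k : ℕ, n < k → ∀ c, S (DirectSum.lof R ℕ (fun n => N ⊗[R] T n) n c) k = 0)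
    {p e₁ : M →ₗ[R] M} {q : M →ₗ[R] N} {r e₂ : N →ₗ[R] N} {δ : ∀ n, T n →ₗ[R] T n}
    (hP_diag : ∀ n c, P (DirectSum.lof R ℕ (fun n => M ⊗[R] T n) n c) n
      = TensorProduct.map p LinearMap.id c + TensorProduct.map e₁ (δ n) c)
    (hQ_diag : ∀ n c, Q (DirectSum.lof R ℕ (fun n => M ⊗[R] T n) n c) n
      = TensorProduct.map q LinearMap.id c)
    (hS_diag : ∀ n c, S (DirectSum.lof R ℕ (fun n => N ⊗[R] T n) n c) n
      = TensorProduct.map r LinearMap.id c + TensorProduct.map e₂ (δ n) c)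
    (hd : Function.Exact (coneMap p q r) (coneMap p q r)) [Module.Flat R (M × N)]
    [Module.Flat R (LinearMap.ker (coneMap p q r))]
    (hep : e₁ ∘ₗ p = -(p ∘ₗ e₁)) (heq : e₂ ∘ₗ q = -(q ∘ₗ e₁)) (her : e₂ ∘ₗ r = -(r ∘ₗ e₂))
    (hδ : ∀ n, δ n ∘ₗ δ n = 0) {x : DirectSum ℕ fun n => M ⊗[R] T n}
    {y : DirectSum ℕ fun n => N ⊗[R] T n} (hx : P x = 0) (hy : Q x + S y = 0) :
    ∃ x' y', P x' = x ∧ Q x' + S y' = y := by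
  let D : (DirectSum ℕ fun n => (M × N) ⊗[R] T n) →ₗ[R] DirectSum ℕ fun n => (M × N) ⊗[R] T n :=
    mapCoeff T (LinearMap.inl R M N) ∘ₗ P ∘ₗ mapCoeff T (LinearMap.fst R M N)
      + (mapCoeff T (LinearMap.inr R M N) ∘ₗ Q ∘ₗ mapCoeff T (LinearMap.fst R M N)
        + mapCoeff T (LinearMap.inr R M N) ∘ₗ S ∘ₗ mapCoeff T (LinearMap.snd R M N))
  have hDapp : ∀ v, D v = mapCoeff T (LinearMap.inl R M N) (P (mapCoeff T (LinearMap.fst R M N) v))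
      + mapCoeff T (LinearMap.inr R M N) (Q (mapCoeff T (LinearMap.fst R M N) v)
        + S (mapCoeff T (LinearMap.snd R M N) v)) := fun v => by
    rw [map_add]; rfl
  have hfst : ∀ u v, mapCoeff T (LinearMap.fst R M N) (mapCoeff T (LinearMap.inl R M N) u
      + mapCoeff T (LinearMap.inr R M N) v) = u := fun u v => by
    rw [map_add, mapCoeff_mapCoeff (LinearMap.fst_comp_inl R M N), mapCoeff_id,
      mapCoeff_mapCoeff (LinearMap.fst_comp_inr R M N), mapCoeff_zero, add_zero]
  have hsnd : ∀ u v, mapCoeff T (LinearMap.snd R M N) (mapCoeff T (LinearMap.inl R M N) u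
      + mapCoeff T (LinearMap.inr R M N) v) = v := fun u v => by
    rw [map_add, mapCoeff_mapCoeff (LinearMap.snd_comp_inl R M N), mapCoeff_zero,
      mapCoeff_mapCoeff (LinearMap.snd_comp_inr R M N), mapCoeff_id, zero_add]
  have hDfst : ∀ v, mapCoeff T (LinearMap.fst R M N) (D v)
      = P (mapCoeff T (LinearMap.fst R M N) v) := fun v => by rw [hDapp, hfst]
  have hDsnd : ∀ v, mapCoeff T (LinearMap.snd R M N) (D v)
      = Q (mapCoeff T (LinearMap.fst R M N) v) + S (mapCoeff T (LinearMap.snd R M N) v) :=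
    fun v => by rw [hDapp, hsnd]
  have hcomp : ∀ n (c : (M × N) ⊗[R] T n), TensorProduct.map (coneMap p q r) LinearMap.id c
      + TensorProduct.map (coneMap e₁ 0 e₂) (δ n) c = 0 → ∃ w,
        TensorProduct.map (coneMap p q r) LinearMap.id w
        + TensorProduct.map (coneMap e₁ 0 e₂) (δ n) w = c := fun n c hc => by
    refine exists_tensor_total_primitive hd (LinearMap.ext fun v => ?_) (hδ n) c hc
    have h1 := LinearMap.congr_fun hep v.1
    have h2 := LinearMap.congr_fun heq v.1
    have h3 := LinearMap.congr_fun her v.2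
    simp only [LinearMap.comp_apply, LinearMap.neg_apply] at h1 h2 h3
    rw [LinearMap.neg_apply, LinearMap.comp_apply, LinearMap.comp_apply]
    simp only [coneMap_apply, LinearMap.zero_apply, zero_add, map_add, h1, h2, h3, Prod.neg_mk,
      neg_add]
  obtain ⟨w, hw⟩ := exists_apply_eq_of_triangular (R := R) (D := D)
    (D₀ := fun n => TensorProduct.map (coneMap p q r) LinearMap.id
      + TensorProduct.map (coneMap e₁ 0 e₂) (δ n)) (fun v => by
        rw [hDapp (D v), hDfst, hDsnd, hPP, map_add S, hSS, add_zero, hQ, map_zero, map_zero,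
          add_zero])
      (fun n k hnk c => by
        rw [hDapp, DirectSum.add_apply, mapCoeff_apply, mapCoeff_apply, DirectSum.add_apply,
          mapCoeff_lof, mapCoeff_lof, hP_lt n k hnk, hQ_lt n k hnk, hS_lt n k hnk]
        simp only [map_zero, add_zero])
      (fun n c => by
        rw [hDapp, DirectSum.add_apply, mapCoeff_apply, mapCoeff_apply, DirectSum.add_apply,
          mapCoeff_lof, mapCoeff_lof, hP_diag, hQ_diag, hS_diag]
        simp only [map_add, TensorProduct.map_map, LinearMap.comp_id, LinearMap.id_comp,
          LinearMap.add_apply, coneMap, TensorProduct.map_add_left, LinearMap.zero_comp,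
          LinearMap.comp_zero, zero_add]
        abel)
      (fun n c hc => hcomp n c hc)
      (mapCoeff T (LinearMap.inl R M N) x + mapCoeff T (LinearMap.inr R M N) y) (by
        rw [hDapp, hfst, hsnd, hx, hy, map_zero, map_zero, add_zero])
  exact ⟨mapCoeff T (LinearMap.fst R M N) w, mapCoeff T (LinearMap.snd R M N) w,
    by rw [← hDfst, hw, hfst], by rw [← hDsnd, hw, hsnd]⟩

end Cone

section GradedCone

variable {R : Type} [CommRing R] {M N : Type} [AddCommGroup M] [Module R M]
  [AddCommGroup N] [Module R N] {grM : ℤ → Submodule R M} {grN : ℤ → Submodule R N}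

/-- A homogeneous map intertwines the projections to homogeneous components. -/
theorem map_gradedScale_single {φ : M →ₗ[R] N} {e : ℤ}
    (hφ : ∀ d, ∀ m ∈ grM d, φ m ∈ grN (d + e))
    (hgrM : DirectSum.IsInternal grM) (hgrN : DirectSum.IsInternal grN) (j : ℤ) (x : M) :
    φ (gradedScale hgrM (Pi.single j 1) x) = gradedScale hgrN (Pi.single (j + e) 1) (φ x) := by
  have h : φ ∘ₗ gradedScale hgrM (Pi.single j 1)
      = gradedScale hgrN (Pi.single (j + e) 1) ∘ₗ φ := by
    refine linearMap_ext_homogeneous hgrM fun d m hm => ?_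
    rw [LinearMap.comp_apply, LinearMap.comp_apply, gradedScale_apply hgrM _ hm,
      gradedScale_apply hgrN _ (hφ d m hm), map_smul, Pi.single_apply, Pi.single_apply]
    simp only [add_left_inj]
  exact LinearMap.congr_fun h x

theorem gradedScale_single_mem (hgrM : DirectSum.IsInternal grM) (j : ℤ) (x : M) :
    gradedScale hgrM (Pi.single j 1) x ∈ grM j := by
  have h : Submodule.comap (gradedScale hgrM (Pi.single j 1)) (grM j) = ⊤ := by
    rw [eq_top_iff, ← span_homogeneous hgrM, Submodule.span_le]
    rintro m ⟨d, hm⟩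
    rw [SetLike.mem_coe, Submodule.mem_comap, gradedScale_apply hgrM _ hm, Pi.single_apply]
    split_ifs with hd
    · exact Submodule.smul_mem _ _ (hd ▸ hm)
    · rw [zero_smul]
      exact Submodule.zero_mem _
  exact Submodule.mem_comap.mp (h ▸ Submodule.mem_top)

/-- Every element is the sum of its homogeneous components. -/
theorem exists_sum_gradedScale_single (hgrM : DirectSum.IsInternal grM) (x : M) :
    ∃ S : Finset ℤ, ∀ T, S ⊆ T → ∑ j ∈ T, gradedScale hgrM (Pi.single j 1) x = x := by
  have hx : x ∈ Submodule.span R {m : M | ∃ d, m ∈ grM d} := by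
    rw [span_homogeneous hgrM]
    trivial
  induction hx using Submodule.span_induction with
  | mem m h =>
    obtain ⟨d, hm⟩ := h
    refine ⟨{d}, fun T hT => ?_⟩
    simp only [gradedScale_apply hgrM _ hm, Pi.single_apply, ite_smul, one_smul, zero_smul]
    rw [Finset.sum_ite_eq, if_pos (hT (mem_singleton_self d))]
  | zero => exact ⟨∅, fun T _ => by simp⟩
  | add m m' _ _ h h' =>
    obtain ⟨S, hS⟩ := h
    obtain ⟨S', hS'⟩ := h'
    refine ⟨S ∪ S', fun T hT => ?_⟩
    simp only [map_add, sum_add_distrib]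
    rw [hS T (subset_union_left.trans hT), hS' T (subset_union_right.trans hT)]
  | smul c m _ h =>
    obtain ⟨S, hS⟩ := h
    refine ⟨S, fun T hT => ?_⟩
    simp only [map_smul]
    rw [← smul_sum, hS T hT]

/-- The mapping cone of a quasi-isomorphism of graded complexes is exact. -/
theorem coneMap_exact (hgrM : DirectSum.IsInternal grM) (hgrN : DirectSum.IsInternal grN) {e : ℤ}
    {p : M →ₗ[R] M} {q : M →ₗ[R] N} {r : N →ₗ[R] N}
    (hp : ∀ d, ∀ m ∈ grM d, p m ∈ grM (d + 1)) (hq : ∀ d, ∀ m ∈ grM d, q m ∈ grN (d + e))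
    (hr : ∀ d, ∀ m ∈ grN d, r m ∈ grN (d + 1))
    (hpp : ∀ x, p (p x) = 0) (hqp : ∀ x, q (p x) + r (q x) = 0) (hrr : ∀ y, r (r y) = 0)
    (hsurj : ∀ j, ∀ y ∈ grN (j + e), r y = 0 →
      ∃ x ∈ grM j, p x = 0 ∧ ∃ z ∈ grN (j + e - 1), q x - y = r z)
    (hinj : ∀ j, ∀ x ∈ grM j, p x = 0 → (∃ z ∈ grN (j + e - 1), q x = r z) →
      ∃ w ∈ grM (j - 1), x = p w) :
    Function.Exact (coneMap p q r) (coneMap p q r) := by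
  have hhom : ∀ j, ∀ x ∈ grM j, ∀ y ∈ grN (j + e - 1), p x = 0 → q x + r y = 0 →
      (x, y) ∈ LinearMap.range (coneMap p q r) := by
    intro j x hx y hy hpx hxy
    obtain ⟨w, hw, rfl⟩ := hinj j x hx hpx ⟨-y, Submodule.neg_mem _ hy, by
      rw [map_neg, ← add_eq_zero_iff_eq_neg, hxy]⟩
    have hcyc : r (y - q w) = 0 := by
      rw [map_sub, sub_eq_zero, ← add_right_inj (q (p w)), hxy, hqp]
    have hqw : q w ∈ grN (j - 1 + e) := hq _ w hw
    obtain ⟨x', -, hx', z, -, hz⟩ := hsurj (j - 1) (y - q w) (Submodule.sub_mem _ (by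
      rwa [sub_add_eq_add_sub]) hqw) hcyc
    refine ⟨(w + x', -z), ?_⟩
    rw [coneMap_apply, map_add, map_add, hx', add_zero, map_neg, ← hz]
    exact congrArg _ (by abel)
  rintro ⟨x, y⟩
  constructor
  · intro h
    rw [coneMap_apply, Prod.mk_eq_zero] at h
    obtain ⟨hx, hxy⟩ := h
    obtain ⟨S, hS⟩ := exists_sum_gradedScale_single hgrM x
    obtain ⟨S', hS'⟩ := exists_sum_gradedScale_single hgrN y
    have hT := hS (S ∪ S'.image fun j => j - e + 1) subset_union_left
    have hT' := hS' ((S ∪ S'.image fun j => j - e + 1).image fun j => j + e - 1) fun j hj =>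
      mem_image.mpr ⟨j - e + 1, mem_union_right _ (mem_image_of_mem _ hj), by ring⟩
    rw [sum_image fun a _ b _ h => by simpa using h] at hT'
    change (x, y) ∈ LinearMap.range (coneMap p q r)
    rw [← hT, ← hT', prod_mk_sum]
    refine Submodule.sum_mem _ fun j _ => hhom j _ (gradedScale_single_mem hgrM _ x) _
      (gradedScale_single_mem hgrN _ y) ?_ ?_
    · rw [map_gradedScale_single hp hgrM hgrM, hx, map_zero]
    · rw [map_gradedScale_single hq hgrM hgrN, map_gradedScale_single hr hgrN hgrN,
        sub_add_cancel, ← map_add, hxy, map_zero]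
  · rintro ⟨⟨x', y'⟩, h⟩
    rw [← h, coneMap_apply, coneMap_apply, hpp, map_add, hrr, add_zero, hqp]
    rfl

end GradedCone

section Comparison

variable {R : Type} [CommRing R] {A M N : Type} [AddCommGroup A] [Module R A]
  [AddCommGroup M] [Module R M] [AddCommGroup N] [Module R N]
  {gr : ℤ → Submodule R A} {grM : ℤ → Submodule R M} {grN : ℤ → Submodule R N}
  {μ : (n : ℕ) → (Fin n → A) → A} {μM : (r s : ℕ) → (Fin r → A) → M → (Fin s → A) → M}
  {μN : (r s : ℕ) → (Fin r → A) → N → (Fin s → A) → N}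
  {f : (r s : ℕ) → (Fin r → A) → M → (Fin s → A) → N} {dg : ℤ}

/-- On words, the map of Hochschild chains induced by `f`, corrected by the sign `(-1)^{dg j}` in
degree `j`, is given by wrapping words around their coefficient. -/
theorem IsFStar.degSign_wordElt (hgr : DirectSum.IsInternal gr) (hgrM : DirectSum.IsInternal grM)
    (hf : IsBimoduleMorphism R gr μ grM μM grN μN dg f) {F : HChain R A M →ₗ[R] HChain R A N}
    (hF : IsFStar R gr grM f dg F) (m : Letter grM) (L : List (Letter gr)) :
    F (degSign hgr hgrM dg (wordElt m L))
      = wrapOp letterPar degPar (letterMap f dg hf.2.1) wordElt m L := by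
  rw [wrapOp_letterMap_wordElt, AInfPaper.degSign_wordElt, map_zsmul, sgn_eq_parSign, wordDeg,
    ← sum_seqDeg, Int.cast_mul, Int.cast_add, wordPar_letterPar, degPar]
  exact congrArg _ (hF L.length m.1.1 (seqDeg L) m.1.2 (seqVal L) m.2 fun q hq => seqVal_mem L hq)

theorem IsFStar.degSign_hchElt (hgr : DirectSum.IsInternal gr) (hgrM : DirectSum.IsInternal grM)
    {F : HChain R A M →ₗ[R] HChain R A N} (hF : IsFStar R gr grM f dg F) {n : ℕ} {dm : ℤ}
    {d : ℕ → ℤ} {m : M} {a : ℕ → A} (hm : m ∈ grM dm) (ha : ∀ q, q < n → a q ∈ gr (d q)) :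
    F (degSign hgr hgrM dg (hchElt R n m a))
      = sgn (dg * (dm + ∑ q ∈ range n, (d q - 1))) • fstarFormula R f dg n dm d m a := by
  rw [degSign_apply hgr hgrM dg (Submodule.subset_span ⟨n, dm, d, m, a, hm, ha, rfl, rfl⟩),
    map_zsmul, hF n dm d m a hm ha, ← sgn_neg]
  ring_nf

/-- The leading term of the map of Hochschild chains induced by a bimodule map. -/
theorem IsFStar.component_lof (hgr : DirectSum.IsInternal gr) (hgrM : DirectSum.IsInternal grM)
    (hf : IsTriMultilinear R (f 0 0)) {F : HChain R A M →ₗ[R] HChain R A N}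
    (hF : IsFStar R gr grM f dg F) (n : ℕ) (c : HTens R A M n) :
    DirectSum.component R ℕ (fun k => HTens R A N k) n
        (F (degSign hgr hgrM dg (DirectSum.lof R ℕ (fun k => HTens R A M k) n c)))
      = TensorProduct.map (middleMap hf) LinearMap.id c := by
  have h : DirectSum.component R ℕ (fun k => HTens R A N k) n ∘ₗ F ∘ₗ degSign hgr hgrM dg ∘ₗ
        DirectSum.lof R ℕ (fun k => HTens R A M k) n
      = TensorProduct.map (middleMap hf) LinearMap.id := by
    refine htens_ext hgr hgrM fun dm d m a hm ha => ?_
    have h' := hF.degSign_hchElt hgr hgrM hm ha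
    rw [hchElt] at h'
    rw [LinearMap.comp_apply, LinearMap.comp_apply, LinearMap.comp_apply, h', map_zsmul,
      component_fstarFormula n hf, smul_smul, sgn_mul_self, one_smul, TensorProduct.map_tmul,
      LinearMap.id_apply]
  exact LinearMap.congr_fun h c

theorem IsFStar.component_lof_of_lt (hgr : DirectSum.IsInternal gr)
    (hgrM : DirectSum.IsInternal grM) {F : HChain R A M →ₗ[R] HChain R A N}
    (hF : IsFStar R gr grM f dg F) {n k : ℕ} (hnk : n < k) (c : HTens R A M n) :
    DirectSum.component R ℕ (fun k => HTens R A N k) k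
        (F (degSign hgr hgrM dg (DirectSum.lof R ℕ (fun k => HTens R A M k) n c))) = 0 := by
  have h : DirectSum.component R ℕ (fun k => HTens R A N k) k ∘ₗ F ∘ₗ degSign hgr hgrM dg ∘ₗ
        DirectSum.lof R ℕ (fun k => HTens R A M k) n = 0 := by
    refine htens_ext hgr hgrM fun dm d m a hm ha => ?_
    have h' := hF.degSign_hchElt hgr hgrM hm ha
    rw [hchElt] at h'
    rw [LinearMap.comp_apply, LinearMap.comp_apply, LinearMap.comp_apply, h', map_zsmul,
      component_fstarFormula_of_lt hnk, smul_zero, LinearMap.zero_apply]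
  exact LinearMap.congr_fun h c

theorem sgn_one : sgn 1 = -1 := rfl

/-- The mapping cone of the map of Hochschild chains induced by a quasi-isomorphism of
torsion-free bimodules is exact. -/
theorem IsFStar.cone_exact [IsDedekindDomain R] [Module.IsTorsionFree R M]
    [Module.IsTorsionFree R N] (hA : IsAInftyAlgebra R gr μ)
    (hM : IsAInftyBimodule R gr μ grM μM) (hN : IsAInftyBimodule R gr μ grN μN)
    (hgr : DirectSum.IsInternal gr) (hgrM : DirectSum.IsInternal grM)
    (hgrN : DirectSum.IsInternal grN)
    (hf : IsBimoduleMorphism R gr μ grM μM grN μN dg f)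
    {bM : HChain R A M →ₗ[R] HChain R A M} (hbM : IsHochschildB R gr μ grM μM bM)
    {bN : HChain R A N →ₗ[R] HChain R A N} (hbN : IsHochschildB R gr μ grN μN bN)
    {F : HChain R A M →ₗ[R] HChain R A N} (hF : IsFStar R gr grM f dg F)
    (hsurj : ∀ j, ∀ y ∈ grN (j + dg), middleMap (hN.1 0 0) y = 0 → ∃ x ∈ grM j,
      middleMap (hM.1 0 0) x = 0 ∧ ∃ z ∈ grN (j + dg - 1),
        middleMap (hf.1 0 0) x - y = middleMap (hN.1 0 0) z)
    (hinj : ∀ j, ∀ x ∈ grM j, middleMap (hM.1 0 0) x = 0 →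
      (∃ z ∈ grN (j + dg - 1), middleMap (hf.1 0 0) x = middleMap (hN.1 0 0) z) →
      ∃ w ∈ grM (j - 1), x = middleMap (hM.1 0 0) w)
    {x : HChain R A M} {y : HChain R A N} (hx : bM x = 0)
    (hy : F (degSign hgr hgrM dg x) + bN y = 0) :
    ∃ x' y', bM x' = -(sgn dg • x) ∧ F (degSign hgr hgrM dg x') + bN y' = y := by
  obtain ⟨c, hc⟩ : ∃ c : R, c = -((sgn dg : ℤ) : R) := ⟨_, rfl⟩
  have hcc : c * c = 1 := by
    rw [hc, neg_mul_neg, ← Int.cast_mul, sgn_mul_self, Int.cast_one]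
  have hcs : ∀ {V : Type} [AddCommGroup V] [Module R V] (v : V), c • v = -(sgn dg • v) :=
    fun v => by rw [hc, neg_smul, Int.cast_smul_eq_zsmul]
  have hc0 : ∀ {V : Type} [AddCommGroup V] [Module R V] {v : V}, c • v = 0 → v = 0 :=
    fun {V} _ _ {v} h => by rw [← one_smul R v, ← hcc, mul_smul, h, smul_zero]
  have hMM : ∀ x, middleMap (hM.1 0 0) (middleMap (hM.1 0 0) x) = 0 :=
    LinearMap.congr_fun (hM.middleMap_comp_self hgrM)
  have hNN : ∀ x, middleMap (hN.1 0 0) (middleMap (hN.1 0 0) x) = 0 :=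
    LinearMap.congr_fun (hN.middleMap_comp_self hgrN)
  have hMN : ∀ x, middleMap (hN.1 0 0) (middleMap (hf.1 0 0) x)
      = sgn dg • middleMap (hf.1 0 0) (middleMap (hM.1 0 0) x) :=
    LinearMap.congr_fun (hf.middleMap_comm hM.1 hN.1 hgrM)
  have hmemM : ∀ d, ∀ m ∈ grM d, middleMap (hM.1 0 0) m ∈ grM (d + 1) := fun d m hm =>
    middleMap_mem hM.2.1 (hM.1 0 0) hm
  have hmemN : ∀ d, ∀ m ∈ grN d, middleMap (hN.1 0 0) m ∈ grN (d + 1) := fun d m hm =>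
    middleMap_mem hN.2.1 (hN.1 0 0) hm
  have hmemf : ∀ d, ∀ m ∈ grM d, middleMap (hf.1 0 0) m ∈ grN (d + dg) := fun d m hm =>
    middleMap_mem hf.2.1 (hf.1 0 0) hm
  have hd : Function.Exact
      (coneMap (c • middleMap (hM.1 0 0)) (middleMap (hf.1 0 0)) (middleMap (hN.1 0 0)))
      (coneMap (c • middleMap (hM.1 0 0)) (middleMap (hf.1 0 0)) (middleMap (hN.1 0 0))) := by
    refine coneMap_exact hgrM hgrN (fun d m hm => Submodule.smul_mem _ c (hmemM d m hm)) hmemf hmemN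
      (fun x => ?_) (fun x => ?_) hNN (fun j y hy h => ?_) (fun j x hx h h' => ?_)
    · rw [LinearMap.smul_apply, LinearMap.smul_apply, map_smul, hMM, smul_zero, smul_zero]
    · rw [LinearMap.smul_apply, map_smul, hcs, hMN, neg_add_cancel]
    · obtain ⟨x, hx, hx0, h'⟩ := hsurj j y hy h
      exact ⟨x, hx, by rw [LinearMap.smul_apply, hx0, smul_zero], h'⟩
    · obtain ⟨w, hw, rfl⟩ := hinj j x hx (hc0 h) h'
      exact ⟨c • w, Submodule.smul_mem _ c hw, by
        rw [LinearMap.smul_apply, map_smul, smul_smul, hcc, one_smul]⟩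
  have hchain : ∀ x, bN (F (degSign hgr hgrM dg x))
      = sgn dg • F (degSign hgr hgrM dg (bM x)) := LinearMap.congr_fun (f := bN ∘ₗ F ∘ₗ
        degSign hgr hgrM dg) (g := sgn dg • (F ∘ₗ degSign hgr hgrM dg ∘ₗ bM)) <|
    hchain_ext hgr hgrM fun m L => IsBimoduleMorphism.comm_wordElt hA hM hN hf hbM hbN
      (F := F ∘ₗ degSign hgr hgrM dg) (hF.degSign_wordElt hgr hgrM hf) m L
  have hbMM : ∀ x, bM (bM x) = 0 := LinearMap.congr_fun (f := bM ∘ₗ bM) (g := 0) <|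
    hchain_ext hgr hgrM fun m L => hbM.sq_wordElt hA hM m L
  have hbNN : ∀ x, bN (bN x) = 0 := LinearMap.congr_fun (f := bN ∘ₗ bN) (g := 0) <|
    hchain_ext hgr hgrN fun m L => hbN.sq_wordElt hA hN m L
  have : Module.IsTorsionFree R (LinearMap.ker
      (coneMap (c • middleMap (hM.1 0 0)) (middleMap (hf.1 0 0)) (middleMap (hN.1 0 0)))) :=
    Function.Injective.moduleIsTorsionFree _ (Submodule.subtype_injective _) fun _ _ => rfl
  obtain ⟨x', y', hx', hy'⟩ := AInfPaper.cone_exact (P := c • bM)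
    (Q := F ∘ₗ degSign hgr hgrM dg) (S := bN) (p := c • middleMap (hM.1 0 0))
    (q := middleMap (hf.1 0 0)) (r := middleMap (hN.1 0 0))
    (e₁ := c • gradedScale hgrM fun d => (sgn (d + 0) : R))
    (e₂ := gradedScale hgrN fun d => (sgn (d + 0) : R))
    (δ := tensorDeriv (gradedScale hgr fun d => (sgn (d + -1) : R)) (unaryMap (hA.1 1)))
    (fun x => by
      rw [LinearMap.smul_apply, LinearMap.smul_apply, map_smul, hbMM, smul_zero, smul_zero])
    hbNN
    (fun x => by
      rw [LinearMap.comp_apply, LinearMap.comp_apply, LinearMap.smul_apply, map_smul, map_smul,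
        hcs, hchain, neg_add_cancel])
    (fun n k hnk v => (congrArg (c • ·) (hbM.component_lof_of_lt hgr hgrM hnk v)).trans
      (smul_zero c))
    (fun n k hnk v => hF.component_lof_of_lt hgr hgrM hnk v)
    (fun n k hnk v => hbN.component_lof_of_lt hgr hgrN hnk v)
    (fun n v => by
      refine (congrArg (c • ·) (hbM.component_lof hA hM.1 hgr hgrM n v)).trans ?_
      simp only [smul_add, TensorProduct.map_smul_left, LinearMap.smul_apply])
    (fun n v => hF.component_lof hgr hgrM (hf.1 0 0) n v)
    (fun n v => hbN.component_lof hA hN.1 hgr hgrN n v)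
    hd
    (by
      rw [LinearMap.smul_comp, LinearMap.comp_smul, gradedScale_comp hmemM hgrM hgrM 0, sgn_one,
        neg_one_smul, LinearMap.smul_comp, LinearMap.comp_smul, smul_neg, smul_neg])
    (by
      rw [gradedScale_comp hmemf hgrM hgrN 0, LinearMap.comp_smul, hcs, neg_neg])
    (by rw [gradedScale_comp hmemN hgrN hgrN 0, sgn_one, neg_one_smul])
    (fun n => tensorDeriv_sq (hA.unaryMap_comp_self hgr) (by
      rw [gradedScale_comp (fun d a => hA.unaryMap_mem) hgr hgr (-1), sgn_one, neg_one_smul]) n)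
    (x := x) (y := y) (by rw [LinearMap.smul_apply, hx, smul_zero]) hy
  refine ⟨x', y', ?_, hy'⟩
  rw [← hx', ← hcs, LinearMap.smul_apply, smul_smul, hcc, one_smul]

end Comparison

section

variable (R : Type) [CommRing R]

/-- Theorem 2.16 of the paper, after Getzler–Jones.  Let `A` be an
`A∞`-algebra over `ℤ`, `M`, `N` torsion-free `A∞`-bimodules over `A` and
`f = (f_{r,s}) : M → N` a morphism of `A∞`-bimodules, `f₁ = f_{0,0}`.  If the map
induced by `f₁` on the cohomology of `(M, μ^M_{0,0})` and `(N, μ^N_{0,0})` is an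
isomorphism of graded abelian groups (stated elementwise: surjectivity up to boundaries
and injectivity modulo boundaries, in every degree), then the map induced by
`f_* : CH_*(A;M) → CH_*(A;N)` on Hochschild homology is an isomorphism of graded abelian
groups (again stated elementwise, in every degree). -/
theorem quasi_iso_criterion
    {A M N : Type} [AddCommGroup A] [AddCommGroup M]
    [AddCommGroup N]
    (gr : ℤ → Submodule ℤ A) (μ : (n : ℕ) → (Fin n → A) → A)
    (grM : ℤ → Submodule ℤ M) (μM : (r s : ℕ) → (Fin r → A) → M → (Fin s → A) → M)
    (grN : ℤ → Submodule ℤ N) (μN : (r s : ℕ) → (Fin r → A) → N → (Fin s → A) → N)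
    (hA : IsAInftyAlgebra ℤ gr μ)
    (hM : IsAInftyBimodule ℤ gr μ grM μM) (hN : IsAInftyBimodule ℤ gr μ grN μN)
    (hgr : DirectSum.IsInternal gr) (hgrM : DirectSum.IsInternal grM)
    (hgrN : DirectSum.IsInternal grN)
    (htfM : ∀ (c : ℤ) (x : M), c • x = 0 → c = 0 ∨ x = 0)
    (htfN : ∀ (c : ℤ) (x : N), c • x = 0 → c = 0 ∨ x = 0)
    (dg : ℤ) (f : (r s : ℕ) → (Fin r → A) → M → (Fin s → A) → N)
    (hf : IsBimoduleMorphism ℤ gr μ grM μM grN μN dg f)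
    (bM : HChain ℤ A M →ₗ[ℤ] HChain ℤ A M) (hbM : IsHochschildB ℤ gr μ grM μM bM)
    (bN : HChain ℤ A N →ₗ[ℤ] HChain ℤ A N) (hbN : IsHochschildB ℤ gr μ grN μN bN)
    (F : HChain ℤ A M →ₗ[ℤ] HChain ℤ A N) (hF : IsFStar ℤ gr grM f dg F)
    -- `(f₁)_* : H^*(M, μ^M₀₀) → H^*(N, μ^N₀₀)` is an isomorphism of graded groups:
    (hqis : ∀ j : ℤ,
      (∀ y ∈ grN (j + dg), μN 0 0 (fun i => i.elim0) y (fun i => i.elim0) = 0 →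
        ∃ x ∈ grM j, μM 0 0 (fun i => i.elim0) x (fun i => i.elim0) = 0 ∧
          ∃ z ∈ grN (j + dg - 1),
            f 0 0 (fun i => i.elim0) x (fun i => i.elim0) - y
              = μN 0 0 (fun i => i.elim0) z (fun i => i.elim0)) ∧
      (∀ x ∈ grM j, μM 0 0 (fun i => i.elim0) x (fun i => i.elim0) = 0 →
        (∃ z ∈ grN (j + dg - 1),
            f 0 0 (fun i => i.elim0) x (fun i => i.elim0)
              = μN 0 0 (fun i => i.elim0) z (fun i => i.elim0)) →
        ∃ w ∈ grM (j - 1), x = μM 0 0 (fun i => i.elim0) w (fun i => i.elim0))) :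
    -- then `[f_*] : HH_*(A;M) → HH_*(A;N)` is an isomorphism of graded groups:
    ∀ j : ℤ,
      (∀ y ∈ hchDeg ℤ gr grN (j - dg), bN y = 0 →
        ∃ x ∈ hchDeg ℤ gr grM j, bM x = 0 ∧
          ∃ z ∈ hchDeg ℤ gr grN (j - dg + 1), F x - y = bN z) ∧
      (∀ x ∈ hchDeg ℤ gr grM j, bM x = 0 →
        (∃ z ∈ hchDeg ℤ gr grN (j - dg + 1), F x = bN z) →
        ∃ w ∈ hchDeg ℤ gr grM (j + 1), x = bM w) := by
  have := Module.IsTorsionFree.of_smul_eq_zero htfM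
  have := Module.IsTorsionFree.of_smul_eq_zero htfN
  have hcone := fun {x y} => hF.cone_exact (x := x) (y := y) hA hM hN hgr hgrM hgrN hf hbM hbN
    (fun j => (hqis j).1) (fun j => (hqis j).2)
  have hprojM := degProj_map hgr hgrM hgrM (hbM.wordElt_mem hA hM)
  have hprojN := degProj_map hgr hgrN hgrN (hbN.wordElt_mem hA hN)
  have hprojF := degProj_map hgr hgrM hgrN (G := F ∘ₗ degSign hgr hgrM dg) (e := -dg) fun m L => by
    rw [LinearMap.comp_apply, hF.degSign_wordElt hgr hgrM hf]
    exact wrapOp_wordElt_mem hf.2.1 m L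
  refine fun j => ⟨fun y hy hy0 => ?_, fun x hx hx0 ⟨z, _, hz⟩ => ?_⟩
  · obtain ⟨x', y', hx', hy'⟩ := hcone (x := 0) (y := y) (map_zero _)
      (by rw [map_zero, map_zero, hy0, add_zero])
    have hmem := degProj_mem hgr hgrM j x'
    refine ⟨sgn (dg * j) • degProj hgr hgrM j x', zsmul_mem hmem _, ?_,
      -degProj hgr hgrN (j - dg + 1) y',
      Submodule.neg_mem _ (degProj_mem hgr hgrN _ _), ?_⟩
    · rw [map_zsmul, ← hprojM, hx', smul_zero, neg_zero, map_zero, smul_zero]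
    · rw [map_zsmul, ← map_zsmul F, ← degSign_apply hgr hgrM dg hmem, ← LinearMap.comp_apply,
        ← hprojF, map_neg, ← hprojN, add_neg_cancel_right, ← sub_eq_add_neg, LinearMap.comp_apply,
        ← degProj_eq_self hgr hgrN hy, ← hy', map_add, sub_add_cancel_left]
  · obtain ⟨x', -, hx', -⟩ := hcone (x := x) (y := -(sgn (dg * j) • z)) hx0 (by
      rw [degSign_apply hgr hgrM dg hx, map_zsmul, hz, map_neg, map_zsmul, add_neg_cancel])
    refine ⟨-(sgn dg • degProj hgr hgrM (j + 1) x'),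
      Submodule.neg_mem _ (zsmul_mem (degProj_mem hgr hgrM _ _) _), ?_⟩
    rw [map_neg, map_zsmul, ← hprojM, hx', add_neg_cancel_right, map_neg, map_zsmul,
      degProj_eq_self hgr hgrM hx, smul_neg, neg_neg, smul_smul, sgn_mul_self, one_smul]

end

end AInfPaper
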